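/- Let φ ∈ 𝒮(ℝ^n), let b be a Lipschitz function on ℝ^n with ∇b ∈ L^∞(ℝ^n), and let f be continuously differentiable with compact support. Then for every 1 < p < ∞, sup_{λ>0} ‖λ √(N_λ({∇[b,Φ_k]f}_{k∈ℤ}))‖_{L^p(ℝ^n)} ≤ C_{p,n} ‖∇b‖_{L^∞} ‖f‖_{L^p(ℝ^n)}. -/

import Mathlib

open MeasureTheory ENNReal NNReal
noncomputable section

/-- The λ-jump count `N_λ(F)(x)` of a family of functions `F : I → α → E`,
valued in `ℝ≥0∞`. -/
def jumpCountE {I α E : Type*} [LinearOrder I] [NormedAddCommGroup E]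
    (F : I → α → E) (lam : ℝ) (x : α) : ℝ≥0∞ :=
  ⨆ (N : ℕ) (_ : ∃ t : Fin (N + 1) → I, StrictMono t ∧
      ∀ k : Fin N, lam < ‖F (t k.succ) x - F (t k.castSucc) x‖), (N : ℝ≥0∞)

/-- `Φ_k g = φ_k ∗ g` where `φ_k(x) = 2^{-kn} φ(2^{-k} x)`, for scalar functions. -/
def schwartzConv (n : ℕ) (φ : SchwartzMap (EuclideanSpace ℝ (Fin n)) ℝ) (k : ℤ)
    (g : EuclideanSpace ℝ (Fin n) → ℝ) (x : EuclideanSpace ℝ (Fin n)) : ℝ :=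
  ∫ y, (2:ℝ) ^ (-(k * (n:ℤ))) * φ ((2:ℝ) ^ (-k) • (x - y)) * g y

/-- `Φ_k g = φ_k ∗ g` for `ℝⁿ`-valued functions `g` (componentwise). -/
def schwartzConvVec (n : ℕ) (φ : SchwartzMap (EuclideanSpace ℝ (Fin n)) ℝ) (k : ℤ)
    (g : EuclideanSpace ℝ (Fin n) → EuclideanSpace ℝ (Fin n))
    (x : EuclideanSpace ℝ (Fin n)) : EuclideanSpace ℝ (Fin n) :=
  ∫ y, ((2:ℝ) ^ (-(k * (n:ℤ))) * φ ((2:ℝ) ^ (-k) • (x - y))) • g y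


-- part 1
namespace JV

/-! ### Part 1: the jump functional -/

open Classical in
/-- Indicator of a proposition. -/
def ind (p : Prop) : ℝ≥0∞ := if p then 1 else 0

lemma ind_le_one (p : Prop) : ind p ≤ 1 := by
  unfold ind; split_ifs <;> simp

lemma ind_true {p : Prop} (h : p) : ind p = 1 := by simp [ind, h]

lemma ind_false {p : Prop} (h : ¬ p) : ind p = 0 := by simp [ind, h]

lemma ind_mono {p q : Prop} (h : p → q) : ind p ≤ ind q := by
  by_cases hp : p
  · rw [ind_true hp, ind_true (h hp)]
  · rw [ind_false hp]; exact zero_le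

lemma ind_or_le {p q r : Prop} (h : p → q ∨ r) : ind p ≤ ind q + ind r := by
  by_cases hp : p
  · rcases h hp with hq | hr
    · rw [ind_true hp, ind_true hq]; exact le_self_add
    · rw [ind_true hp, ind_true hr]; exact le_add_self
  · rw [ind_false hp]; exact zero_le

lemma ind_exists_le {ι : Type*} (s : Finset ι) {p : Prop} {q : ι → Prop}
    (h : p → ∃ i ∈ s, q i) : ind p ≤ ∑ i ∈ s, ind (q i) := by
  by_cases hp : p
  · obtain ⟨i, hi, hq⟩ := h hp
    rw [ind_true hp, ← ind_true hq]
    exact Finset.single_le_sum (f := fun i => ind (q i)) (fun _ _ => zero_le) hi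
  · rw [ind_false hp]; exact zero_le

/-- Count along a list. -/
def jr (D : ℤ → ℤ → Prop) : (ℤ → Prop) → List ℤ → ℝ≥0∞
  | _, [] => 0
  | p, a :: l => ind (p a) + jr D (D a) l

/-- Admissible lists: strictly descending with values in `[m, K]`. -/
def adm (m K : ℤ) (l : List ℤ) : Prop := l.Pairwise (· > ·) ∧ ∀ a ∈ l, m ≤ a ∧ a ≤ K

/-- The abstract jump functional. -/
def WD (D : ℤ → ℤ → Prop) (p : ℤ → Prop) (m K : ℤ) : ℝ≥0∞ :=
  ⨆ (l : List ℤ) (_ : adm m K l), jr D p l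

lemma le_WD {D : ℤ → ℤ → Prop} {p : ℤ → Prop} {m K : ℤ} {l : List ℤ} (h : adm m K l) :
    jr D p l ≤ WD D p m K := le_iSup₂ (f := fun l (_ : adm m K l) => jr D p l) l h

lemma jr_dom {ι : Type*} (s : Finset ι) {D : ℤ → ℤ → Prop} {D' : ι → ℤ → ℤ → Prop}
    (hD : ∀ a b, D a b → ∃ i ∈ s, D' i a b) (l : List ℤ) :
    ∀ {p : ℤ → Prop} {p' : ι → ℤ → Prop}, (∀ a, p a → ∃ i ∈ s, p' i a) →
    jr D p l ≤ ∑ i ∈ s, jr (D' i) (p' i) l := by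
  induction l with
  | nil => intro p p' h; simp [jr]
  | cons a l ih =>
    intro p p' h
    simp only [jr, Finset.sum_add_distrib]
    exact add_le_add (ind_exists_le s (h a)) (ih (hD a))

lemma WD_dom {ι : Type*} (s : Finset ι) {D : ℤ → ℤ → Prop} {D' : ι → ℤ → ℤ → Prop}
    {p : ℤ → Prop} {p' : ι → ℤ → Prop}
    (hD : ∀ a b, D a b → ∃ i ∈ s, D' i a b) (hp : ∀ a, p a → ∃ i ∈ s, p' i a) (m K : ℤ) :
    WD D p m K ≤ ∑ i ∈ s, WD (D' i) (p' i) m K := by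
  refine iSup₂_le fun l hl => (jr_dom s hD l hp).trans ?_
  exact Finset.sum_le_sum fun i _ => le_WD hl

lemma WD_dom2 {D D1 D2 : ℤ → ℤ → Prop} {p p1 p2 : ℤ → Prop}
    (hD : ∀ a b, D a b → D1 a b ∨ D2 a b) (hp : ∀ a, p a → p1 a ∨ p2 a) (m K : ℤ) :
    WD D p m K ≤ WD D1 p1 m K + WD D2 p2 m K := by
  have := WD_dom (Finset.univ : Finset Bool) (D := D) (p := p)
    (D' := fun b => if b then D1 else D2) (p' := fun b => if b then p1 else p2)
    (fun a b h => by
      rcases hD a b h with h | h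
      · exact ⟨true, Finset.mem_univ _, by simpa using h⟩
      · exact ⟨false, Finset.mem_univ _, by simpa using h⟩)
    (fun a h => by
      rcases hp a h with h | h
      · exact ⟨true, Finset.mem_univ _, by simpa using h⟩
      · exact ⟨false, Finset.mem_univ _, by simpa using h⟩) m K
  simpa using this

lemma jr_append {D : ℤ → ℤ → Prop} {p : ℤ → Prop} (hDp : ∀ a b, D a b → p a ∨ p b)
    {c : ℝ≥0∞} (l1 l2 : List ℤ) (hne : l1 ≠ []) (hc : ∀ a ∈ l1, ind (p a) ≤ c) :
    ∀ q : ℤ → Prop, jr D q (l1 ++ l2) ≤ jr D q l1 + c + jr D p l2 := by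
  induction l1 with
  | nil => exact absurd rfl hne
  | cons a l ih =>
    intro q
    rcases l with _ | ⟨b, l⟩
    · simp only [List.cons_append, List.nil_append, jr, add_zero]
      rw [add_assoc]
      gcongr
      rcases l2 with _ | ⟨b, l2⟩
      · simp [jr]
      · simp only [jr, ← add_assoc]
        gcongr
        refine (ind_or_le (hDp a b)).trans ?_
        gcongr
        exact hc a (by simp)
    · have := ih (by simp) (fun a ha => hc a (List.mem_cons_of_mem _ ha)) (D a)
      rw [List.cons_append, jr]
      conv_rhs => rw [jr]
      calc _ ≤ ind (q a) + (jr D (D a) (b :: l) + c + jr D p l2) := by gcongr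
        _ = _ := by ring

lemma list_split (j : ℤ) (l : List ℤ) (h : l.Pairwise (· > ·)) :
    ∃ l1 l2, l = l1 ++ l2 ∧ (∀ a ∈ l1, j < a) ∧ (∀ a ∈ l2, a ≤ j) := by
  induction l with
  | nil => exact ⟨[], [], by simp⟩
  | cons a l ih =>
    rw [List.pairwise_cons] at h
    by_cases ha : j < a
    · obtain ⟨l1, l2, h1, h2, h3⟩ := ih h.2
      refine ⟨a :: l1, l2, by simp [h1], ?_, h3⟩
      intro b hb
      rcases List.mem_cons.1 hb with rfl | hb
      · exact ha
      · exact h2 b hb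
    · refine ⟨[], a :: l, by simp, by simp, ?_⟩
      intro b hb
      rcases List.mem_cons.1 hb with rfl | hb
      · omega
      · have := h.1 b hb; omega

lemma WD_split {D : ℤ → ℤ → Prop} {p : ℤ → Prop} (hDp : ∀ a b, D a b → p a ∨ p b)
    (m j K : ℤ) : WD D p m K ≤ WD D p m j + 2 * WD D p (j + 1) K := by
  refine iSup₂_le fun l hl => ?_
  obtain ⟨l1, l2, rfl, h1, h2⟩ := list_split j l hl.1
  have hp := List.pairwise_append.1 hl.1
  have a1 : adm (j + 1) K l1 := ⟨hp.1, fun a ha => ⟨by have := h1 a ha; omega,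
    (hl.2 a (by simp [ha])).2⟩⟩
  have a2 : adm m j l2 := ⟨hp.2.1, fun a ha => ⟨(hl.2 a (by simp [ha])).1, h2 a ha⟩⟩
  by_cases hne : l1 = []
  · subst hne
    simp only [List.nil_append]
    exact (le_WD a2).trans le_self_add
  · have := jr_append hDp (c := WD D p (j + 1) K) l1 l2 hne (fun a ha => by
      have h3 : adm (j + 1) K [a] := ⟨by simp, by simpa using a1.2 a ha⟩
      refine le_trans ?_ (le_WD h3)
      simp [jr]) p
    refine this.trans ?_
    calc _ ≤ WD D p (j + 1) K + WD D p (j + 1) K + WD D p m j := by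
          gcongr
          · exact le_WD a1
          · exact le_WD a2
      _ = _ := by ring

lemma WD_mono {D : ℤ → ℤ → Prop} {p : ℤ → Prop} {m m' K K' : ℤ} (hm : m' ≤ m) (hK : K ≤ K') :
    WD D p m K ≤ WD D p m' K' := by
  refine iSup₂_le fun l hl => le_WD ⟨hl.1, fun a ha => ?_⟩
  have := hl.2 a ha
  omega

lemma jr_le_sum {D : ℤ → ℤ → Prop} {p : ℤ → Prop} (hDp : ∀ a b, D a b → p a ∨ p b)
    (l : List ℤ) : ∀ (q : ℤ → Prop) (c : ℝ≥0∞), (∀ a, ind (q a) ≤ c + ind (p a)) →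
    jr D q l ≤ c + 2 * (l.map fun a => ind (p a)).sum := by
  induction l with
  | nil => intro q c _; simp [jr]
  | cons a l ih =>
    intro q c h
    simp only [jr, List.map_cons, List.sum_cons]
    calc _ ≤ (c + ind (p a)) + (ind (p a) + 2 * (l.map fun a => ind (p a)).sum) := by
          gcongr
          · exact h a
          · exact ih _ _ (fun b => ind_or_le (hDp a b))
      _ = _ := by ring

lemma WD_le_sum {D : ℤ → ℤ → Prop} {p : ℤ → Prop} (hDp : ∀ a b, D a b → p a ∨ p b)
    (m K : ℤ) : WD D p m K ≤ 2 * ∑ k ∈ Finset.Icc m K, ind (p k) := by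
  refine iSup₂_le fun l hl => (jr_le_sum hDp l p 0 (by simp)).trans ?_
  rw [zero_add]
  gcongr
  have hnd : l.Nodup := hl.1.imp (fun h => ne_of_gt h)
  rw [← List.sum_toFinset _ hnd]
  refine Finset.sum_le_sum_of_subset fun a ha => ?_
  simpa using hl.2 a (by simpa using ha)

/-- Jump relation of a real sequence. -/
def JD (lam : ℝ) (F : ℤ → ℝ) : ℤ → ℤ → Prop := fun a b => lam < |F a - F b|
/-- Large value relation of a real sequence. -/
def JP (lam : ℝ) (F : ℤ → ℝ) : ℤ → Prop := fun a => lam / 2 < |F a|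
/-- The jump functional of a real sequence on `[m, K]`. -/
def W (lam : ℝ) (F : ℤ → ℝ) (m K : ℤ) : ℝ≥0∞ := WD (JD lam F) (JP lam F) m K

lemma JDP (lam : ℝ) (F : ℤ → ℝ) : ∀ a b, JD lam F a b → JP lam F a ∨ JP lam F b := by
  intro a b h
  unfold JD at h
  unfold JP
  by_contra! hh
  have := abs_sub (F a) (F b)
  linarith [hh.1, hh.2]

lemma W_add (lam : ℝ) (F G : ℤ → ℝ) (m K : ℤ) :
    W lam (fun k => F k + G k) m K ≤ W (lam / 2) F m K + W (lam / 2) G m K := by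
  refine WD_dom2 ?_ ?_ m K
  · intro a b h
    unfold JD at h ⊢
    by_contra! hh
    have := abs_add_le (F a - F b) (G a - G b)
    rw [show F a - F b + (G a - G b) = F a + G a - (F b + G b) by ring] at this
    linarith [hh.1, hh.2]
  · intro a h
    unfold JP at h ⊢
    by_contra! hh
    have := abs_add_le (F a) (G a)
    linarith [hh.1, hh.2]

lemma W_split (lam : ℝ) (F : ℤ → ℝ) (m j K : ℤ) :
    W lam F m K ≤ W lam F m j + 2 * W lam F (j + 1) K := WD_split (JDP lam F) m j K

lemma W_mono {lam : ℝ} {F : ℤ → ℝ} {m m' K K' : ℤ} (hm : m' ≤ m) (hK : K ≤ K') :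
    W lam F m K ≤ W lam F m' K' := WD_mono hm hK

lemma W_congr {lam : ℝ} {F G : ℤ → ℝ} {m K : ℤ} (h : ∀ k, m ≤ k → k ≤ K → F k = G k) :
    W lam F m K = W lam G m K := by
  have key : ∀ {F G : ℤ → ℝ}, (∀ k, m ≤ k → k ≤ K → F k = G k) → W lam F m K ≤ W lam G m K := by
    intro F G h
    refine iSup₂_le fun l hl => ?_
    refine le_trans ?_ (le_WD hl)
    have : ∀ l : List ℤ, (∀ a ∈ l, m ≤ a ∧ a ≤ K) → ∀ p q : ℤ → Prop,
        (∀ k, m ≤ k → k ≤ K → (p k → q k)) →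
        jr (JD lam F) p l ≤ jr (JD lam G) q l := by
      intro l
      induction l with
      | nil => intros; simp [jr]
      | cons a l ih =>
        intro hl p q hpq
        have ha := hl a (by simp)
        simp only [jr]
        refine add_le_add (ind_mono (hpq a ha.1 ha.2)) (ih (fun b hb => hl b (by simp [hb])) _ _ ?_)
        intro k h1 h2 h3
        unfold JD at *
        rwa [← h a ha.1 ha.2, ← h k h1 h2]
    refine this l hl.2 _ _ ?_
    intro k h1 h2 h3
    unfold JP at *
    rwa [← h k h1 h2]
  exact le_antisymm (key h) (key fun k h1 h2 => (h k h1 h2).symm)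

lemma W_sq {lam : ℝ} (hl : 0 < lam) (F : ℤ → ℝ) (m K : ℤ) :
    ENNReal.ofReal (lam ^ 2) * W lam F m K ≤
      ∑ k ∈ Finset.Icc m K, ENNReal.ofReal (8 * (F k) ^ 2) := by
  calc _ ≤ ENNReal.ofReal (lam ^ 2) * (2 * ∑ k ∈ Finset.Icc m K, ind (JP lam F k)) := by
        gcongr; exact WD_le_sum (JDP lam F) m K
    _ = ∑ k ∈ Finset.Icc m K, ENNReal.ofReal (lam ^ 2) * (2 * ind (JP lam F k)) := by
        rw [Finset.mul_sum, Finset.mul_sum]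
    _ ≤ _ := by
        refine Finset.sum_le_sum fun k _ => ?_
        by_cases h : JP lam F k
        · rw [ind_true h, mul_one, show (2 : ℝ≥0∞) = ENNReal.ofReal 2 by simp,
            ← ENNReal.ofReal_mul (by positivity)]
          apply ENNReal.ofReal_le_ofReal
          unfold JP at h
          have : (lam / 2) ^ 2 ≤ |F k| ^ 2 := by gcongr
          rw [sq_abs] at this
          nlinarith
        · rw [ind_false h]; simp

/-- product trick -/
lemma W_mul {lam a c : ℝ} (ha : 0 < a) (hc : 0 < c) (hl : 0 < lam) (u G : ℤ → ℝ) (m K : ℤ)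
    (hu : ∀ k, |u k| ≤ a) (hG : ∀ k, |G k| ≤ c) :
    W lam (fun k => u k * G k) m K ≤ W (lam / (2 * a)) G m K + W (lam / (2 * c)) u m K := by
  refine WD_dom2 ?_ ?_ m K
  · intro i j h
    unfold JD at h ⊢
    by_contra! hh
    obtain ⟨h1, h2⟩ := hh
    rw [le_div_iff₀ (by positivity)] at h1 h2
    have e : u i * G i - u j * G j = u i * (G i - G j) + (u i - u j) * G j := by ring
    have := abs_add_le (u i * (G i - G j)) ((u i - u j) * G j)
    rw [← e, abs_mul, abs_mul] at this
    have h3 : |u i| * |G i - G j| ≤ a * |G i - G j| := by gcongr; exact hu i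
    have h4 : |u i - u j| * |G j| ≤ |u i - u j| * c := by gcongr; exact hG j
    nlinarith
  · intro i h
    left
    unfold JP at h ⊢
    by_contra! hh
    rw [abs_mul] at h
    have h3 : |u i| * |G i| ≤ a * |G i| := by gcongr; exact hu i
    have h4 : a * |G i| ≤ a * (lam / (2 * a) / 2) := by gcongr
    have h5 : a * (lam / (2 * a) / 2) = lam / 4 := by field_simp; ring
    linarith

lemma W_const (lam : ℝ) (hl : 0 < lam) (c : ℝ) (m K : ℤ) :
    ENNReal.ofReal (lam ^ 2) * W lam (fun _ => c) m K ≤ ENNReal.ofReal (4 * c ^ 2) := by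
  have hz : ∀ (l : List ℤ) (p : ℤ → Prop), (∀ a, ¬ p a) → jr (JD lam fun _ => c) p l = 0 := by
    intro l
    induction l with
    | nil => intros; simp [jr]
    | cons a l ih =>
      intro p hp
      simp only [jr]
      rw [ind_false (hp a), ih _ (fun b => by unfold JD; simpa using hl.le), zero_add]
  have h1 : W lam (fun _ => c) m K ≤ ind (lam / 2 < |c|) := by
    refine iSup₂_le fun l hl' => ?_
    rcases l with _ | ⟨a, l⟩
    · simp [jr]
    · simp only [jr]
      rw [hz l _ (fun b => by unfold JD; simpa using hl.le), add_zero]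
      exact ind_mono fun h => h
  refine (mul_le_mul_right h1 _).trans ?_
  by_cases h : lam / 2 < |c|
  · rw [ind_true h, mul_one]
    apply ENNReal.ofReal_le_ofReal
    have : (lam / 2) ^ 2 ≤ |c| ^ 2 := by gcongr
    rw [sq_abs] at this
    nlinarith
  · rw [ind_false h]; simp

lemma W_smul_le {lam c : ℝ} (hc : 0 < c) (F : ℤ → ℝ) (m K : ℤ) :
    W (lam * c) (fun k => c * F k) m K = W lam F m K := by
  unfold W
  congr 1
  · funext a b
    unfold JD
    rw [← mul_sub, abs_mul, abs_of_pos hc, mul_comm c]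
    simp [hc]
  · funext a
    unfold JP
    rw [abs_mul, abs_of_pos hc, mul_comm c, mul_div_right_comm]
    simp [hc]

lemma measurable_ind {α : Type*} [MeasurableSpace α] {p : α → Prop}
    (h : MeasurableSet {x | p x}) : Measurable fun x => ind (p x) := by
  classical
  have : (fun x => ind (p x)) = Set.indicator {x | p x} (fun _ => 1) := by
    funext x
    by_cases hx : p x
    · rw [ind_true hx, Set.indicator_of_mem (by exact hx)]
    · rw [ind_false hx, Set.indicator_of_notMem (by exact hx)]
  rw [this]
  exact measurable_const.indicator h

lemma measurable_W {α : Type*} [MeasurableSpace α] {F : ℤ → α → ℝ} (hF : ∀ k, Measurable (F k))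
    (lam : ℝ) (m K : ℤ) : Measurable fun x => W lam (fun k => F k x) m K := by
  unfold W WD
  refine Measurable.iSup fun l => Measurable.iSup fun _ => ?_
  have : ∀ (l : List ℤ) (p : α → ℤ → Prop), (∀ k, MeasurableSet {x | p x k}) →
      Measurable fun x => jr (JD lam fun k => F k x) (p x) l := by
    intro l
    induction l with
    | nil => intro p _; simp only [jr]; exact measurable_const
    | cons a l ih =>
      intro p hp
      simp only [jr]
      refine (measurable_ind (hp a)).add (ih (fun x => JD lam (fun k => F k x) a) fun k => ?_)
      unfold JD
      exact measurableSet_lt measurable_const ((hF a).sub (hF k)).abs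
  refine this l (fun x => JP lam fun k => F k x) fun k => ?_
  unfold JP
  exact measurableSet_lt measurable_const (hF k).abs

end JV

-- part 2
namespace JV

/-! ### Part 2: dyadic cubes and averages -/

/-- Euclidean space. -/
abbrev E (n : ℕ) := EuclideanSpace ℝ (Fin n)

variable {n : ℕ}

/-- Index of the dyadic cube of side `2 ^ k` containing `x`. -/
def q (k : ℤ) (x : E n) : Fin n → ℤ := fun i => ⌊(2:ℝ) ^ (-k) * x i⌋

/-- The dyadic cube of side `2 ^ k` containing `x`. -/
def Q (k : ℤ) (x : E n) : Set (E n) := q k ⁻¹' {q k x}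

lemma two_pos (k : ℤ) : (0:ℝ) < 2 ^ k := by positivity

lemma measurable_q (k : ℤ) : Measurable (q (n := n) k) := by
  refine measurable_pi_lambda _ fun i => ?_
  unfold q
  refine Int.measurable_floor.comp ?_
  fun_prop

lemma measurable_of_q (k : ℤ) {β : Type*} [MeasurableSpace β] (h : (Fin n → ℤ) → β) :
    Measurable fun x : E n => h (q k x) :=
  (measurable_of_countable h).comp (measurable_q k)

lemma measurableSet_of_q (k : ℤ) (s : Set (Fin n → ℤ)) :
    MeasurableSet (q (n := n) k ⁻¹' s) :=
  measurable_q k (Set.Countable.measurableSet (Set.to_countable s))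

lemma measurableSet_Q (k : ℤ) (x : E n) : MeasurableSet (Q k x) := measurableSet_of_q k _

lemma mem_Q {k : ℤ} {x y : E n} : y ∈ Q k x ↔ q k y = q k x := Iff.rfl

lemma mem_Q_self (k : ℤ) (x : E n) : x ∈ Q k x := rfl

lemma Q_eq {k : ℤ} {x y : E n} (h : y ∈ Q k x) : Q k y = Q k x := by
  unfold Q; rw [mem_Q.1 h]

lemma Q_congr {k : ℤ} {x y : E n} (h : q k y = q k x) : Q k y = Q k x := by
  unfold Q; rw [h]

lemma q_mono {k l : ℤ} (hkl : k ≤ l) {x y : E n} (h : q k x = q k y) : q l x = q l y := by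
  obtain ⟨d, rfl⟩ := Int.le.dest hkl
  have key : ∀ x : E n, q (k + d) x = fun i => q k x i / ((2 ^ d : ℕ) : ℤ) := by
    intro x
    funext i
    unfold q
    rw [← Int.floor_div_natCast]
    congr 1
    rw [neg_add, zpow_add₀ (by norm_num)]
    push_cast
    rw [zpow_neg 2 (d:ℤ), zpow_natCast]
    field_simp
  rw [key, key, h]

lemma Q_mono {k l : ℤ} (hkl : k ≤ l) (x : E n) : Q k x ⊆ Q l x :=
  fun _ h => q_mono hkl h

lemma norm_le_sum (x : E n) : ‖x‖ ≤ ∑ i, |x i| := by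
  rw [EuclideanSpace.norm_eq]
  apply Real.sqrt_le_iff.2
  refine ⟨Finset.sum_nonneg fun _ _ => abs_nonneg _, ?_⟩
  simp only [Real.norm_eq_abs]
  exact Finset.sum_sq_le_sq_sum_of_nonneg fun _ _ => abs_nonneg _

lemma coord_le_norm (x : E n) (i : Fin n) : |x i| ≤ ‖x‖ := by
  have := PiLp.norm_apply_le x i
  simpa using this

lemma norm_sub_le_of_mem_Q {k : ℤ} {x y : E n} (h : y ∈ Q k x) : ‖y - x‖ ≤ n * 2 ^ k := by
  refine (norm_le_sum _).trans ?_
  have : ∀ i ∈ (Finset.univ : Finset (Fin n)), |(y - x) i| ≤ 2 ^ k := by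
    intro i _
    have h1 := congrFun (mem_Q.1 h) i
    unfold q at h1
    have h2 := Int.abs_sub_lt_one_of_floor_eq_floor h1
    rw [← mul_sub, abs_mul, abs_of_pos (two_pos _), zpow_neg] at h2
    have h3 := two_pos k
    rw [inv_mul_lt_iff₀ h3, mul_one] at h2
    simpa using h2.le
  simpa using Finset.sum_le_card_nsmul _ _ _ this

lemma volume_Q (k : ℤ) (x : E n) : volume (Q k x) = ENNReal.ofReal (((2:ℝ) ^ k) ^ n) := by
  have h1 : Q k x = (WithLp.ofLp : E n → (Fin n → ℝ)) ⁻¹'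
      (Set.univ.pi fun i => Set.Ico ((2:ℝ)^k * q k x i) ((2:ℝ)^k * (q k x i + 1))) := by
    ext y
    simp only [mem_Q, Set.mem_preimage, Set.mem_pi, Set.mem_univ, forall_true_left, Set.mem_Ico]
    rw [funext_iff]
    refine forall_congr' fun i => ?_
    have h3 := two_pos k
    rw [show q k y i = ⌊(2:ℝ) ^ (-k) * y i⌋ from rfl, Int.floor_eq_iff, zpow_neg,
      le_inv_mul_iff₀ h3, inv_mul_lt_iff₀ h3]
  rw [h1, (PiLp.volume_preserving_ofLp (Fin n)).measure_preimage
    (MeasurableSet.univ_pi fun i => measurableSet_Ico).nullMeasurableSet, Real.volume_pi_Ico]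
  have : ∀ i, (2:ℝ)^k * (q k x i + 1) - (2:ℝ)^k * q k x i = 2 ^ k := fun i => by ring
  simp only [this, Finset.prod_const, Finset.card_univ, Fintype.card_fin]
  rw [ENNReal.ofReal_pow (two_pos k).le]

lemma volume_Q_ne_top (k : ℤ) (x : E n) : volume (Q k x) ≠ ∞ := by
  rw [volume_Q]; exact ENNReal.ofReal_ne_top

/-- saturated sets: unions of cubes of side `2^k` -/
def sat (k : ℤ) (U : Set (E n)) : Prop := ∀ x ∈ U, Q k x ⊆ U

lemma sat_Q {k l : ℤ} (h : k ≤ l) (x : E n) : sat k (Q l x) := by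
  intro y hy
  rw [← Q_eq hy]
  exact Q_mono h y

lemma sat_univ (k : ℤ) : sat k (Set.univ : Set (E n)) := fun _ _ => Set.subset_univ _

lemma sat_eq {k : ℤ} {U : Set (E n)} (h : sat k U) : U = q k ⁻¹' (q k '' U) := by
  ext x
  refine ⟨fun hx => ⟨x, hx, rfl⟩, ?_⟩
  rintro ⟨y, hy, hyx⟩
  exact h y hy hyx.symm

lemma sat.measurableSet {k : ℤ} {U : Set (E n)} (h : sat k U) : MeasurableSet U := by
  rw [sat_eq h]; exact measurableSet_of_q k _

lemma sat_biUnion {k : ℤ} {U : Set (E n)} (h : sat k U) :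
    U = ⋃ z ∈ q k '' U, q k ⁻¹' {z} := by
  conv_lhs => rw [sat_eq h, ← Set.biUnion_preimage_singleton]

lemma lint_le_of_cubes (k : ℤ) {U : Set (E n)} (hU : sat k U) {f g : E n → ℝ≥0∞}
    (h : ∀ x ∈ U, ∫⁻ y in Q k x, f y ≤ ∫⁻ y in Q k x, g y) :
    ∫⁻ y in U, f y ≤ ∫⁻ y in U, g y := by
  rw [sat_biUnion hU]
  have hd : (q (n := n) k '' U).PairwiseDisjoint (fun z => q k ⁻¹' {z}) := by
    intro a _ b _ hab
    exact Disjoint.preimage _ (by simpa using hab)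
  rw [lintegral_biUnion (Set.to_countable _) (fun z _ => measurableSet_of_q k _) hd,
    lintegral_biUnion (Set.to_countable _) (fun z _ => measurableSet_of_q k _) hd]
  refine ENNReal.tsum_le_tsum fun z => ?_
  obtain ⟨z, x, hx, rfl⟩ := z
  exact h x hx

lemma integral_eq_zero_of_cubes (k : ℤ) {G : E n → ℝ} (hG : Integrable G)
    (h : ∀ x, ∫ y in Q k x, G y = 0) : ∫ y, G y = 0 := by
  have h1 : (Set.univ : Set (E n)) = ⋃ z : (Fin n → ℤ), q k ⁻¹' {z} := by
    ext x; simp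
  rw [← setIntegral_univ, h1]
  rw [integral_iUnion (fun z => measurableSet_of_q k _) ?_ ?_]
  · have : ∀ z : Fin n → ℤ, ∫ y in q (n := n) k ⁻¹' {z}, G y = 0 := by
      intro z
      by_cases hz : ∃ x : E n, q k x = z
      · obtain ⟨x, rfl⟩ := hz
        exact h x
      · have : q (n := n) k ⁻¹' {z} = ∅ := by
          ext x; simp only [Set.mem_preimage, Set.mem_singleton_iff, Set.mem_empty_iff_false,
            iff_false]
          exact fun hx => hz ⟨x, hx⟩
        rw [this]; simp
    simp [this]
  · intro a b hab
    exact Disjoint.preimage _ (by simpa using hab)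
  · exact hG.integrableOn

/-- dyadic averages -/
def Ek (k : ℤ) (f : E n → ℝ) (x : E n) : ℝ := (((2:ℝ) ^ k) ^ n)⁻¹ * ∫ y in Q k x, f y

lemma Ek_congr {k : ℤ} (f : E n → ℝ) {x y : E n} (h : y ∈ Q k x) : Ek k f y = Ek k f x := by
  unfold Ek; rw [Q_eq h]

lemma measurable_Ek (k : ℤ) (f : E n → ℝ) : Measurable (Ek k f) :=
  measurable_of_q k (fun z => (((2:ℝ) ^ k) ^ n)⁻¹ * ∫ y in q k ⁻¹' {z}, f y)

lemma abs_Ek_le (k : ℤ) (f : E n → ℝ) (x : E n) : |Ek k f x| ≤ Ek k (fun y => |f y|) x := by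
  unfold Ek
  rw [abs_mul, abs_of_nonneg (by positivity)]
  gcongr
  exact abs_integral_le_integral_abs

lemma Ek_const (k : ℤ) (c : ℝ) (x : E n) : Ek k (fun _ => c) x = c := by
  unfold Ek
  rw [setIntegral_const, Measure.real, volume_Q, ENNReal.toReal_ofReal (by positivity), smul_eq_mul]
  have := two_pos k
  field_simp

lemma Ek_mono {k : ℤ} {f g : E n → ℝ} {x : E n} (hf : IntegrableOn f (Q k x))
    (hg : IntegrableOn g (Q k x)) (h : ∀ y, f y ≤ g y) : Ek k f x ≤ Ek k g x := by
  unfold Ek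
  exact mul_le_mul_of_nonneg_left (setIntegral_mono hf hg h) (by have := two_pos k; positivity)

lemma Ek_succ_le (k : ℤ) {f : E n → ℝ} (hf : Integrable f) (h0 : ∀ y, 0 ≤ f y) (x : E n) :
    Ek k f x ≤ 2 ^ n * Ek (k + 1) f x := by
  unfold Ek
  have h1 : ∫ y in Q k x, f y ≤ ∫ y in Q (k+1) x, f y :=
    setIntegral_mono_set hf.integrableOn (by filter_upwards with y using h0 y)
      (Q_mono (by omega) x).eventuallyLE
  have := two_pos k
  have e : ∀ I : ℝ, 2 ^ n * (((((2:ℝ) ^ (k + 1))) ^ n)⁻¹ * I) = (((2:ℝ) ^ k) ^ n)⁻¹ * I := by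
    intro I
    rw [zpow_add₀ (by norm_num), zpow_one, mul_pow]
    field_simp
  rw [e]
  exact mul_le_mul_of_nonneg_left h1 (by positivity)

lemma setIntegral_Q (k : ℤ) (f : E n → ℝ) (x : E n) :
    ∫ y in Q k x, f y = ((2:ℝ) ^ k) ^ n * Ek k f x := by
  unfold Ek
  have := two_pos k
  field_simp

lemma integrableOn_Q {f : E n → ℝ} (hf : Measurable f) {M : ℝ} (hM : ∀ x, |f x| ≤ M) (k : ℤ)
    (x : E n) : IntegrableOn f (Q k x) := by
  refine Measure.integrableOn_of_bounded (M := M) (volume_Q_ne_top k x) hf.aestronglyMeasurable ?_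
  filter_upwards with y using hM y

lemma integrableOn_Q_of_int {f : E n → ℝ} (hf : Integrable f) (k : ℤ)
    (x : E n) : IntegrableOn f (Q k x) := hf.integrableOn

/-! ### Part 3: jumps of dyadic martingales in `L²` -/

open Classical in
/-- greedy count -/
def gr (θ : ℝ) (G : ℤ → ℝ) (m : ℤ) : ℕ → ℝ → ℝ≥0∞
  | 0, _ => 0
  | d + 1, v => if θ < |G (m + d) - v| then 1 + gr θ G m d (G (m + d)) else gr θ G m d v

lemma jr_le_gr {lam : ℝ} (hl : 0 < lam) (G : ℤ → ℝ) (m : ℤ) (d : ℕ) :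
    ∀ (l : List ℤ), adm m (m + d - 1) l → ∀ v : ℝ,
    jr (JD lam G) (fun a => lam / 2 < |G a - v|) l ≤ gr (lam / 2) G m d v := by
  induction d with
  | zero =>
    intro l hl v
    rcases l with _ | ⟨a, l⟩
    · simp [jr]
    · have := hl.2 a (by simp)
      push_cast at this
      omega
  | succ d ih =>
    intro l hadm v
    rcases l with _ | ⟨a, l⟩
    · simp [jr]
    have ha := hadm.2 a (by simp)
    have hpw := List.pairwise_cons.1 hadm.1
    by_cases had : a = m + d
    · have hl' : adm m (m + d - 1) l := ⟨hpw.2, fun b hb => ⟨(hadm.2 b (by simp [hb])).1, by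
        have := hpw.1 b hb; omega⟩⟩
      simp only [jr, gr]
      subst had
      split_ifs with h
      · rw [ind_true h]
        gcongr
        refine le_trans ?_ (ih l hl' (G (m + d)))
        refine le_of_le_of_eq ((jr_dom {()} (D' := fun _ => JD lam G)
          (p' := fun _ a => lam / 2 < |G a - G (m + d)|) (by simp) l ?_)) (by simp)
        intro b hb
        refine ⟨(), by simp, ?_⟩
        unfold JD at hb
        rw [abs_sub_comm] at hb
        linarith
      · rw [ind_false h, zero_add]
        refine le_trans ?_ (ih l hl' v)
        refine le_of_le_of_eq ((jr_dom {()} (D' := fun _ => JD lam G)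
          (p' := fun _ a => lam / 2 < |G a - v|) (by simp) l ?_)) (by simp)
        intro b hb
        refine ⟨(), by simp, ?_⟩
        unfold JD at hb
        have := abs_sub_le (G (m + d)) v (G b)
        rw [abs_sub_comm v] at this
        push Not at h
        linarith
    · have hl' : adm m (m + d - 1) (a :: l) := ⟨hadm.1, fun b hb => ⟨(hadm.2 b hb).1, by
        push_cast at ha
        rcases List.mem_cons.1 hb with rfl | hb'
        · omega
        · have := hpw.1 b hb'; omega⟩⟩
      simp only [gr]
      split_ifs with h
      · have h1 := ih (a :: l) hl' (G (m+d))
        have hpl : adm m (m + d - 1) l := ⟨hpw.2, fun b hb => hl'.2 b (by simp [hb])⟩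
        rw [jr]
        rw [jr] at h1
        gcongr
        · exact ind_le_one _
        · exact le_add_self.trans h1
      · exact ih _ hl' v

lemma gr_int {g : E n → ℝ} (hg : Measurable g) {M : ℝ} (hM : ∀ x, |g x| ≤ M) {θ : ℝ}
    (hθ : 0 < θ) (m : ℤ) (d : ℕ) : ∀ (x0 : E n) (v : ℝ),
    ∫⁻ x in Q (m + d - 1) x0, ENNReal.ofReal (θ ^ 2) * gr θ (fun k => Ek k g x) m d v ≤
      ∫⁻ x in Q (m + d - 1) x0, ENNReal.ofReal ((g x - v) ^ 2) := by
  induction d with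
  | zero => intro x0 v; simp [gr]
  | succ d ih =>
    intro x0 v
    have ih' : ∀ v, ∫⁻ x in Q (m + d) x0, ENNReal.ofReal (θ ^ 2) * gr θ (fun k => Ek k g x) m d v ≤
      ∫⁻ x in Q (m + d) x0, ENNReal.ofReal ((g x - v) ^ 2) := fun v =>
      lint_le_of_cubes (m + d - 1) (sat_Q (by omega) x0) fun x _ => ih x v
    rw [show m + ((d + 1 : ℕ) : ℤ) - 1 = m + d by push_cast; ring]
    set c := Ek (m + d) g x0 with hc
    have hcc : ∀ x ∈ Q (m + d) x0, Ek (m + d) g x = c := fun x hx => Ek_congr g hx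
    by_cases h : θ < |c - v|
    · have e1 : ∫⁻ x in Q (m + d) x0, ENNReal.ofReal (θ ^ 2) *
          gr θ (fun k => Ek k g x) m (d + 1) v =
          ∫⁻ x in Q (m + d) x0, (ENNReal.ofReal (θ ^ 2) + ENNReal.ofReal (θ ^ 2) *
          gr θ (fun k => Ek k g x) m d c) := by
        refine setLIntegral_congr_fun (measurableSet_Q _ _) fun x hx => ?_
        simp only [gr]
        rw [hcc x hx, if_pos h, mul_add, mul_one]
      rw [e1, lintegral_add_left measurable_const]
      calc _ ≤ (∫⁻ x in Q (m + d) x0, ENNReal.ofReal ((c - v) ^ 2)) +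
            (∫⁻ x in Q (m + d) x0, ENNReal.ofReal ((g x - c) ^ 2)) := by
            refine add_le_add (lintegral_mono fun x => ?_) (ih' c)
            rw [← sq_abs (c - v)]; gcongr
        _ = _ := by
            rw [← lintegral_add_left measurable_const]
            have i0 := integrableOn_Q hg hM (m + d) x0
            have im : ∀ w, IntegrableOn (fun x => (g x - w) ^ 2) (Q (m + d) x0) := fun w => by
              refine integrableOn_Q (by fun_prop) (M := (M + |w|) ^ 2) (fun x => ?_) _ _
              rw [abs_pow]
              gcongr
              exact (abs_sub _ _).trans (by gcongr; exact hM x)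
            have ic : IntegrableOn (fun _ => (c - v) ^ 2) (Q (m + d) x0) :=
              integrableOn_const (volume_Q_ne_top _ _)
            have e2 : ∀ x, ENNReal.ofReal ((c - v) ^ 2) + ENNReal.ofReal ((g x - c) ^ 2) =
                ENNReal.ofReal ((c - v) ^ 2 + (g x - c) ^ 2) := fun x =>
              (ENNReal.ofReal_add (by positivity) (by positivity)).symm
            simp only [e2]
            have is : IntegrableOn (fun x => (c - v) ^ 2 + (g x - c) ^ 2) (Q (m + d) x0) :=
              ic.add (im c)
            rw [← ofReal_integral_eq_lintegral_ofReal is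
                (by filter_upwards with x using by positivity),
              ← ofReal_integral_eq_lintegral_ofReal (im v)
                (by filter_upwards with x using by positivity)]
            congr 1
            rw [← sub_eq_zero, ← integral_sub is (im v)]
            have e3 : ∀ x, (c - v) ^ 2 + (g x - c) ^ 2 - (g x - v) ^ 2 =
                (2 * (v - c)) * g x + 2 * c * (c - v) := fun x => by ring
            simp only [e3]
            have iu : IntegrableOn (fun _ => 2 * c * (c - v)) (Q (m + d) x0) :=
              integrableOn_const (volume_Q_ne_top _ _)
            rw [integral_add (i0.const_mul _) iu, integral_const_mul, setIntegral_Q, setIntegral_Q,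
              Ek_const, ← hc]
            ring
    · refine le_of_eq_of_le (setLIntegral_congr_fun (measurableSet_Q _ _) fun x hx => ?_) (ih' v)
      simp only [gr]
      rw [hcc x hx, if_neg h]

lemma W_Ek_int {g : E n → ℝ} (hg : Measurable g) {M : ℝ} (hM : ∀ x, |g x| ≤ M) {lam : ℝ}
    (hl : 0 < lam) (m K : ℤ) :
    ∫⁻ x, ENNReal.ofReal (lam ^ 2) * W lam (fun k => Ek k g x) m K ≤
      4 * ∫⁻ x, ENNReal.ofReal ((g x) ^ 2) := by
  have key : ∀ d : ℕ, ∫⁻ x, ENNReal.ofReal (lam ^ 2) * W lam (fun k => Ek k g x) m (m + d - 1) ≤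
      4 * ∫⁻ x, ENNReal.ofReal ((g x) ^ 2) := by
    intro d
    have h1 : ∀ x, ENNReal.ofReal (lam ^ 2) * W lam (fun k => Ek k g x) m (m + d - 1) ≤
        4 * (ENNReal.ofReal ((lam / 2) ^ 2) * gr (lam / 2) (fun k => Ek k g x) m d 0) := by
      intro x
      rw [← mul_assoc, show (4 : ℝ≥0∞) = ENNReal.ofReal 4 by simp,
        ← ENNReal.ofReal_mul (by positivity), show 4 * (lam / 2) ^ 2 = lam ^ 2 by ring]
      gcongr
      refine iSup₂_le fun l hadm => ?_
      have := jr_le_gr hl (fun k => Ek k g x) m d l hadm 0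
      simp only [sub_zero] at this
      exact this
    refine (lintegral_mono h1).trans ?_
    rw [lintegral_const_mul' _ _ (by simp)]
    refine mul_le_mul' le_rfl ?_
    rw [← setLIntegral_univ, ← setLIntegral_univ (μ := volume) (fun x => ENNReal.ofReal (g x ^ 2))]
    refine lint_le_of_cubes (m + d - 1) (sat_univ _) fun x _ => ?_
    simpa using gr_int hg hM (half_pos hl) m d x 0
  by_cases h : m ≤ K
  · have := key (K + 1 - m).toNat
    rwa [show m + ((K + 1 - m).toNat : ℤ) - 1 = K by omega] at this
  · refine le_trans (lintegral_mono fun x => ?_) (key 0)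
    gcongr
    exact W_mono le_rfl (by push_cast; omega)

end JV

-- part 3
namespace JV

variable {n : ℕ}

/-! ### Part 4: the Poisson-like majorant -/

/-- Poisson-like majorant at scale `t`. -/
def rho (t : ℝ) (h : E n) : ℝ := t ^ 2 / (t + ‖h‖) ^ (n + 2)

lemma rho_pos {t : ℝ} (ht : 0 < t) (h : E n) : 0 < rho t h := by
  unfold rho; positivity

lemma rho_neg (t : ℝ) (h : E n) : rho t (-h) = rho t h := by
  unfold rho; rw [norm_neg]

lemma rho_comm (t : ℝ) (x y : E n) : rho t (x - y) = rho t (y - x) := by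
  rw [← rho_neg, neg_sub]

lemma rho_scale {t : ℝ} (ht : 0 < t) (h : E n) : rho t h = (t ^ n)⁻¹ * rho 1 (t⁻¹ • h) := by
  unfold rho
  rw [norm_smul, norm_inv, Real.norm_of_nonneg ht.le]
  have : 1 + t⁻¹ * ‖h‖ = (t + ‖h‖) / t := by field_simp
  rw [this, div_pow, pow_add]
  have h2 : 0 < t + ‖h‖ := by positivity
  field_simp
  ring

lemma measurable_rho (t : ℝ) : Measurable (rho (n := n) t) := by
  unfold rho; fun_prop

lemma rho_le {t : ℝ} (ht : 0 < t) (h : E n) : rho t h ≤ (t ^ n)⁻¹ := by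
  unfold rho
  rw [div_le_iff₀ (by positivity), inv_mul_eq_div, le_div_iff₀ (by positivity), ← pow_add, add_comm 2 n]
  gcongr
  simp

lemma integrable_rho_one : Integrable (rho (n := n) 1) := by
  have := integrable_one_add_norm (E := E n) (μ := volume) (r := n + 2) (by simp)
  refine this.congr ?_
  filter_upwards with h
  unfold rho
  rw [Real.rpow_neg (by positivity), one_pow, one_div]
  congr 1
  exact_mod_cast Real.rpow_natCast _ (n + 2)

lemma integrable_rho_one_norm : Integrable (fun h : E n => rho 1 h * ‖h‖) := by
  have := integrable_one_add_norm (E := E n) (μ := volume) (r := n + 1) (by simp)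
  refine this.mono' ((measurable_rho 1).mul measurable_norm).aestronglyMeasurable ?_
  filter_upwards with h
  have e : (1 + ‖h‖) ^ (-((n:ℝ) + 1)) = ((1 + ‖h‖) ^ (n + 1))⁻¹ := by
    rw [Real.rpow_neg (by positivity)]
    congr 1
    exact_mod_cast Real.rpow_natCast _ (n + 1)
  rw [e, Real.norm_of_nonneg (mul_nonneg (rho_pos one_pos h).le (norm_nonneg h))]
  unfold rho
  rw [one_pow, one_div, show n + 2 = n + 1 + 1 by rfl, pow_succ (1 + ‖h‖) (n+1), mul_inv, mul_assoc]
  refine mul_le_of_le_one_right (by positivity) ?_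
  rw [inv_mul_le_iff₀ (by positivity)]
  simp

/-- `∫ ρ` -/
def I0 (n : ℕ) : ℝ := ∫ h : E n, rho 1 h

/-- `∫ ρ |h|` -/
def J0 (n : ℕ) : ℝ := ∫ h : E n, rho 1 h * ‖h‖

lemma I0_nonneg : 0 ≤ I0 n := integral_nonneg fun h => (rho_pos one_pos h).le
lemma J0_nonneg : 0 ≤ J0 n :=
  integral_nonneg fun h => mul_nonneg (rho_pos one_pos h).le (norm_nonneg h)

lemma I0_pos : 0 < I0 n := by
  unfold I0
  rw [integral_pos_iff_support_of_nonneg (fun h => (rho_pos one_pos h).le) integrable_rho_one]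
  have : Function.support (rho (n := n) 1) = Set.univ := by
    ext h; simp [(rho_pos one_pos h).ne']
  rw [this]
  exact Measure.measure_univ_pos.2 (NeZero.ne _)

lemma integrable_rho {t : ℝ} (ht : 0 < t) : Integrable (rho (n := n) t) := by
  have : rho (n := n) t = fun h => (t ^ n)⁻¹ * rho 1 (t⁻¹ • h) := by
    funext h; exact rho_scale ht h
  rw [this]
  exact (integrable_rho_one.comp_smul (inv_ne_zero ht.ne')).const_mul _

lemma integral_rho {t : ℝ} (ht : 0 < t) : ∫ h : E n, rho t h = I0 n := by
  simp_rw [rho_scale ht]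
  rw [integral_const_mul, Measure.integral_comp_inv_smul, finrank_euclideanSpace, Fintype.card_fin,
    abs_of_nonneg (by positivity), smul_eq_mul, ← mul_assoc, inv_mul_cancel₀ (by positivity), one_mul]
  rfl

lemma integrable_rho_norm {t : ℝ} (ht : 0 < t) : Integrable (fun h : E n => rho t h * ‖h‖) := by
  have : (fun h : E n => rho t h * ‖h‖) =
      fun h => ((t ^ n)⁻¹ * t) * (rho 1 (t⁻¹ • h) * ‖t⁻¹ • h‖) := by
    funext h
    rw [rho_scale ht h, norm_smul, norm_inv, Real.norm_of_nonneg ht.le]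
    field_simp
  rw [this]
  exact (integrable_rho_one_norm.comp_smul (inv_ne_zero ht.ne')).const_mul _

lemma integral_rho_norm {t : ℝ} (ht : 0 < t) : ∫ h : E n, rho t h * ‖h‖ = t * J0 n := by
  have : (fun h : E n => rho t h * ‖h‖) =
      fun h => ((t ^ n)⁻¹ * t) * (fun h => (rho 1 h * ‖h‖)) (t⁻¹ • h) := by
    funext h
    simp only
    rw [rho_scale ht h, norm_smul, norm_inv, Real.norm_of_nonneg ht.le]
    field_simp
  rw [this, integral_const_mul, Measure.integral_comp_inv_smul volume (fun h : E n => rho 1 h * ‖h‖) t,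
    finrank_euclideanSpace,
    Fintype.card_fin, abs_of_nonneg (by positivity), smul_eq_mul, J0]
  field_simp

lemma lint_rho {t : ℝ} (ht : 0 < t) : ∫⁻ h : E n, ENNReal.ofReal (rho t h) = ENNReal.ofReal (I0 n) := by
  rw [← integral_rho ht, ofReal_integral_eq_lintegral_ofReal (integrable_rho ht)]
  filter_upwards with h using (rho_pos ht h).le

lemma lint_rho_norm {t : ℝ} (ht : 0 < t) :
    ∫⁻ h : E n, ENNReal.ofReal (rho t h * ‖h‖) = ENNReal.ofReal (t * J0 n) := by
  rw [← integral_rho_norm ht, ofReal_integral_eq_lintegral_ofReal (integrable_rho_norm ht)]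
  filter_upwards with h using mul_nonneg (rho_pos ht h).le (norm_nonneg h)

lemma lint_rho_left {t : ℝ} (ht : 0 < t) (x : E n) :
    ∫⁻ y : E n, ENNReal.ofReal (rho t (x - y)) = ENNReal.ofReal (I0 n) := by
  rw [lintegral_sub_left_eq_self (fun y => ENNReal.ofReal (rho t y)) x, lint_rho ht]

lemma lint_rho_right {t : ℝ} (ht : 0 < t) (x : E n) :
    ∫⁻ y : E n, ENNReal.ofReal (rho t (y - x)) = ENNReal.ofReal (I0 n) := by
  rw [lintegral_sub_right_eq_self (fun y => ENNReal.ofReal (rho t y)) x, lint_rho ht]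

lemma integral_rho_left {t : ℝ} (ht : 0 < t) (x : E n) : ∫ y : E n, rho t (x - y) = I0 n := by
  rw [integral_sub_left_eq_self (fun y => rho t y) volume x, integral_rho ht]

/-! ### Part 5: operators with dominated kernels -/

/-- the kernel `R` is measurable and dominated by `A ρ_t`. -/
structure Dom (A t : ℝ) (R : E n → E n → ℝ) : Prop where
  meas : Measurable (Function.uncurry R)
  le : ∀ x y, |R x y| ≤ A * rho t (x - y)

/-- integral operator -/
def op (R : E n → E n → ℝ) (a : E n → ℝ) (x : E n) : ℝ := ∫ y, R x y * a y

lemma Dom.swap {A t : ℝ} {R : E n → E n → ℝ} (h : Dom A t R) : Dom A t (fun x y => R y x) :=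
  ⟨h.meas.comp measurable_swap, fun x y => by rw [rho_comm]; exact h.le y x⟩

lemma Dom.measx {A t : ℝ} {R : E n → E n → ℝ} (h : Dom A t R) (y : E n) : Measurable fun x => R x y :=
  h.meas.comp (measurable_id.prodMk measurable_const)

lemma Dom.measy {A t : ℝ} {R : E n → E n → ℝ} (h : Dom A t R) (x : E n) : Measurable fun y => R x y :=
  h.meas.comp (measurable_const.prodMk measurable_id)

lemma Dom.inty {A t : ℝ} (ht : 0 < t) {R : E n → E n → ℝ} (h : Dom A t R) (x : E n) :
    Integrable fun y => R x y := by
  refine (((integrable_rho ht).comp_sub_left x).const_mul A).mono' (h.measy x).aestronglyMeasurable ?_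
  filter_upwards with y using h.le x y

lemma Dom.int_prod {A t : ℝ} (ht : 0 < t) {R : E n → E n → ℝ} (h : Dom A t R) {a : E n → ℝ}
    (ha : Integrable a) {c : E n → ℝ} (hcm : Measurable c) {M : ℝ} (hc : ∀ x, |c x| ≤ M) :
    Integrable (fun z : E n × E n => c z.1 * (R z.1 z.2 * a z.2)) (volume.prod volume) := by
  have h1 := (ha.norm.convolution_integrand (ContinuousLinearMap.mul ℝ ℝ) (integrable_rho (n := n) ht))
  have h2 := h1.const_mul (M * A)
  refine h2.mono' ?_ ?_
  · refine AEStronglyMeasurable.mul (hcm.comp measurable_fst).aestronglyMeasurable ?_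
    refine AEStronglyMeasurable.mul h.meas.aestronglyMeasurable ?_
    exact ha.aestronglyMeasurable.comp_snd
  · filter_upwards with z
    simp only [norm_mul, Real.norm_eq_abs, ContinuousLinearMap.mul_apply']
    have h3 := h.le z.1 z.2
    have h4 := hc z.1
    calc |c z.1| * (|R z.1 z.2| * |a z.2|) ≤ M * (A * rho t (z.1 - z.2) * |a z.2|) := by gcongr; exact (abs_nonneg _).trans h4
      _ = _ := by ring

lemma op_dual {A t : ℝ} (ht : 0 < t) {R : E n → E n → ℝ} (h : Dom A t R) {a : E n → ℝ}
    (ha : Integrable a) {c : E n → ℝ} (hcm : Measurable c) {M : ℝ} (hc : ∀ x, |c x| ≤ M) :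
    ∫ x, c x * op R a x = ∫ y, a y * op (fun x y => R y x) c y := by
  unfold op
  simp_rw [← integral_const_mul]
  rw [integral_integral_swap (h.int_prod ht ha hcm hc)]
  refine integral_congr_ae ?_
  filter_upwards with y
  refine integral_congr_ae ?_
  filter_upwards with x
  ring

lemma measurable_op {A t : ℝ} {R : E n → E n → ℝ} (h : Dom A t R) {a : E n → ℝ}
    (ha : Measurable a) : Measurable (op R a) := by
  unfold op
  have : StronglyMeasurable (Function.uncurry fun x y => R x y * a y) :=
    (h.meas.mul (ha.comp measurable_snd)).stronglyMeasurable
  exact this.integral_prod_right.measurable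

lemma integrable_op {A t : ℝ} (ht : 0 < t) {R : E n → E n → ℝ} (h : Dom A t R) {a : E n → ℝ}
    (ha : Integrable a) : Integrable (op R a) := by
  have := h.int_prod ht ha (measurable_const (a := (1:ℝ))) (M := 1) (by simp)
  simp only [one_mul] at this
  exact this.integral_prod_left

lemma Dom.int_mul {A t : ℝ} (ht : 0 < t) {R : E n → E n → ℝ} (h : Dom A t R) {a : E n → ℝ}
    (ham : Measurable a) {M : ℝ} (hM : ∀ x, |a x| ≤ M) (x : E n) :
    Integrable fun y => R x y * a y := by
  refine (h.inty ht x).mul_bdd (c := M) ham.aestronglyMeasurable ?_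
  filter_upwards with y using hM y

lemma Dom.A_nonneg {A t : ℝ} (ht : 0 < t) {R : E n → E n → ℝ} (h : Dom A t R) : 0 ≤ A := by
  have h1 := (abs_nonneg _).trans (h.le 0 0)
  exact nonneg_of_mul_nonneg_left h1 (rho_pos ht _)

lemma abs_op_le {A t : ℝ} (ht : 0 < t) {R : E n → E n → ℝ} (h : Dom A t R) {a : E n → ℝ}
    {M : ℝ} (hM : ∀ x, |a x| ≤ M) (x : E n) : |op R a x| ≤ A * M * I0 n := by
  unfold op
  have h1 : ∀ y, ‖R x y * a y‖ ≤ A * M * rho t (x - y) := fun y => by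
    rw [norm_mul]
    calc _ ≤ (A * rho t (x - y)) * M := by
          apply mul_le_mul (h.le x y) (hM y) (abs_nonneg _) ((abs_nonneg _).trans (h.le x y))
      _ = _ := by ring
  have := norm_integral_le_of_norm_le (((integrable_rho ht).comp_sub_left x).const_mul (A * M))
    (Filter.Eventually.of_forall h1)
  rwa [integral_const_mul, integral_rho_left ht] at this

end JV

-- part 4
namespace JV

variable {n : ℕ}

/-! ### Part 6: almost orthogonality -/

lemma geo_half {θ : ℝ} (h0 : 0 ≤ θ) (h1 : θ < 1) (s : Finset ℤ) (e : ℤ → ℕ)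
    (he : Set.InjOn e s) : ∑ l ∈ s, θ ^ e l ≤ (1 - θ)⁻¹ := by
  rw [← tsum_geometric_of_lt_one h0 h1, ← Finset.sum_image (f := fun d => θ ^ d) he]
  exact (summable_geometric_of_lt_one h0 h1).sum_le_tsum _ fun _ _ => by positivity

lemma geo {θ : ℝ} (h0 : 0 ≤ θ) (h1 : θ < 1) (s : Finset ℤ) (k : ℤ) :
    ∑ l ∈ s, θ ^ (k - l).natAbs ≤ 2 * (1 - θ)⁻¹ := by
  rw [← Finset.sum_filter_add_sum_filter_not s (fun l => l ≤ k), two_mul]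
  refine add_le_add (geo_half h0 h1 _ _ ?_) (geo_half h0 h1 _ _ ?_)
  · intro a ha b hb hab
    simp only [Finset.coe_filter, Set.mem_ofPred_eq] at ha hb hab
    omega
  · intro a ha b hb hab
    simp only [Finset.coe_filter, Set.mem_ofPred_eq] at ha hb hab
    omega

/-- the kernel of `R_k R_l^*` -/
def KK (R : ℤ → E n → E n → ℝ) (k l : ℤ) (x x' : E n) : ℝ := ∫ y, R k x y * R l x' y

lemma measurable_KK {A : ℝ} {R : ℤ → E n → E n → ℝ} (hR : ∀ k : ℤ, Dom A (2 ^ k) (R k)) (k l : ℤ) :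
    Measurable (Function.uncurry (KK R k l)) := by
  have : StronglyMeasurable (Function.uncurry fun (z : E n × E n) y => R k z.1 y * R l z.2 y) := by
    refine Measurable.stronglyMeasurable ?_
    refine Measurable.mul ?_ ?_
    · exact (hR k).meas.comp ((measurable_fst.comp measurable_fst).prodMk measurable_snd)
    · exact (hR l).meas.comp ((measurable_snd.comp measurable_fst).prodMk measurable_snd)
  exact this.integral_prod_right.measurable

/-- bounded integrable measurable function -/
structure Nice (f : E n → ℝ) : Prop where
  meas : Measurable f
  int : Integrable f
  bdd : ∃ M, ∀ x, |f x| ≤ M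

lemma Nice.op {A t : ℝ} (ht : 0 < t) {R : E n → E n → ℝ} (h : Dom A t R) {f : E n → ℝ}
    (hf : Nice f) : Nice (op R f) := by
  obtain ⟨M, hM⟩ := hf.bdd
  exact ⟨measurable_op h hf.meas, integrable_op ht h hf.int, _, abs_op_le ht h hM⟩

lemma Nice.mul {f g : E n → ℝ} (hf : Nice f) (hg : Nice g) : Integrable fun x => f x * g x := by
  obtain ⟨M, hM⟩ := hg.bdd
  refine hf.int.mul_bdd (c := M) hg.meas.aestronglyMeasurable ?_
  filter_upwards with y using hM y

lemma Nice.sq {f : E n → ℝ} (hf : Nice f) : Integrable fun x => f x ^ 2 := by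
  simp_rw [pow_two]; exact hf.mul hf

lemma pair_bound {A B : ℝ} (hB : 0 ≤ B) {R : ℤ → E n → E n → ℝ} (hR : ∀ k : ℤ, Dom A (2 ^ k) (R k))
    {k l : ℤ} {β : ℝ} (hβ : 0 ≤ β)
    (H1 : ∀ x', ∫⁻ x, ‖KK R k l x x'‖ₑ ≤ ENNReal.ofReal β)
    (H2 : ∀ x, ∫⁻ x', ‖KK R k l x x'‖ₑ ≤ ENNReal.ofReal B) {τ : ℝ} (hτ : 0 < τ)
    {g g' : E n → ℝ} (hg : Nice g) (hg' : Nice g') :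
    |∫ y, op (fun x y => R k y x) g y * op (fun x y => R l y x) g' y| ≤
      B * τ / 2 * (∫ x, g x ^ 2) + β * τ⁻¹ / 2 * ∫ x, g' x ^ 2 := by
  obtain ⟨M, hM⟩ := hg.bdd
  obtain ⟨M', hM'⟩ := hg'.bdd
  have e1 : ∫ y, op (fun x y => R k y x) g y * op (fun x y => R l y x) g' y =
      ∫ x, g x * ∫ x', g' x' * KK R k l x x' := by
    have := op_dual (two_pos k) (hR k) (Nice.op (two_pos l) (hR l).swap hg').int hg.meas hM
    rw [show (∫ y, op (fun x y => R k y x) g y * op (fun x y => R l y x) g' y) =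
      ∫ y, op (fun x y => R l y x) g' y * op (fun x y => R k y x) g y by
        congr 1; funext y; ring, ← this]
    congr 1; funext x; congr 1
    have h2 : ∀ y, |R k x y| ≤ A * (((2:ℝ) ^ k) ^ n)⁻¹ := fun y =>
      ((hR k).le x y).trans (by
        have := (hR k).A_nonneg (two_pos k)
        gcongr; exact rho_le (two_pos k) _)
    have := op_dual (two_pos l) (hR l).swap hg'.int ((hR k).measy x) h2
    rw [show JV.op (R k) (JV.op (fun x y => R l y x) g') x =
      ∫ y, R k x y * JV.op (fun x y => R l y x) g' y from rfl, this]
    congr 1; funext x'; congr 1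
    unfold KK op
    congr 1; funext y; ring
  rw [e1]
  have mK := measurable_KK hR k l
  have m1 : Measurable fun z : E n × E n => ‖KK R k l z.1 z.2‖ₑ := mK.enorm
  have i1 : ∫⁻ x, ENNReal.ofReal (τ / 2 * g x ^ 2) = ENNReal.ofReal (τ / 2 * ∫ x, g x ^ 2) := by
    rw [← ofReal_integral_eq_lintegral_ofReal (hg.sq.const_mul _)
      (by filter_upwards with x using by positivity), integral_const_mul]
  have i2 : ∫⁻ x, ENNReal.ofReal (τ⁻¹ / 2 * g' x ^ 2) =
      ENNReal.ofReal (τ⁻¹ / 2 * ∫ x, g' x ^ 2) := by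
    rw [← ofReal_integral_eq_lintegral_ofReal (hg'.sq.const_mul _)
      (by filter_upwards with x using by positivity), integral_const_mul]
  have key : ‖∫ x, g x * ∫ x', g' x' * KK R k l x x'‖ₑ ≤
      ENNReal.ofReal (B * τ / 2 * (∫ x, g x ^ 2) + β * τ⁻¹ / 2 * ∫ x, g' x ^ 2) := by
    calc _ ≤ ∫⁻ x, ‖g x * ∫ x', g' x' * KK R k l x x'‖ₑ := enorm_integral_le_lintegral_enorm _
      _ ≤ ∫⁻ x, ∫⁻ x', ‖g x‖ₑ * ‖g' x' * KK R k l x x'‖ₑ := by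
          refine lintegral_mono fun x => ?_
          rw [enorm_mul, lintegral_const_mul' _ _ enorm_ne_top]
          gcongr
          exact enorm_integral_le_lintegral_enorm _
      _ ≤ ∫⁻ x, ∫⁻ x', (ENNReal.ofReal (τ / 2 * g x ^ 2) * ‖KK R k l x x'‖ₑ +
            ENNReal.ofReal (τ⁻¹ / 2 * g' x' ^ 2) * ‖KK R k l x x'‖ₑ) := by
          refine lintegral_mono fun x => lintegral_mono fun x' => ?_
          rw [enorm_mul, ← mul_assoc, ← add_mul]
          gcongr
          rw [← ENNReal.ofReal_add (by positivity) (by positivity), ← enorm_mul, ← ofReal_norm]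
          apply ENNReal.ofReal_le_ofReal
          rw [norm_mul, Real.norm_eq_abs, Real.norm_eq_abs, ← sq_abs (g x), ← sq_abs (g' x')]
          have : 0 ≤ (τ * |g x| - |g' x'|) ^ 2 / (2 * τ) := by positivity
          have h3 : (τ * |g x| - |g' x'|) ^ 2 / (2 * τ) =
            τ / 2 * |g x| ^ 2 + τ⁻¹ / 2 * |g' x'| ^ 2 - |g x| * |g' x'| := by
            field_simp; ring
          linarith
      _ = (∫⁻ x, ENNReal.ofReal (τ / 2 * g x ^ 2) * ∫⁻ x', ‖KK R k l x x'‖ₑ) +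
          ∫⁻ x', ENNReal.ofReal (τ⁻¹ / 2 * g' x' ^ 2) * ∫⁻ x, ‖KK R k l x x'‖ₑ := by
          have m2 : Measurable fun z : E n × E n =>
            ENNReal.ofReal (τ / 2 * g z.1 ^ 2) * ‖KK R k l z.1 z.2‖ₑ := by
            have := hg.meas
            fun_prop
          have m3 : Measurable fun z : E n × E n =>
            ENNReal.ofReal (τ⁻¹ / 2 * g' z.2 ^ 2) * ‖KK R k l z.1 z.2‖ₑ := by
            have := hg'.meas
            fun_prop
          have : ∀ x, ∫⁻ x', (ENNReal.ofReal (τ / 2 * g x ^ 2) * ‖KK R k l x x'‖ₑ +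
            ENNReal.ofReal (τ⁻¹ / 2 * g' x' ^ 2) * ‖KK R k l x x'‖ₑ) =
            (∫⁻ x', ENNReal.ofReal (τ / 2 * g x ^ 2) * ‖KK R k l x x'‖ₑ) + ∫⁻ x',
            ENNReal.ofReal (τ⁻¹ / 2 * g' x' ^ 2) * ‖KK R k l x x'‖ₑ := fun x =>
            lintegral_add_left (m2.comp (measurable_const.prodMk measurable_id)) _
          simp_rw [this]
          rw [lintegral_add_left m2.lintegral_prod_right', lintegral_lintegral_swap (f := fun x x' =>
            ENNReal.ofReal (τ⁻¹ / 2 * g' x' ^ 2) * ‖KK R k l x x'‖ₑ) m3.aemeasurable]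
          congr 1
          · refine lintegral_congr fun x => ?_
            exact lintegral_const_mul' (ENNReal.ofReal (τ / 2 * g x ^ 2)) (fun x' => ‖KK R k l x x'‖ₑ)
              ofReal_ne_top
          · refine lintegral_congr fun x => ?_
            rw [lintegral_const_mul' _ _ ofReal_ne_top]
      _ ≤ (∫⁻ x, ENNReal.ofReal (τ / 2 * g x ^ 2) * ENNReal.ofReal B) +
          ∫⁻ x', ENNReal.ofReal (τ⁻¹ / 2 * g' x' ^ 2) * ENNReal.ofReal β :=
          add_le_add (lintegral_mono fun x => mul_le_mul' le_rfl (H2 x))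
            (lintegral_mono fun x => mul_le_mul' le_rfl (H1 x))
      _ = _ := by
          rw [lintegral_mul_const' _ _ ofReal_ne_top, lintegral_mul_const' _ _ ofReal_ne_top, i1, i2]
          have j1 : 0 ≤ ∫ x, g x ^ 2 := integral_nonneg fun x => by positivity
          have j2 : 0 ≤ ∫ x, g' x ^ 2 := integral_nonneg fun x => by positivity
          rw [← ENNReal.ofReal_mul (by positivity), ← ENNReal.ofReal_mul (by positivity),
            ← ENNReal.ofReal_add (by positivity) (by positivity)]
          congr 1
          ring
  rw [← ofReal_norm] at key
  have j1 : 0 ≤ ∫ x, g x ^ 2 := integral_nonneg fun x => by positivity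
  have j2 : 0 ≤ ∫ x, g' x ^ 2 := integral_nonneg fun x => by positivity
  exact (ENNReal.ofReal_le_ofReal_iff (by positivity)).1 key

lemma pair_bound' {A B : ℝ} (hB : 0 ≤ B) {R : ℤ → E n → E n → ℝ} (hR : ∀ k : ℤ, Dom A (2 ^ k) (R k))
    (H1 : ∀ k l : ℤ, k ≤ l → ∀ x', ∫⁻ x, ‖KK R k l x x'‖ₑ ≤ ENNReal.ofReal (B * 2 ^ (k - l)))
    (H2 : ∀ k l : ℤ, k ≤ l → ∀ x, ∫⁻ x', ‖KK R k l x x'‖ₑ ≤ ENNReal.ofReal B)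
    (k l : ℤ) {g g' : E n → ℝ} (hg : Nice g) (hg' : Nice g') :
    |∫ y, op (fun x y => R k y x) g y * op (fun x y => R l y x) g' y| ≤
      B * (3/4 : ℝ) ^ (k - l).natAbs / 2 * ((∫ x, g x ^ 2) + ∫ x, g' x ^ 2) := by
  have j : ∀ g : E n → ℝ, 0 ≤ ∫ x, g x ^ 2 := fun g => integral_nonneg fun x => by positivity
  have main : ∀ (k l : ℤ), k ≤ l → ∀ {g g' : E n → ℝ}, Nice g → Nice g' →
    |∫ y, op (fun x y => R k y x) g y * op (fun x y => R l y x) g' y| ≤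
      B * (3/4 : ℝ) ^ (k - l).natAbs / 2 * ((∫ x, g x ^ 2) + ∫ x, g' x ^ 2) := by
    intro k l hkl g g' hg hg'
    obtain ⟨d, rfl⟩ := Int.le.dest hkl
    have := pair_bound hB hR (by positivity) (H1 k _ hkl) (H2 k _ hkl)
      (τ := (3/4 : ℝ) ^ d) (by positivity) hg hg'
    refine this.trans ?_
    rw [show (k - (k + (d:ℤ))).natAbs = d by omega, show k - (k + (d:ℤ)) = -(d:ℤ) by ring, zpow_neg,
      zpow_natCast]
    have h5 : ((2:ℝ) ^ d)⁻¹ * ((3/4:ℝ) ^ d)⁻¹ ≤ (3/4) ^ d := by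
      rw [← mul_inv, ← mul_pow, ← inv_pow]
      gcongr
      norm_num
    rw [mul_add]
    have e : B * ((2:ℝ) ^ d)⁻¹ * ((3/4:ℝ) ^ d)⁻¹ = B * (((2:ℝ) ^ d)⁻¹ * ((3/4:ℝ) ^ d)⁻¹) := by ring
    rw [e]
    have := j g'
    gcongr
  rcases le_total k l with h | h
  · exact main k l h hg hg'
  · have := main l k h hg' hg
    rw [show (k - l).natAbs = (l - k).natAbs by omega, add_comm (∫ x, g x ^ 2)]
    convert this using 4
    ring

lemma almost_orth {A B : ℝ} (hB : 0 < B) {R : ℤ → E n → E n → ℝ} (hR : ∀ k : ℤ, Dom A (2 ^ k) (R k))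
    (H1 : ∀ k l : ℤ, k ≤ l → ∀ x', ∫⁻ x, ‖KK R k l x x'‖ₑ ≤ ENNReal.ofReal (B * 2 ^ (k - l)))
    (H2 : ∀ k l : ℤ, k ≤ l → ∀ x, ∫⁻ x', ‖KK R k l x x'‖ₑ ≤ ENNReal.ofReal B)
    (s : Finset ℤ) {f : E n → ℝ} (hf : Nice f) :
    ∑ k ∈ s, ∫ x, (op (R k) f x) ^ 2 ≤ 8 * B * ∫ x, f x ^ 2 := by
  set X := ∑ k ∈ s, ∫ x, (op (R k) f x) ^ 2 with hX
  have hg : ∀ k, Nice (op (R k) f) := fun k => Nice.op (two_pos k) (hR k) hf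
  set h : ℤ → E n → ℝ := fun k => op (fun x y => R k y x) (op (R k) f) with hh
  have hhn : ∀ k, Nice (h k) := fun k => Nice.op (two_pos k) (hR k).swap (hg k)
  have e1 : X = ∫ y, f y * ∑ k ∈ s, h k y := by
    simp_rw [Finset.mul_sum]
    rw [integral_finsetSum _ fun k _ => hf.mul (hhn k), hX]
    refine Finset.sum_congr rfl fun k _ => ?_
    obtain ⟨M, hM⟩ := (hg k).bdd
    rw [← op_dual (two_pos k) (hR k) hf.int (hg k).meas hM]
    simp_rw [pow_two]
  have hsq : ∀ y, (∑ k ∈ s, h k y) ^ 2 = ∑ k ∈ s, ∑ l ∈ s, h k y * h l y := fun y => by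
    rw [pow_two, Finset.sum_mul_sum]
  have e2 : ∫ y, (∑ k ∈ s, h k y) ^ 2 ≤ 8 * B * X := by
    simp_rw [hsq]
    rw [integral_finsetSum _ fun k _ => integrable_finsetSum _ fun l _ => (hhn k).mul (hhn l)]
    calc _ = ∑ k ∈ s, ∑ l ∈ s, ∫ y, h k y * h l y := by
          refine Finset.sum_congr rfl fun k _ => ?_
          rw [integral_finsetSum _ fun l _ => (hhn k).mul (hhn l)]
      _ ≤ ∑ k ∈ s, ∑ l ∈ s, B * (3/4 : ℝ) ^ (k - l).natAbs / 2 *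
          ((∫ x, (op (R k) f x) ^ 2) + ∫ x, (op (R l) f x) ^ 2) := by
          refine Finset.sum_le_sum fun k _ => Finset.sum_le_sum fun l _ => ?_
          exact (le_abs_self _).trans (pair_bound' hB.le hR H1 H2 k l (hg k) (hg l))
      _ = B * ∑ k ∈ s, (∫ x, (op (R k) f x) ^ 2) * ∑ l ∈ s, (3/4 : ℝ) ^ (k - l).natAbs := by
          simp_rw [mul_add, Finset.sum_add_distrib]
          rw [Finset.sum_comm (f := fun k l => B * (3/4 : ℝ) ^ (k - l).natAbs / 2 *
            ∫ x, (op (R l) f x) ^ 2), ← Finset.sum_add_distrib, Finset.mul_sum]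
          refine Finset.sum_congr rfl fun k _ => ?_
          rw [Finset.mul_sum, Finset.mul_sum, ← Finset.sum_add_distrib]
          refine Finset.sum_congr rfl fun l _ => ?_
          rw [show (l - k).natAbs = (k - l).natAbs by omega]
          ring
      _ ≤ B * ∑ k ∈ s, (∫ x, (op (R k) f x) ^ 2) * 8 := by
          gcongr with k
          exact (geo (by norm_num) (by norm_num) s k).trans (by norm_num)
      _ = _ := by rw [← Finset.sum_mul, ← hX]; ring
  have hsn : Integrable fun y => (∑ k ∈ s, h k y) ^ 2 := by
    simp_rw [hsq]
    exact integrable_finsetSum _ fun k _ => integrable_finsetSum _ fun l _ => (hhn k).mul (hhn l)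
  have e3 : X ≤ ∫ y, (4 * B * f y ^ 2 + (16 * B)⁻¹ * (∑ k ∈ s, h k y) ^ 2) := by
    rw [e1]
    refine integral_mono ?_ ((hf.sq.const_mul _).add (hsn.const_mul _)) fun y => ?_
    · simp_rw [Finset.mul_sum]
      exact integrable_finsetSum _ fun k _ => hf.mul (hhn k)
    · simp only
      have : 0 ≤ (8 * B * f y - ∑ k ∈ s, h k y) ^ 2 / (16 * B) := by positivity
      have h3 : (8 * B * f y - ∑ k ∈ s, h k y) ^ 2 / (16 * B) = 4 * B * f y ^ 2 + (16 * B)⁻¹ *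
        (∑ k ∈ s, h k y) ^ 2 - f y * ∑ k ∈ s, h k y := by field_simp; ring
      linarith
  rw [integral_add (hf.sq.const_mul _) (hsn.const_mul _), integral_const_mul, integral_const_mul] at e3
  have : (16 * B)⁻¹ * ∫ y, (∑ k ∈ s, h k y) ^ 2 ≤ X / 2 := by
    calc _ ≤ (16 * B)⁻¹ * (8 * B * X) := by gcongr
      _ = _ := by field_simp; ring
  linarith

end JV

-- part 5
namespace JV

variable {n : ℕ}

/-! ### Part 7: kernels and the square function estimate -/

/-- The normalised kernel class. -/
structure Ker (s : ℤ → E n → E n → ℝ) : Prop where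
  meas : ∀ k, Measurable (Function.uncurry (s k))
  size : ∀ k x y, |s k x y| ≤ rho (2 ^ k) (x - y)
  regy : ∀ k x y y', |s k x y - s k x y'| ≤
    ((2:ℝ) ^ k)⁻¹ * ‖y - y'‖ * (rho (2 ^ k) (x - y) + rho (2 ^ k) (x - y'))
  regx : ∀ k x x' y, |s k x y - s k x' y| ≤
    ((2:ℝ) ^ k)⁻¹ * ‖x - x'‖ * (rho (2 ^ k) (x - y) + rho (2 ^ k) (x' - y))

lemma Ker.dom {s : ℤ → E n → E n → ℝ} (h : Ker s) (k : ℤ) : Dom 1 (2 ^ k) (s k) :=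
  ⟨h.meas k, fun x y => by rw [one_mul]; exact h.size k x y⟩

/-- `u_k = S_k 1` -/
def uk (s : ℤ → E n → E n → ℝ) (k : ℤ) (x : E n) : ℝ := ∫ y, s k x y

lemma abs_uk_le {s : ℤ → E n → E n → ℝ} (h : Ker s) (k : ℤ) (x : E n) : |uk s k x| ≤ I0 n := by
  have := abs_op_le (two_pos k) (h.dom k) (a := fun _ => 1) (M := 1) (by simp) x
  simpa [op, uk] using this

lemma measurable_uk {s : ℤ → E n → E n → ℝ} (h : Ker s) (k : ℤ) : Measurable (uk s k) := by
  have := measurable_op (h.dom k) (a := fun _ => 1) measurable_const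
  have e : op (s k) (fun _ => 1) = uk s k := by funext x; simp [op, uk]
  rwa [e] at this

/-- kernel of the conditional expectation -/
def ek (k : ℤ) (x y : E n) : ℝ := (((2:ℝ) ^ k) ^ n)⁻¹ * (Q k x).indicator 1 y

lemma measurable_ek (k : ℤ) : Measurable (Function.uncurry (ek (n := n) k)) := by
  unfold ek
  refine Measurable.const_mul ?_ _
  have : (Function.uncurry fun x y : E n => (Q k x).indicator (1 : E n → ℝ) y) =
      Set.indicator {z : E n × E n | q k z.2 = q k z.1} 1 := by
    funext z
    rfl
  show Measurable (Function.uncurry fun x y : E n => (Q k x).indicator (1 : E n → ℝ) y)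
  rw [this]
  refine measurable_one.indicator ?_
  exact measurableSet_eq_fun ((measurable_q k).comp measurable_snd) ((measurable_q k).comp measurable_fst)

lemma rho_ge_of_le {t c : ℝ} (ht : 0 < t) (hc : 0 ≤ c) {h : E n} (hh : ‖h‖ ≤ c * t) :
    (t ^ n)⁻¹ ≤ (c + 1) ^ (n + 2) * rho t h := by
  unfold rho
  rw [← mul_div_assoc, le_div_iff₀ (by positivity)]
  calc (t ^ n)⁻¹ * (t + ‖h‖) ^ (n + 2) ≤ (t ^ n)⁻¹ * ((c + 1) * t) ^ (n + 2) := by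
        gcongr; linarith
    _ = _ := by
        rw [mul_pow, pow_add t]; field_simp

lemma ek_dom (k : ℤ) : Dom (n := n) ((n + 1) ^ (n + 2)) (2 ^ k) (ek k) := by
  refine ⟨measurable_ek k, fun x y => ?_⟩
  unfold ek
  by_cases h : y ∈ Q k x
  · rw [Set.indicator_of_mem h, Pi.one_apply, mul_one, abs_of_nonneg (by positivity), rho_comm]
    exact rho_ge_of_le (two_pos k) (by positivity) (norm_sub_le_of_mem_Q h)
  · rw [Set.indicator_of_notMem h, mul_zero, abs_zero]
    have := rho_pos (two_pos k) (x - y)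
    positivity

lemma op_ek (k : ℤ) (f : E n → ℝ) (x : E n) : op (ek k) f x = Ek k f x := by
  unfold op ek Ek
  rw [← integral_indicator (measurableSet_Q k x), ← integral_const_mul]
  congr 1
  funext y
  by_cases h : y ∈ Q k x <;> simp [h]

lemma int_ek (k : ℤ) (x : E n) : ∫ y, ek k x y = 1 := by
  have := op_ek k (fun _ => 1) x
  rw [Ek_const] at this
  simpa [op] using this

/-- the remainder kernel -/
def Rk (s : ℤ → E n → E n → ℝ) (k : ℤ) (x y : E n) : ℝ := s k x y - uk s k x * ek k x y

/-- constant -/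
def A1 (n : ℕ) : ℝ := 1 + I0 n * (n + 1) ^ (n + 2)

lemma A1_pos : 0 < A1 n := by
  unfold A1; have := I0_nonneg (n := n); positivity

lemma Rk_dom {s : ℤ → E n → E n → ℝ} (h : Ker s) (k : ℤ) : Dom (A1 n) (2 ^ k) (Rk s k) := by
  refine ⟨?_, fun x y => ?_⟩
  · exact (h.meas k).sub (((measurable_uk h k).comp measurable_fst).mul (measurable_ek k))
  · unfold Rk A1
    rw [add_mul, one_mul, mul_assoc]
    refine (abs_sub _ _).trans (add_le_add (h.size k x y) ?_)
    rw [abs_mul]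
    exact mul_le_mul (abs_uk_le h k x) ((ek_dom k).le x y) (abs_nonneg _) I0_nonneg

lemma int_Rk {s : ℤ → E n → E n → ℝ} (h : Ker s) (k : ℤ) (x : E n) : ∫ y, Rk s k x y = 0 := by
  unfold Rk
  rw [integral_sub ((h.dom k).inty (two_pos k) x) (((ek_dom k).inty (two_pos k) x).const_mul _),
    integral_const_mul, int_ek, mul_one, uk, sub_self]

lemma op_Rk {s : ℤ → E n → E n → ℝ} (h : Ker s) (k : ℤ) {f : E n → ℝ} (hf : Measurable f) {M : ℝ}
    (hM : ∀ x, |f x| ≤ M) (x : E n) :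
    op (s k) f x = uk s k x * Ek k f x + op (Rk s k) f x := by
  rw [← op_ek]
  unfold op Rk
  simp_rw [sub_mul, mul_assoc]
  rw [integral_sub ((h.dom k).int_mul (two_pos k) hf hM x)
    (((ek_dom k).int_mul (two_pos k) hf hM x).const_mul _), integral_const_mul]
  ring

lemma mem_Q_iff {k : ℤ} {x y : E n} : y ∈ Q k x ↔
    ∀ i, y i ∈ Set.Ico ((2:ℝ)^k * q k x i) ((2:ℝ)^k * (q k x i + 1)) := by
  rw [mem_Q, funext_iff]
  refine forall_congr' fun i => ?_
  have h3 := two_pos k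
  rw [show q k y i = ⌊(2:ℝ) ^ (-k) * y i⌋ from rfl, Int.floor_eq_iff, zpow_neg,
    le_inv_mul_iff₀ h3, inv_mul_lt_iff₀ h3, Set.mem_Ico]

lemma vol_slab {k : ℤ} (x h : E n) (i : Fin n) :
    volume {y | y ∈ Q k x ∧ y i + h i ∉ Set.Ico ((2:ℝ)^k * q k x i) ((2:ℝ)^k * (q k x i + 1))} ≤
      ENNReal.ofReal (|h i| * ((2:ℝ) ^ k) ^ (n - 1)) := by
  set a := (2:ℝ)^k * q k x i with ha
  set b := (2:ℝ)^k * (q k x i + 1) with hb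
  set J : Set ℝ := if 0 ≤ h i then Set.Ico (b - h i) b else Set.Ico a (a - h i) with hJ
  have hJm : MeasurableSet J := by rw [hJ]; split_ifs <;> exact measurableSet_Ico
  have hJv : volume J = ENNReal.ofReal |h i| := by
    rw [hJ]
    split_ifs with h0
    · rw [Real.volume_Ico, abs_of_nonneg h0]; congr 1; ring
    · rw [Real.volume_Ico, abs_of_neg (not_le.1 h0)]; congr 1; ring
  set B : Fin n → Set ℝ := Function.update
    (fun i => Set.Ico ((2:ℝ)^k * q k x i) ((2:ℝ)^k * (q k x i + 1))) i J with hB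
  have hsub : {y | y ∈ Q k x ∧ y i + h i ∉ Set.Ico a b} ⊆
      (WithLp.ofLp : E n → (Fin n → ℝ)) ⁻¹' (Set.univ.pi B) := by
    rintro y ⟨hy, hy2⟩ j -
    rw [mem_Q_iff] at hy
    by_cases hj : j = i
    · subst hj
      rw [hB, Function.update_self, hJ]
      have h1 := hy j
      rw [← ha, ← hb] at h1
      simp only [Set.mem_Ico, not_and, not_lt] at h1 hy2
      split_ifs with h0
      · exact ⟨by have := hy2 (by linarith); linarith, h1.2⟩
      · refine ⟨h1.1, ?_⟩
        by_contra hc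
        have := hy2 (by linarith)
        linarith
    · rw [hB, Function.update_of_ne hj]
      exact hy j
  have hBm : ∀ j, MeasurableSet (B j) := by
    intro j
    by_cases hj : j = i
    · subst hj; rw [hB, Function.update_self]; exact hJm
    · rw [hB, Function.update_of_ne hj]; exact measurableSet_Ico
  refine (measure_mono hsub).trans ?_
  rw [(PiLp.volume_preserving_ofLp (Fin n)).measure_preimage
    (MeasurableSet.univ_pi hBm).nullMeasurableSet, volume_pi_pi,
    ← Finset.mul_prod_erase _ _ (Finset.mem_univ i), hB, Function.update_self, hJv,
    ENNReal.ofReal_mul (abs_nonneg _)]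
  gcongr
  rw [Finset.prod_congr rfl (g := fun _ => ENNReal.ofReal ((2:ℝ) ^ k))]
  · rw [Finset.prod_const, Finset.card_erase_of_mem (Finset.mem_univ _), Finset.card_univ,
      Fintype.card_fin, ENNReal.ofReal_pow (two_pos k).le]
  · intro j hj
    rw [Function.update_of_ne (Finset.ne_of_mem_erase hj), Real.volume_Ico]
    congr 1; ring

lemma vol_shift {k : ℤ} (x h : E n) :
    volume {y | y ∈ Q k x ∧ y + h ∉ Q k x} ≤
      ENNReal.ofReal (n * ‖h‖ * ((2:ℝ) ^ k)⁻¹ * ((2:ℝ) ^ k) ^ n) := by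
  have hsub : {y | y ∈ Q k x ∧ y + h ∉ Q k x} ⊆ ⋃ i, {y | y ∈ Q k x ∧
      y i + h i ∉ Set.Ico ((2:ℝ)^k * q k x i) ((2:ℝ)^k * (q k x i + 1))} := by
    rintro y ⟨hy, hy2⟩
    rw [mem_Q_iff] at hy2
    push Not at hy2
    obtain ⟨i, hi⟩ := hy2
    exact Set.mem_iUnion.2 ⟨i, hy, hi⟩
  refine (measure_mono hsub).trans ((measure_iUnion_fintype_le _ _).trans ?_)
  refine (Finset.sum_le_sum fun i _ => vol_slab x h i).trans ?_
  have : ∀ i ∈ (Finset.univ : Finset (Fin n)), ENNReal.ofReal (|h i| * ((2:ℝ) ^ k) ^ (n - 1)) ≤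
      ENNReal.ofReal (‖h‖ * ((2:ℝ) ^ k)⁻¹ * ((2:ℝ) ^ k) ^ n) := by
    intro i _
    apply ENNReal.ofReal_le_ofReal
    have h3 := two_pos k
    have hn : n - 1 + 1 = n := by have := i.2; omega
    have : ((2:ℝ) ^ k)⁻¹ * ((2:ℝ) ^ k) ^ n = ((2:ℝ) ^ k) ^ (n - 1) := by
      conv_lhs => rw [← hn, pow_succ]
      field_simp
    rw [mul_assoc, this]
    gcongr
    exact coord_le_norm h i
  refine (Finset.sum_le_card_nsmul _ _ _ this).trans ?_
  rw [Finset.card_univ, Fintype.card_fin, nsmul_eq_mul, ← ENNReal.ofReal_natCast,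
    ← ENNReal.ofReal_mul (by positivity)]
  apply le_of_eq; congr 1; ring

lemma lint_ek_shift (k : ℤ) (x' h : E n) :
    ∫⁻ x, ‖ek k x' (x + h) - ek k x' x‖ₑ ≤ ENNReal.ofReal (2 * n * ‖h‖ * ((2:ℝ) ^ k)⁻¹) := by
  have h3 := two_pos k
  set S1 := {y | y ∈ Q k x' ∧ y + h ∉ Q k x'}
  set S2 := {y | y ∈ Q k x' ∧ y + -h ∉ Q k x'}
  have mQ := measurableSet_Q k x'
  have m1 : MeasurableSet S1 := mQ.inter (measurable_add_const h mQ.compl)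
  have m2 : MeasurableSet S2 := mQ.inter (measurable_add_const (-h) mQ.compl)
  have h1 : ∀ x, ‖ek k x' (x + h) - ek k x' x‖ₑ ≤ ENNReal.ofReal (((2:ℝ) ^ k) ^ n)⁻¹ *
      (S1.indicator 1 x + S2.indicator 1 (x + h)) := by
    intro x
    have hpos : 0 ≤ (((2:ℝ) ^ k) ^ n)⁻¹ := by positivity
    unfold ek
    rw [← mul_sub, enorm_mul, Real.enorm_of_nonneg hpos]
    gcongr
    by_cases a1 : x ∈ Q k x' <;> by_cases a2 : x + h ∈ Q k x' <;> simp [a1, a2, S1, S2]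
  refine (lintegral_mono h1).trans ?_
  rw [lintegral_const_mul' _ _ ofReal_ne_top, lintegral_add_left (measurable_one.indicator m1),
    lintegral_add_right_eq_self (fun x => S2.indicator (1 : E n → ℝ≥0∞) x) h,
    lintegral_indicator_one m1, lintegral_indicator_one m2]
  calc _ ≤ ENNReal.ofReal (((2:ℝ) ^ k) ^ n)⁻¹ * (ENNReal.ofReal (n * ‖h‖ * ((2:ℝ) ^ k)⁻¹ * ((2:ℝ) ^ k) ^ n)
        + ENNReal.ofReal (n * ‖-h‖ * ((2:ℝ) ^ k)⁻¹ * ((2:ℝ) ^ k) ^ n)) := by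
        gcongr
        · exact vol_shift x' h
        · exact vol_shift x' (-h)
    _ = _ := by
        rw [norm_neg, ← ENNReal.ofReal_add (by positivity) (by positivity),
          ← ENNReal.ofReal_mul (by positivity)]
        congr 1
        field_simp
        ring

lemma lint_Rk_shift {s : ℤ → E n → E n → ℝ} (hs : Ker s) (k : ℤ) (x' h : E n) :
    ∫⁻ x, ‖Rk s k x' (x + h) - Rk s k x' x‖ₑ ≤
      ENNReal.ofReal ((2 * I0 n + 2 * n * I0 n) * (‖h‖ * ((2:ℝ) ^ k)⁻¹)) := by
  have h3 := two_pos k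
  have hI := I0_nonneg (n := n)
  have h1 : ∀ x, ‖Rk s k x' (x + h) - Rk s k x' x‖ₑ ≤
      (ENNReal.ofReal (((2:ℝ) ^ k)⁻¹ * ‖h‖) * (ENNReal.ofReal (rho (2 ^ k) (x' - (x + h))) +
        ENNReal.ofReal (rho (2 ^ k) (x' - x)))) +
        ENNReal.ofReal (I0 n) * ‖ek k x' (x + h) - ek k x' x‖ₑ := by
    intro x
    have : Rk s k x' (x + h) - Rk s k x' x = (s k x' (x + h) - s k x' x) -
      uk s k x' * (ek k x' (x + h) - ek k x' x) := by unfold Rk; ring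
    rw [this]
    refine enorm_sub_le.trans (add_le_add ?_ ?_)
    · rw [← ENNReal.ofReal_add (rho_pos h3 _).le (rho_pos h3 _).le,
        ← ENNReal.ofReal_mul (by positivity), ← ofReal_norm]
      apply ENNReal.ofReal_le_ofReal
      have := hs.regy k x' (x + h) x
      rwa [add_sub_cancel_left] at this
    · rw [enorm_mul]
      gcongr
      rw [← ofReal_norm]
      exact ENNReal.ofReal_le_ofReal (abs_uk_le hs k x')
  refine (lintegral_mono h1).trans ?_
  have mr : Measurable fun x : E n => ENNReal.ofReal (rho (2 ^ k) (x' - x)) :=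
    ((measurable_rho _).comp (measurable_const.sub measurable_id)).ennreal_ofReal
  have mr' : Measurable fun x : E n => ENNReal.ofReal (rho (2 ^ k) (x' - (x + h))) :=
    mr.comp (measurable_add_const h)
  have ms : Measurable fun x : E n => ENNReal.ofReal (((2:ℝ) ^ k)⁻¹ * ‖h‖) *
      (ENNReal.ofReal (rho (2 ^ k) (x' - (x + h))) + ENNReal.ofReal (rho (2 ^ k) (x' - x))) :=
    (mr'.add mr).const_mul _
  rw [lintegral_add_left ms, lintegral_const_mul' _ _ ofReal_ne_top,
    lintegral_add_left mr', lintegral_const_mul' _ _ ofReal_ne_top,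
    lintegral_add_right_eq_self (fun x => ENNReal.ofReal (rho (2 ^ k) (x' - x))) h,
    lint_rho_left h3]
  calc _ ≤ ENNReal.ofReal (((2:ℝ) ^ k)⁻¹ * ‖h‖) * (ENNReal.ofReal (I0 n) + ENNReal.ofReal (I0 n)) +
        ENNReal.ofReal (I0 n) * ENNReal.ofReal (2 * n * ‖h‖ * ((2:ℝ) ^ k)⁻¹) :=
        add_le_add le_rfl (mul_le_mul' le_rfl (lint_ek_shift k x' h))
    _ = _ := by
        rw [← ENNReal.ofReal_add hI hI, ← ENNReal.ofReal_mul (by positivity),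
          ← ENNReal.ofReal_mul hI, ← ENNReal.ofReal_add (by positivity) (by positivity)]
        congr 1
        ring

/-- constant -/
def B1 (n : ℕ) : ℝ := A1 n * (2 * I0 n + 2 * n * I0 n) * J0 n + (A1 n * I0 n) ^ 2

lemma B1_pos : 0 < B1 n := by
  unfold B1
  have := A1_pos (n := n)
  have := I0_pos (n := n)
  have := J0_nonneg (n := n)
  positivity

lemma KK_H1 {s : ℤ → E n → E n → ℝ} (hs : Ker s) (k l : ℤ) (x' : E n) :
    ∫⁻ x, ‖KK (Rk s) k l x x'‖ₑ ≤ ENNReal.ofReal (B1 n * 2 ^ (k - l)) := by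
  have h3 := two_pos k
  have h4 := two_pos l
  have hA := A1_pos (n := n)
  have hI := I0_pos (n := n)
  have hJ := J0_nonneg (n := n)
  have h1 : ∀ x, ‖KK (Rk s) k l x x'‖ₑ ≤
      ∫⁻ h, ENNReal.ofReal (A1 n * rho (2 ^ k) h) * ‖Rk s l x' (x + h) - Rk s l x' x‖ₑ := by
    intro x
    have hb : ∀ y, |Rk s l x' y| ≤ A1 n * (((2:ℝ) ^ l) ^ n)⁻¹ := fun y =>
      ((Rk_dom hs l).le x' y).trans (by gcongr; exact rho_le h4 _)
    have e : KK (Rk s) k l x x' = ∫ y, Rk s k x y * (Rk s l x' y - Rk s l x' x) := by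
      unfold KK
      simp_rw [mul_sub]
      rw [integral_sub ((Rk_dom hs k).int_mul h3 ((Rk_dom hs l).measy x') hb x)
        (((Rk_dom hs k).inty h3 x).mul_const _), integral_mul_const, int_Rk hs, zero_mul, sub_zero]
    rw [e, ← integral_add_left_eq_self (fun y => Rk s k x y * (Rk s l x' y - Rk s l x' x)) x]
    refine (enorm_integral_le_lintegral_enorm _).trans (lintegral_mono fun h => ?_)
    rw [enorm_mul]
    gcongr
    rw [← ofReal_norm]
    apply ENNReal.ofReal_le_ofReal
    refine ((Rk_dom hs k).le x _).trans_eq ?_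
    rw [sub_add_cancel_left, rho_neg]
  refine (lintegral_mono h1).trans ?_
  rw [lintegral_lintegral_swap]
  · calc _ = ∫⁻ h, ENNReal.ofReal (A1 n * rho (2 ^ k) h) *
          ∫⁻ x, ‖Rk s l x' (x + h) - Rk s l x' x‖ₑ := by
          refine lintegral_congr fun h => ?_
          rw [lintegral_const_mul' _ _ ofReal_ne_top]
      _ ≤ ∫⁻ h, ENNReal.ofReal (A1 n * (2 * I0 n + 2 * n * I0 n) * ((2:ℝ) ^ l)⁻¹) *
            ENNReal.ofReal (rho (2 ^ k) h * ‖h‖) := by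
          refine lintegral_mono fun h => ?_
          have hr := rho_pos h3 h
          refine (mul_le_mul' le_rfl (lint_Rk_shift hs l x' h)).trans_eq ?_
          rw [← ENNReal.ofReal_mul (by positivity), ← ENNReal.ofReal_mul (by positivity)]
          congr 1
          ring
      _ = ENNReal.ofReal (A1 n * (2 * I0 n + 2 * n * I0 n) * ((2:ℝ) ^ l)⁻¹) *
            ENNReal.ofReal (2 ^ k * J0 n) := by
          rw [lintegral_const_mul' _ _ ofReal_ne_top, lint_rho_norm h3]
      _ ≤ _ := by
          rw [← ENNReal.ofReal_mul (by positivity)]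
          apply ENNReal.ofReal_le_ofReal
          unfold B1
          rw [add_mul, zpow_sub₀ (by norm_num)]
          refine le_add_of_le_of_nonneg (le_of_eq ?_) (by positivity)
          field_simp
  · refine Measurable.aemeasurable ?_
    have := measurable_rho (n := n) (2 ^ k)
    have h5 := (Rk_dom hs l).measy x'
    refine Measurable.mul ?_ (Measurable.enorm (Measurable.sub ?_ ?_))
    · exact ((this.comp measurable_snd).const_mul _).ennreal_ofReal
    · exact h5.comp (measurable_fst.add measurable_snd)
    · exact h5.comp measurable_fst

lemma KK_H2 {s : ℤ → E n → E n → ℝ} (hs : Ker s) (k l : ℤ) (x : E n) :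
    ∫⁻ x', ‖KK (Rk s) k l x x'‖ₑ ≤ ENNReal.ofReal (B1 n) := by
  have h3 := two_pos k
  have h4 := two_pos l
  have hA := A1_pos (n := n)
  have hI := I0_pos (n := n)
  have hJ := J0_nonneg (n := n)
  have h1 : ∀ x', ‖KK (Rk s) k l x x'‖ₑ ≤
      ∫⁻ y, ENNReal.ofReal (A1 n ^ 2 * rho (2 ^ k) (x - y)) * ENNReal.ofReal (rho (2 ^ l) (x' - y)) := by
    intro x'
    unfold KK
    refine (enorm_integral_le_lintegral_enorm _).trans (lintegral_mono fun y => ?_)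
    have hr := rho_pos h3 (x - y)
    rw [← ENNReal.ofReal_mul (by positivity), ← ofReal_norm, norm_mul]
    apply ENNReal.ofReal_le_ofReal
    calc _ ≤ (A1 n * rho (2 ^ k) (x - y)) * (A1 n * rho (2 ^ l) (x' - y)) :=
          mul_le_mul ((Rk_dom hs k).le x y) ((Rk_dom hs l).le x' y) (abs_nonneg _) (by positivity)
      _ = _ := by ring
  refine (lintegral_mono h1).trans ?_
  rw [lintegral_lintegral_swap]
  · calc _ = ∫⁻ y, ENNReal.ofReal (A1 n ^ 2 * I0 n) * ENNReal.ofReal (rho (2 ^ k) (x - y)) := by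
          refine lintegral_congr fun y => ?_
          have hr := rho_pos h3 (x - y)
          rw [lintegral_const_mul' _ _ ofReal_ne_top, lint_rho_right h4,
            ← ENNReal.ofReal_mul (by positivity), ← ENNReal.ofReal_mul (by positivity)]
          congr 1; ring
      _ = ENNReal.ofReal (A1 n ^ 2 * I0 n) * ENNReal.ofReal (I0 n) := by
          rw [lintegral_const_mul' _ _ ofReal_ne_top, lint_rho_left h3]
      _ ≤ _ := by
          rw [← ENNReal.ofReal_mul (by positivity)]
          apply ENNReal.ofReal_le_ofReal
          unfold B1
          refine le_add_of_nonneg_of_le (by positivity) (le_of_eq ?_)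
          ring
  · refine Measurable.aemeasurable ?_
    have := measurable_rho (n := n) (2 ^ k)
    have h5 := measurable_rho (n := n) (2 ^ l)
    have m1 : Measurable fun z : E n × E n => ENNReal.ofReal (A1 n ^ 2 * rho (2 ^ k) (x - z.2)) :=
      ((this.comp (measurable_const.sub measurable_snd)).const_mul _).ennreal_ofReal
    refine Measurable.mul m1 ?_
    · exact (h5.comp (measurable_fst.sub measurable_snd)).ennreal_ofReal

/-- The `L²` square function estimate. -/
lemma square_fun {s : ℤ → E n → E n → ℝ} (hs : Ker s) (t : Finset ℤ) {f : E n → ℝ} (hf : Nice f) :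
    ∑ k ∈ t, ∫ x, (op (Rk s k) f x) ^ 2 ≤ 8 * B1 n * ∫ x, f x ^ 2 :=
  almost_orth B1_pos (Rk_dom hs) (fun k l _ => KK_H1 hs k l) (fun k l _ => KK_H2 hs k l) t hf

end JV

-- part 6
namespace JV

variable {n : ℕ}

/-! ### Part 8: local estimate for bounded functions -/

/-- local jump control of `S_k 1` -/
def K4 (C4 : ℝ) (s : ℤ → E n → E n → ℝ) : Prop := ∀ (x0 : E n) (K m : ℤ) (μ : ℝ), 0 < μ →
  ∫⁻ x in Q K x0, ENNReal.ofReal (μ ^ 2) * W μ (fun k => uk s k x) m K ≤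
    ENNReal.ofReal (C4 * ((2:ℝ) ^ K) ^ n)

lemma resc {lam r : ℝ} (hr : 0 < r) (X : ℝ≥0∞) : ENNReal.ofReal (lam ^ 2) * X =
    ENNReal.ofReal (r ^ 2) * (ENNReal.ofReal ((lam / r) ^ 2) * X) := by
  rw [← mul_assoc, ← ENNReal.ofReal_mul (by positivity)]
  congr 2
  field_simp

/-- constant -/
def C3 (n : ℕ) (B C4 : ℝ) : ℝ := 256 * B1 n * B + 64 * I0 n ^ 2 * B + 16 * C4

lemma local_bdd {s : ℤ → E n → E n → ℝ} (hs : Ker s) {C4 : ℝ} (hC4 : 0 ≤ C4) (h4 : K4 C4 s)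
    {g : E n → ℝ} (hg : Nice g) {a B : ℝ} (ha : 0 < a) (hB : 0 ≤ B) (hga : ∀ x, |g x| ≤ a)
    (x0 : E n) (K m : ℤ)
    (hinteg : ∫ x, |g x| ≤ B * a * ((2:ℝ) ^ K) ^ n) {lam : ℝ} (hl : 0 < lam) :
    ∫⁻ x in Q K x0, ENNReal.ofReal (lam ^ 2) * W lam (fun k => op (s k) g x) m K ≤
      ENNReal.ofReal (C3 n B C4 * a ^ 2 * ((2:ℝ) ^ K) ^ n) := by
  have h3 := two_pos K
  have hI := I0_pos (n := n)
  have hB1 := B1_pos (n := n)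
  have hg2 : ∫ x, g x ^ 2 ≤ B * a ^ 2 * ((2:ℝ) ^ K) ^ n := by
    calc ∫ x, g x ^ 2 ≤ ∫ x, a * |g x| := by
          refine integral_mono hg.sq (hg.int.abs.const_mul a) fun x => ?_
          simp only
          rw [← sq_abs, pow_two]
          gcongr
          exact hga x
      _ ≤ _ := by
          rw [integral_const_mul]
          calc _ ≤ a * (B * a * ((2:ℝ) ^ K) ^ n) := by gcongr
            _ = _ := by ring
  have hg2' : ∫⁻ x, ENNReal.ofReal (g x ^ 2) ≤ ENNReal.ofReal (B * a ^ 2 * ((2:ℝ) ^ K) ^ n) := by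
    rw [← ofReal_integral_eq_lintegral_ofReal hg.sq (by filter_upwards with x using by positivity)]
    exact ENNReal.ofReal_le_ofReal hg2
  set T1 : E n → ℝ≥0∞ := fun x => ENNReal.ofReal ((lam / (4 * I0 n)) ^ 2) *
    W (lam / (4 * I0 n)) (fun k => Ek k g x) m K with hT1
  set T2 : E n → ℝ≥0∞ := fun x => ENNReal.ofReal ((lam / (4 * a)) ^ 2) *
    W (lam / (4 * a)) (fun k => uk s k x) m K with hT2
  set T3 : E n → ℝ≥0∞ := fun x => ∑ k ∈ Finset.Icc m K, ENNReal.ofReal (8 * (op (Rk s k) g x) ^ 2)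
    with hT3
  have mT1 : Measurable T1 := (measurable_W (fun k => measurable_Ek k g) _ m K).const_mul _
  have mT2 : Measurable T2 := (measurable_W (fun k => measurable_uk hs k) _ m K).const_mul _
  have mR : ∀ k, Measurable (op (Rk s k) g) := fun k => measurable_op (Rk_dom hs k) hg.meas
  have mT3 : Measurable T3 := by
    refine Finset.measurable_sum _ fun k _ => ?_
    exact (((mR k).pow_const 2).const_mul 8).ennreal_ofReal
  have pt : ∀ x, ENNReal.ofReal (lam ^ 2) * W lam (fun k => op (s k) g x) m K ≤
      ENNReal.ofReal ((4 * I0 n) ^ 2) * T1 x + ENNReal.ofReal ((4 * a) ^ 2) * T2 x +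
      ENNReal.ofReal (2 ^ 2) * T3 x := by
    intro x
    have e : (fun k => op (s k) g x) = fun k => uk s k x * Ek k g x + op (Rk s k) g x := by
      funext k; exact op_Rk hs k hg.meas hga x
    rw [e]
    have w1 := W_add lam (fun k => uk s k x * Ek k g x) (fun k => op (Rk s k) g x) m K
    have hE : ∀ k, |Ek k g x| ≤ a := fun k => by
      refine (abs_Ek_le k g x).trans ?_
      rw [← Ek_const k a x]
      exact Ek_mono hg.int.abs.integrableOn (integrableOn_const (volume_Q_ne_top k x)) hga
    have w2 := W_mul hI ha (half_pos hl) (fun k => uk s k x) (fun k => Ek k g x) m K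
      (fun k => abs_uk_le hs k x) hE
    have w3 := W_sq (half_pos hl) (fun k => op (Rk s k) g x) m K
    rw [show lam / 2 / (2 * I0 n) = lam / (4 * I0 n) by field_simp; norm_num,
      show lam / 2 / (2 * a) = lam / (4 * a) by field_simp; norm_num] at w2
    calc _ ≤ ENNReal.ofReal (lam ^ 2) * (W (lam / (4 * I0 n)) (fun k => Ek k g x) m K +
          W (lam / (4 * a)) (fun k => uk s k x) m K + W (lam / 2) (fun k => op (Rk s k) g x) m K) :=
          mul_le_mul' le_rfl (w1.trans (add_le_add w2 le_rfl))
      _ ≤ _ := by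
          rw [mul_add, mul_add]
          refine add_le_add (add_le_add (le_of_eq ?_) (le_of_eq ?_)) ?_
          · exact resc (by positivity) _
          · exact resc (by positivity) _
          · rw [resc (show (0:ℝ) < 2 by norm_num)]
            exact mul_le_mul' le_rfl w3
  refine (lintegral_mono pt).trans ?_
  rw [lintegral_add_right _ (mT3.const_mul _), lintegral_add_left (mT1.const_mul _),
    lintegral_const_mul' _ T1 ofReal_ne_top, lintegral_const_mul' _ T2 ofReal_ne_top,
    lintegral_const_mul' _ T3 ofReal_ne_top]
  have b1 : ∫⁻ x in Q K x0, T1 x ≤ ENNReal.ofReal (4 * (B * a ^ 2 * ((2:ℝ) ^ K) ^ n)) := by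
    refine (setLIntegral_le_lintegral _ _).trans ((W_Ek_int hg.meas hga (by positivity) m K).trans ?_)
    rw [ENNReal.ofReal_mul (by norm_num)]
    refine mul_le_mul' (by simp) hg2'
  have b2 : ∫⁻ x in Q K x0, T2 x ≤ ENNReal.ofReal (C4 * ((2:ℝ) ^ K) ^ n) := h4 x0 K m _ (by positivity)
  have b3 : ∫⁻ x in Q K x0, T3 x ≤ ENNReal.ofReal (64 * B1 n * (B * a ^ 2 * ((2:ℝ) ^ K) ^ n)) := by
    refine (setLIntegral_le_lintegral _ _).trans ?_
    rw [hT3, lintegral_finsetSum _ fun k _ => (((mR k).pow_const 2).const_mul 8).ennreal_ofReal]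
    have : ∀ k ∈ Finset.Icc m K, ∫⁻ x, ENNReal.ofReal (8 * (op (Rk s k) g x) ^ 2) =
        ENNReal.ofReal (8 * ∫ x, (op (Rk s k) g x) ^ 2) := fun k _ => by
      rw [← ofReal_integral_eq_lintegral_ofReal
        ((Nice.op (two_pos k) (Rk_dom hs k) hg).sq.const_mul 8)
        (by filter_upwards with x using by positivity), integral_const_mul]
    rw [Finset.sum_congr rfl this, ← ENNReal.ofReal_sum_of_nonneg fun k _ => by
      have : 0 ≤ ∫ x, (op (Rk s k) g x) ^ 2 := integral_nonneg fun x => by positivity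
      positivity]
    apply ENNReal.ofReal_le_ofReal
    rw [← Finset.mul_sum]
    calc _ ≤ 8 * (8 * B1 n * ∫ x, g x ^ 2) := by gcongr; exact square_fun hs _ hg
      _ ≤ 8 * (8 * B1 n * (B * a ^ 2 * ((2:ℝ) ^ K) ^ n)) := by gcongr
      _ = _ := by ring
  calc _ ≤ ENNReal.ofReal ((4 * I0 n) ^ 2) * ENNReal.ofReal (4 * (B * a ^ 2 * ((2:ℝ) ^ K) ^ n)) +
        ENNReal.ofReal ((4 * a) ^ 2) * ENNReal.ofReal (C4 * ((2:ℝ) ^ K) ^ n) +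
        ENNReal.ofReal (2 ^ 2) * ENNReal.ofReal (64 * B1 n * (B * a ^ 2 * ((2:ℝ) ^ K) ^ n)) := by
        refine add_le_add (add_le_add ?_ ?_) ?_
        · exact mul_le_mul' le_rfl b1
        · exact mul_le_mul' le_rfl b2
        · exact mul_le_mul' le_rfl b3
    _ = _ := by
        rw [← ENNReal.ofReal_mul (by positivity), ← ENNReal.ofReal_mul (by positivity),
          ← ENNReal.ofReal_mul (by positivity), ← ENNReal.ofReal_add (by positivity) (by positivity),
          ← ENNReal.ofReal_add (by positivity) (by positivity)]
        congr 1
        unfold C3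
        ring

end JV

-- part 7
namespace JV

variable {n : ℕ}

/-! ### Part 9: Calderón–Zygmund decomposition -/

lemma Ek_bdd {F : E n → ℝ} (hF : Nice F) {M : ℝ} (hM : ∀ x, |F x| ≤ M) (j : ℤ) (x : E n) :
    |Ek j F x| ≤ M := by
  refine (abs_Ek_le j F x).trans ?_
  rw [← Ek_const j M x]
  exact Ek_mono hF.int.abs.integrableOn (integrableOn_const (volume_Q_ne_top j x)) hM

lemma Ek_abs_int {F : E n → ℝ} (hF : Nice F) {j : ℤ} {U : Set (E n)} (hU : sat j U) :
    ∫⁻ x in U, ‖Ek j F x‖ₑ ≤ ∫⁻ x in U, ‖F x‖ₑ := by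
  refine lint_le_of_cubes j hU fun x _ => ?_
  have h3 := two_pos j
  calc _ = ∫⁻ y in Q j x, ‖Ek j F x‖ₑ := by
        refine setLIntegral_congr_fun (measurableSet_Q j x) fun y hy => ?_
        rw [Ek_congr F hy]
    _ = ENNReal.ofReal ‖((2:ℝ) ^ j) ^ n * Ek j F x‖ := by
        rw [setLIntegral_const, volume_Q, ← ofReal_norm, ← ENNReal.ofReal_mul (norm_nonneg _), norm_mul,
          Real.norm_of_nonneg (show 0 ≤ ((2:ℝ) ^ j) ^ n by positivity), mul_comm]
    _ ≤ _ := by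
        rw [← setIntegral_Q, ofReal_norm]
        exact enorm_integral_le_lintegral_enorm _

/-- the bad function -/
def bad (F : E n → ℝ) (j : ℤ) (U : Set (E n)) : E n → ℝ := U.indicator fun x => F x - Ek j F x

lemma lint_enorm_of_indicator {U : Set (E n)} (hU : MeasurableSet U) (f : E n → ℝ) :
    ∫⁻ x, ‖U.indicator f x‖ₑ = ∫⁻ x in U, ‖f x‖ₑ := by
  rw [← lintegral_indicator hU]
  refine lintegral_congr fun x => ?_
  by_cases h : x ∈ U <;> simp [h]

lemma bad_int {F : E n → ℝ} (hF : Nice F) {j : ℤ} {U : Set (E n)} (hU : sat j U) :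
    ∫⁻ x, ‖bad F j U x‖ₑ ≤ 2 * ∫⁻ x in U, ‖F x‖ₑ := by
  unfold bad
  rw [lint_enorm_of_indicator hU.measurableSet]
  calc _ ≤ ∫⁻ x in U, (‖F x‖ₑ + ‖Ek j F x‖ₑ) := lintegral_mono fun x => enorm_sub_le
    _ = (∫⁻ x in U, ‖F x‖ₑ) + ∫⁻ x in U, ‖Ek j F x‖ₑ := lintegral_add_left hF.meas.enorm _
    _ ≤ _ := by rw [two_mul]; exact add_le_add le_rfl (Ek_abs_int hF hU)

lemma Nice.lint_lt {F : E n → ℝ} (hF : Nice F) : ∫⁻ x, ‖F x‖ₑ < ∞ := hF.int.2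

lemma bad_nice {F : E n → ℝ} (hF : Nice F) {j : ℤ} {U : Set (E n)} (hU : sat j U) :
    Nice (bad F j U) := by
  have hm : Measurable (bad F j U) := (hF.meas.sub (measurable_Ek j F)).indicator hU.measurableSet
  refine ⟨hm, ⟨hm.aestronglyMeasurable, ?_⟩, ?_⟩
  · refine lt_of_le_of_lt (bad_int hF hU) ?_
    exact ENNReal.mul_lt_top (by simp) (lt_of_le_of_lt (setLIntegral_le_lintegral _ _) hF.lint_lt)
  · obtain ⟨M, hM⟩ := hF.bdd
    refine ⟨M + M, fun x => ?_⟩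
    unfold bad
    by_cases h : x ∈ U
    · rw [Set.indicator_of_mem h]
      exact (abs_sub _ _).trans (add_le_add (hM x) (Ek_bdd hF hM j x))
    · rw [Set.indicator_of_notMem h, abs_zero]
      have := (abs_nonneg _).trans (hM x)
      positivity

lemma bad_cancel {F : E n → ℝ} (hF : Nice F) {j : ℤ} {U : Set (E n)} (hU : sat j U) (x : E n) :
    ∫ y in Q j x, bad F j U y = 0 := by
  by_cases h : x ∈ U
  · have h1 := hU x h
    rw [setIntegral_congr_fun (g := fun y => F y - Ek j F x) (measurableSet_Q j x)]
    · rw [integral_sub hF.int.integrableOn (integrableOn_const (volume_Q_ne_top j x)), setIntegral_Q,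
        setIntegral_Q, Ek_const, sub_self]
    · intro y hy
      simp only [bad]
      rw [Set.indicator_of_mem (h1 hy), Ek_congr F hy]
  · rw [setIntegral_congr_fun (g := fun y => 0) (measurableSet_Q j x)]
    · simp
    · intro y hy
      simp only [bad]
      rw [Set.indicator_of_notMem]
      intro hy2
      apply h
      have := hU y hy2
      rw [Q_eq hy] at this
      exact this (mem_Q_self j x)

/-- corner of a cube -/
def corner (j : ℤ) (y : E n) : E n := WithLp.toLp 2 fun i => (2:ℝ) ^ j * q j y i

lemma corner_mem (j : ℤ) (y : E n) : corner j y ∈ Q j y := by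
  rw [mem_Q_iff]
  intro i
  have := two_pos j
  simp only [corner, Set.mem_Ico, le_refl, true_and]
  nlinarith

lemma corner_congr {j : ℤ} {x y : E n} (h : y ∈ Q j x) : corner j y = corner j x := by
  unfold corner; rw [mem_Q.1 h]

lemma measurable_corner (j : ℤ) : Measurable (corner (n := n) j) :=
  measurable_of_q j fun z => WithLp.toLp 2 fun i => (2:ℝ) ^ j * (z i : ℝ)

lemma op_bad_eq {s : ℤ → E n → E n → ℝ} (hs : Ker s) {F : E n → ℝ} (hF : Nice F) {j : ℤ}
    {U : Set (E n)} (hU : sat j U) (k : ℤ) (x : E n) :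
    op (s k) (bad F j U) x = ∫ y, (s k x y - s k x (corner j y)) * bad F j U y := by
  have hb := bad_nice hF hU
  obtain ⟨M, hM⟩ := hb.bdd
  have i1 := (hs.dom k).int_mul (two_pos k) hb.meas hM x
  have i2 : Integrable fun y => s k x (corner j y) * bad F j U y := by
    refine hb.int.bdd_mul (c := (((2:ℝ) ^ k) ^ n)⁻¹)
      (((hs.dom k).measy x).comp (measurable_corner j)).aestronglyMeasurable ?_
    filter_upwards with y
    exact (hs.size k x _).trans (rho_le (two_pos k) _)
  simp_rw [sub_mul]
  rw [integral_sub i1 i2, integral_eq_zero_of_cubes j i2, sub_zero, op]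
  intro z
  rw [setIntegral_congr_fun (g := fun y => s k x (corner j z) * bad F j U y) (measurableSet_Q j z),
    integral_const_mul, bad_cancel hF hU, mul_zero]
  intro y hy
  simp only
  rw [corner_congr hy]

/-- constant -/
def D1 (n : ℕ) : ℝ := 2 * n * I0 n + J0 n

lemma D1_nonneg : 0 ≤ D1 n := by
  unfold D1
  have := I0_nonneg (n := n)
  have := J0_nonneg (n := n)
  positivity

lemma bad_est1 {s : ℤ → E n → E n → ℝ} (hs : Ker s) {F : E n → ℝ} (hF : Nice F) {j : ℤ}
    {U : Set (E n)} (hU : sat j U) (k : ℤ) :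
    ∫⁻ x, ‖op (s k) (bad F j U) x‖ₑ ≤
      ENNReal.ofReal (D1 n * 2 ^ (j - k)) * ∫⁻ y, ‖bad F j U y‖ₑ := by
  have h3 := two_pos k
  have h4 := two_pos j
  have hI := I0_nonneg (n := n)
  have hJ := J0_nonneg (n := n)
  have hb := bad_nice hF hU
  have h1 : ∀ x, ‖op (s k) (bad F j U) x‖ₑ ≤ ∫⁻ y, ENNReal.ofReal (n * 2 ^ (j - k)) *
      (ENNReal.ofReal (rho (2 ^ k) (x - y)) + ENNReal.ofReal (rho (2 ^ k) (x - corner j y))) *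
      ‖bad F j U y‖ₑ := by
    intro x
    rw [op_bad_eq hs hF hU]
    refine (enorm_integral_le_lintegral_enorm _).trans (lintegral_mono fun y => ?_)
    rw [enorm_mul]
    gcongr
    rw [← ENNReal.ofReal_add (rho_pos h3 _).le (rho_pos h3 _).le, ← ENNReal.ofReal_mul (by positivity),
      ← ofReal_norm]
    apply ENNReal.ofReal_le_ofReal
    refine (hs.regy k x y (corner j y)).trans ?_
    have r1 := rho_pos h3 (x - y)
    have r2 := rho_pos h3 (x - corner j y)
    refine mul_le_mul_of_nonneg_right ?_ (by positivity)
    rw [norm_sub_rev, zpow_sub₀ (by norm_num)]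
    have := norm_sub_le_of_mem_Q (corner_mem j y)
    calc _ ≤ ((2:ℝ) ^ k)⁻¹ * (n * 2 ^ j) := by gcongr
      _ = _ := by field_simp
  refine (lintegral_mono h1).trans ?_
  have mr := measurable_rho (n := n) (2 ^ k)
  have m1 : Measurable fun z : E n × E n => ENNReal.ofReal (rho (2 ^ k) (z.1 - z.2)) :=
    (mr.comp (measurable_fst.sub measurable_snd)).ennreal_ofReal
  have m2 : Measurable fun z : E n × E n => ENNReal.ofReal (rho (2 ^ k) (z.1 - corner j z.2)) :=
    (mr.comp (measurable_fst.sub ((measurable_corner j).comp measurable_snd))).ennreal_ofReal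
  rw [lintegral_lintegral_swap]
  · rw [← lintegral_const_mul' _ _ ofReal_ne_top]
    refine lintegral_mono fun y => ?_
    rw [lintegral_mul_const' _ _ enorm_ne_top]
    refine mul_le_mul' ?_ le_rfl
    have m1y : Measurable fun a : E n => ENNReal.ofReal (rho (2 ^ k) (a - y)) :=
      (mr.comp (measurable_id.sub_const y)).ennreal_ofReal
    rw [lintegral_const_mul' _ _ ofReal_ne_top, lintegral_add_left m1y, lint_rho_right h3, lint_rho_right h3,
      ← ENNReal.ofReal_add hI hI, ← ENNReal.ofReal_mul (by positivity)]
    apply ENNReal.ofReal_le_ofReal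
    unfold D1
    have : 0 ≤ J0 n * 2 ^ (j - k) := by positivity
    nlinarith
  · refine Measurable.aemeasurable ?_
    exact ((m1.add m2).const_mul _).mul (hb.meas.enorm.comp measurable_snd)

lemma bad_est2 {s : ℤ → E n → E n → ℝ} (hs : Ker s) {F : E n → ℝ} (hF : Nice F) {j : ℤ}
    {U : Set (E n)} (hU : sat j U) (k : ℤ) {Om : Set (E n)} (hOm : MeasurableSet Om)
    (h : ∀ x ∉ Om, ∀ y ∈ U, 2 ^ j < ‖x - y‖) :
    ∫⁻ x in Omᶜ, ‖op (s k) (bad F j U) x‖ₑ ≤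
      ENNReal.ofReal (D1 n * 2 ^ (k - j)) * ∫⁻ y, ‖bad F j U y‖ₑ := by
  have h3 := two_pos k
  have h4 := two_pos j
  have hI := I0_nonneg (n := n)
  have hJ := J0_nonneg (n := n)
  have hb := bad_nice hF hU
  have h1 : ∀ x ∈ Omᶜ, ‖op (s k) (bad F j U) x‖ₑ ≤ ∫⁻ y, ENNReal.ofReal (((2:ℝ) ^ j)⁻¹) *
      ENNReal.ofReal (rho (2 ^ k) (x - y) * ‖x - y‖) * ‖bad F j U y‖ₑ := by
    intro x hx
    unfold op
    refine (enorm_integral_le_lintegral_enorm _).trans (lintegral_mono fun y => ?_)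
    rw [enorm_mul]
    by_cases hy : y ∈ U
    · gcongr
      have r1 := rho_pos h3 (x - y)
      rw [← ENNReal.ofReal_mul (by positivity), ← ofReal_norm]
      apply ENNReal.ofReal_le_ofReal
      refine (hs.size k x y).trans ?_
      have h5 := h x hx y hy
      rw [inv_mul_eq_div, le_div_iff₀ h4]
      gcongr
    · have : bad F j U y = 0 := Set.indicator_of_notMem hy _
      rw [this]; simp
  refine (setLIntegral_mono' hOm.compl h1).trans ((setLIntegral_le_lintegral _ _).trans ?_)
  have mr := measurable_rho (n := n) (2 ^ k)
  have m1 : Measurable fun z : E n × E n => ENNReal.ofReal (rho (2 ^ k) (z.1 - z.2) * ‖z.1 - z.2‖) :=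
    ((mr.comp (measurable_fst.sub measurable_snd)).mul
      (measurable_fst.sub measurable_snd).norm).ennreal_ofReal
  rw [lintegral_lintegral_swap]
  · rw [← lintegral_const_mul' _ _ ofReal_ne_top]
    refine lintegral_mono fun y => ?_
    rw [lintegral_mul_const' _ _ enorm_ne_top]
    refine mul_le_mul' ?_ le_rfl
    rw [lintegral_const_mul' _ _ ofReal_ne_top,
      lintegral_sub_right_eq_self (fun x => ENNReal.ofReal (rho (2 ^ k) x * ‖x‖)) y,
      lint_rho_norm h3, ← ENNReal.ofReal_mul (by positivity)]
    apply ENNReal.ofReal_le_ofReal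
    unfold D1
    rw [zpow_sub₀ (by norm_num), add_mul]
    refine le_add_of_nonneg_of_le (by positivity) (le_of_eq ?_)
    field_simp
  · refine Measurable.aemeasurable ?_
    exact (m1.const_mul _).mul (hb.meas.enorm.comp measurable_snd)

end JV

-- part 8
namespace JV
variable {n : ℕ}

/-! ### Calderon-Zygmund decomposition -/

/-- stopping sets -/
def US (F : E n → ℝ) (α : ℝ) (m K j : ℤ) : Set (E n) :=
  {x | (j = m ∨ α < Ek j (fun y => |F y|) x) ∧
    ∀ i ∈ Finset.Ioc j K, Ek i (fun y => |F y|) x ≤ α}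

lemma US_sat (F : E n → ℝ) (α : ℝ) (m K j : ℤ) : sat j (US F α m K j) := by
  intro x hx y hy
  refine ⟨?_, fun i hi => ?_⟩
  · rw [Ek_congr _ hy]; exact hx.1
  · rw [Ek_congr _ (Q_mono (Finset.mem_Ioc.1 hi).1.le x hy)]; exact hx.2 i hi

lemma US_ex (F : E n → ℝ) (α : ℝ) {m K : ℤ} (hmK : m ≤ K) (x : E n) :
    ∃ j ∈ Finset.Icc m K, x ∈ US F α m K j := by
  classical
  set s := (Finset.Icc m K).filter fun j => j = m ∨ α < Ek j (fun y => |F y|) x with hs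
  have hne : s.Nonempty := ⟨m, by simp [hs, hmK]⟩
  have h1 := Finset.mem_filter.1 (s.max'_mem hne)
  refine ⟨s.max' hne, h1.1, h1.2, fun i hi => ?_⟩
  by_contra h
  push Not at h
  rw [Finset.mem_Ioc] at hi
  have h2 : i ∈ s := by
    rw [hs, Finset.mem_filter]
    have := (Finset.mem_Icc.1 h1.1).1
    refine ⟨Finset.mem_Icc.2 ⟨this.trans hi.1.le, hi.2⟩, Or.inr h⟩
  have := s.le_max' i h2
  omega

lemma US_lt {F : E n → ℝ} {α : ℝ} {m K : ℤ} {x : E n} {j i : ℤ} (hj : j ∈ Finset.Icc m K)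
    (hi : i ∈ Finset.Icc m K) (hxj : x ∈ US F α m K j) (hxi : x ∈ US F α m K i) : ¬ j < i := by
  intro h
  rw [Finset.mem_Icc] at hj hi
  have h1 := hxj.2 i (Finset.mem_Ioc.2 ⟨h, hi.2⟩)
  rcases hxi.1 with h2 | h2
  · omega
  · linarith

lemma US_sum {F : E n → ℝ} {α : ℝ} {m K : ℤ} {x : E n} {j : ℤ} (hj : j ∈ Finset.Icc m K)
    (hxj : x ∈ US F α m K j) {β : Type*} [AddCommMonoid β] (G : ℤ → E n → β) :
    ∑ i ∈ Finset.Icc m K, (US F α m K i).indicator (G i) x = G j x := by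
  rw [Finset.sum_eq_single_of_mem j hj, Set.indicator_of_mem hxj]
  intro i hi hij
  apply Set.indicator_of_notMem
  intro hxi
  have := US_lt hj hi hxj hxi
  have := US_lt hi hj hxi hxj
  omega

lemma US_lint {F : E n → ℝ} {α : ℝ} {m K : ℤ} (hmK : m ≤ K) (G : E n → ℝ≥0∞) (hG : Measurable G) :
    ∑ i ∈ Finset.Icc m K, ∫⁻ x in US F α m K i, G x = ∫⁻ x, G x := by
  have h1 : ∀ x, G x = ∑ i ∈ Finset.Icc m K, (US F α m K i).indicator G x := by
    intro x
    obtain ⟨j, hj, hx⟩ := US_ex F α hmK x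
    rw [US_sum hj hx fun _ => G]
  rw [lintegral_congr h1, lintegral_finsetSum]
  · refine Finset.sum_congr rfl fun i _ => ?_
    rw [lintegral_indicator (US_sat F α m K i).measurableSet]
  · intro i _
    exact hG.indicator (US_sat F α m K i).measurableSet

/-- good part -/
def good (F : E n → ℝ) (α : ℝ) (m K : ℤ) (x : E n) : ℝ :=
  ∑ j ∈ Finset.Icc m K, (US F α m K j).indicator (Ek j F) x

lemma good_bad {F : E n → ℝ} {α : ℝ} {m K : ℤ} (hmK : m ≤ K) (x : E n) :
    F x - good F α m K x = ∑ j ∈ Finset.Icc m K, bad F j (US F α m K j) x := by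
  obtain ⟨j, hj, hx⟩ := US_ex F α hmK x
  unfold good bad
  rw [US_sum hj hx, US_sum hj hx fun j x => F x - Ek j F x]

lemma measurable_good (F : E n → ℝ) (α : ℝ) (m K : ℤ) : Measurable (good F α m K) := by
  unfold good
  refine Finset.measurable_sum _ fun j _ => ?_
  exact (measurable_Ek j F).indicator (US_sat F α m K j).measurableSet

lemma good_lint {F : E n → ℝ} (hF : Nice F) {α : ℝ} {m K : ℤ} (hmK : m ≤ K) :
    ∫⁻ x, ‖good F α m K x‖ₑ ≤ ∫⁻ x, ‖F x‖ₑ := by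
  rw [← US_lint (F := F) (α := α) hmK _ (measurable_good F α m K).enorm,
    ← US_lint (F := F) (α := α) hmK _ hF.meas.enorm]
  refine Finset.sum_le_sum fun j hj => ?_
  refine le_trans (le_of_eq ?_) (Ek_abs_int hF (US_sat F α m K j))
  refine setLIntegral_congr_fun (US_sat F α m K j).measurableSet fun x hx => ?_
  unfold good
  rw [US_sum hj hx]

lemma Nice.abs {F : E n → ℝ} (hF : Nice F) : Nice fun x => |F x| := by
  refine ⟨hF.meas.abs, hF.int.abs, ?_⟩
  obtain ⟨M, hM⟩ := hF.bdd
  exact ⟨M, fun x => by rw [abs_abs]; exact hM x⟩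

lemma good_le {F : E n → ℝ} (hF : Nice F) {α : ℝ} (hα : 0 < α) {m K : ℤ} (hmK : m ≤ K)
    (hK : ∀ x, Ek K (fun y => |F y|) x ≤ α) (x : E n) : |good F α m K x| ≤ 2 ^ n * α := by
  obtain ⟨j, hj, hx⟩ := US_ex F α hmK x
  unfold good
  rw [US_sum hj hx]
  refine (abs_Ek_le j F x).trans ?_
  rw [Finset.mem_Icc] at hj
  rcases hj.2.lt_or_eq with h | h
  · refine (Ek_succ_le j hF.int.abs (fun y => abs_nonneg _) x).trans ?_
    gcongr
    exact hx.2 (j + 1) (Finset.mem_Ioc.2 ⟨by omega, by omega⟩)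
  · rw [h]
    have : (1:ℝ) ≤ 2 ^ n := one_le_pow₀ (by norm_num)
    nlinarith [hK x]

lemma good_nice {F : E n → ℝ} (hF : Nice F) {α : ℝ} (hα : 0 < α) {m K : ℤ} (hmK : m ≤ K)
    (hK : ∀ x, Ek K (fun y => |F y|) x ≤ α) : Nice (good F α m K) :=
  ⟨measurable_good F α m K, ⟨(measurable_good F α m K).aestronglyMeasurable,
    (good_lint hF hmK).trans_lt hF.lint_lt⟩, _, good_le hF hα hmK hK⟩

/-- translation vector -/
def tv (j : ℤ) (v : Fin n → ℤ) : E n := WithLp.toLp 2 fun i => (2:ℝ) ^ j * v i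

/-- exceptional set -/
def OmS (F : E n → ℝ) (α : ℝ) (m K : ℤ) : Set (E n) :=
  ⋃ j ∈ Finset.Ioc m K, ⋃ v ∈ Fintype.piFinset (fun _ : Fin n => ({-1, 0, 1} : Finset ℤ)),
    (fun x => x + tv j v) ⁻¹' US F α m K j

lemma OmS_meas (F : E n → ℝ) (α : ℝ) (m K : ℤ) : MeasurableSet (OmS F α m K) := by
  refine Finset.measurableSet_biUnion _ fun j _ => Finset.measurableSet_biUnion _ fun v _ => ?_
  exact (measurable_add_const _) (US_sat F α m K j).measurableSet

lemma OmS_vol {F : E n → ℝ} (hF : Nice F) {α : ℝ} {m K : ℤ} (hmK : m ≤ K) :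
    ENNReal.ofReal α * volume (OmS F α m K) ≤ 3 ^ n * ∫⁻ x, ‖F x‖ₑ := by
  have h1 : volume (OmS F α m K) ≤ ∑ j ∈ Finset.Ioc m K, 3 ^ n * volume (US F α m K j) := by
    refine (measure_biUnion_finset_le _ _).trans (Finset.sum_le_sum fun j _ => ?_)
    refine (measure_biUnion_finset_le _ _).trans ?_
    have : ∀ v : Fin n → ℤ, volume ((fun x => x + tv j v) ⁻¹' US F α m K j) = volume (US F α m K j) :=
      fun v => measure_preimage_add_right _ _ _
    simp_rw [this]
    rw [Finset.sum_const, Fintype.card_piFinset_const]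
    simp
  calc _ ≤ ENNReal.ofReal α * ∑ j ∈ Finset.Ioc m K, 3 ^ n * volume (US F α m K j) := by gcongr
    _ = ∑ j ∈ Finset.Ioc m K, 3 ^ n * (ENNReal.ofReal α * volume (US F α m K j)) := by
        rw [Finset.mul_sum]; refine Finset.sum_congr rfl fun j _ => by ring
    _ ≤ ∑ j ∈ Finset.Ioc m K, 3 ^ n * ∫⁻ x in US F α m K j, ‖F x‖ₑ := by
        refine Finset.sum_le_sum fun j hj => mul_le_mul' le_rfl ?_
        have h2 := Ek_abs_int hF.abs (US_sat F α m K j)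
        simp only [← Real.norm_eq_abs, enorm_norm] at h2
        refine le_trans ?_ h2
        rw [← setLIntegral_const]
        refine setLIntegral_mono' (US_sat F α m K j).measurableSet fun x hx => ?_
        rw [← ofReal_norm]
        apply ENNReal.ofReal_le_ofReal
        rcases hx.1 with h | h
        · have := (Finset.mem_Ioc.1 hj).1; omega
        · exact h.le.trans (by simpa only [Real.norm_eq_abs] using le_abs_self _)
    _ ≤ ∑ j ∈ Finset.Icc m K, 3 ^ n * ∫⁻ x in US F α m K j, ‖F x‖ₑ :=
        Finset.sum_le_sum_of_subset Finset.Ioc_subset_Icc_self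
    _ = _ := by rw [← Finset.mul_sum, US_lint hmK _ hF.meas.enorm]

lemma OmS_far {F : E n → ℝ} {α : ℝ} {m K j : ℤ} (hj : j ∈ Finset.Ioc m K) {x y : E n}
    (hx : x ∉ OmS F α m K) (hy : y ∈ US F α m K j) : 2 ^ j < ‖x - y‖ := by
  by_contra h
  push Not at h
  apply hx
  have h4 := two_pos j
  unfold OmS
  simp only [Set.mem_iUnion, Fintype.mem_piFinset]
  refine ⟨j, hj, fun i => q j y i - q j x i, fun i => ?_, ?_⟩
  · have h1 : |(2:ℝ) ^ (-j) * y i - (2:ℝ) ^ (-j) * x i| ≤ 1 := by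
      rw [← mul_sub, abs_mul, abs_of_pos (two_pos _), zpow_neg, inv_mul_le_iff₀ h4, mul_one]
      refine le_trans ?_ h
      have := coord_le_norm (x - y) i
      rw [abs_sub_comm]
      exact this
    rw [abs_le] at h1
    have h2 := Int.floor_le ((2:ℝ) ^ (-j) * y i)
    have h3 := Int.lt_floor_add_one ((2:ℝ) ^ (-j) * y i)
    have h5 := Int.floor_le ((2:ℝ) ^ (-j) * x i)
    have h6 := Int.lt_floor_add_one ((2:ℝ) ^ (-j) * x i)
    have h7 : (q j y i : ℝ) - q j x i < 2 := by unfold q; linarith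
    have h8 : (-2 : ℝ) < (q j y i : ℝ) - q j x i := by unfold q; linarith
    have h7' : q j y i - q j x i < 2 := by exact_mod_cast h7
    have h8' : -2 < q j y i - q j x i := by exact_mod_cast h8
    simp only [Finset.mem_insert, Finset.mem_singleton]
    omega
  · refine US_sat F α m K j y hy ?_
    rw [mem_Q]
    funext i
    unfold q tv
    simp only [PiLp.add_apply]
    rw [mul_add, ← mul_assoc, ← zpow_add₀ (by norm_num), neg_add_cancel, zpow_zero, one_mul,
      Int.floor_add_intCast]
    omega

lemma cz_bad {s : ℤ → E n → E n → ℝ} (hs : Ker s) {F : E n → ℝ} (hF : Nice F) {α : ℝ}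
    {m K : ℤ} (hmK : m ≤ K) :
    ∫⁻ x in (OmS F α m K)ᶜ, ∑ k ∈ Finset.Icc m K, ‖op (s k) (fun y => F y - good F α m K y) x‖ₑ ≤
      ENNReal.ofReal (8 * D1 n) * ∫⁻ x, ‖F x‖ₑ := by
  have hD := D1_nonneg (n := n)
  have hn : ∀ j, Nice (bad F j (US F α m K j)) := fun j => bad_nice hF (US_sat F α m K j)
  have h1 : ∀ k x, op (s k) (fun y => F y - good F α m K y) x =
      ∑ j ∈ Finset.Icc m K, op (s k) (bad F j (US F α m K j)) x := by
    intro k x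
    unfold op
    rw [← integral_finsetSum]
    · congr 1; funext y; beta_reduce; rw [good_bad hmK, Finset.mul_sum]
    · intro j _
      obtain ⟨M, hM⟩ := (hn j).bdd
      exact (hs.dom k).int_mul (two_pos k) (hn j).meas hM x
  have h2 : ∀ k j, j ∈ Finset.Icc m K → k ∈ Finset.Icc m K →
      ∫⁻ x in (OmS F α m K)ᶜ, ‖op (s k) (bad F j (US F α m K j)) x‖ₑ ≤
      ENNReal.ofReal (D1 n * (1/2 : ℝ) ^ (j - k).natAbs) * (2 * ∫⁻ y in US F α m K j, ‖F y‖ₑ) := by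
    intro k j hj hk
    rw [Finset.mem_Icc] at hj hk
    refine le_trans ?_ (mul_le_mul' le_rfl (bad_int hF (US_sat F α m K j)))
    rcases le_or_gt j k with h | h
    · refine (setLIntegral_le_lintegral _ _).trans ((bad_est1 hs hF (US_sat F α m K j) k).trans_eq ?_)
      have : (2:ℝ) ^ (j - k) = (1/2 : ℝ) ^ (j - k).natAbs := by
        obtain ⟨d, hd⟩ := Int.le.dest h
        have e : j - k = -(d:ℤ) := by omega
        rw [e, Int.natAbs_neg, Int.natAbs_natCast, zpow_neg, zpow_natCast, one_div, inv_pow]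
      rw [this]
    · refine (bad_est2 hs hF (US_sat F α m K j) k (OmS_meas F α m K) fun x hx y hy =>
        OmS_far (Finset.mem_Ioc.2 ⟨by omega, hj.2⟩) hx hy).trans_eq ?_
      have : (2:ℝ) ^ (k - j) = (1/2 : ℝ) ^ (j - k).natAbs := by
        obtain ⟨d, hd⟩ := Int.le.dest h.le
        have e : k - j = -(d:ℤ) := by omega
        have e' : j - k = (d:ℤ) := by omega
        rw [e, e', Int.natAbs_natCast, zpow_neg, zpow_natCast, one_div, inv_pow]
      rw [this]
  have mo : ∀ k j, Measurable fun x => ‖op (s k) (bad F j (US F α m K j)) x‖ₑ := fun k j =>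
    (measurable_op (hs.dom k) (hn j).meas).enorm
  calc _ ≤ ∫⁻ x in (OmS F α m K)ᶜ, ∑ k ∈ Finset.Icc m K, ∑ j ∈ Finset.Icc m K,
        ‖op (s k) (bad F j (US F α m K j)) x‖ₑ := by
        refine lintegral_mono fun x => Finset.sum_le_sum fun k _ => ?_
        rw [h1]
        exact enorm_sum_le _ _
    _ = ∑ k ∈ Finset.Icc m K, ∑ j ∈ Finset.Icc m K, ∫⁻ x in (OmS F α m K)ᶜ,
        ‖op (s k) (bad F j (US F α m K j)) x‖ₑ := by
        rw [lintegral_finsetSum _ fun k _ => Finset.measurable_sum _ fun j _ => mo k j]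
        refine Finset.sum_congr rfl fun k _ => ?_
        rw [lintegral_finsetSum _ fun j _ => mo k j]
    _ ≤ ∑ k ∈ Finset.Icc m K, ∑ j ∈ Finset.Icc m K, ENNReal.ofReal (D1 n * (1/2 : ℝ) ^ (j - k).natAbs) *
        (2 * ∫⁻ y in US F α m K j, ‖F y‖ₑ) :=
        Finset.sum_le_sum fun k hk => Finset.sum_le_sum fun j hj => h2 k j hj hk
    _ = ∑ j ∈ Finset.Icc m K, ENNReal.ofReal (∑ k ∈ Finset.Icc m K, D1 n * (1/2 : ℝ) ^ (j - k).natAbs) *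
        (2 * ∫⁻ y in US F α m K j, ‖F y‖ₑ) := by
        rw [Finset.sum_comm]
        refine Finset.sum_congr rfl fun j _ => ?_
        rw [ENNReal.ofReal_sum_of_nonneg fun k _ => by positivity, Finset.sum_mul]
    _ ≤ ∑ j ∈ Finset.Icc m K, ENNReal.ofReal (4 * D1 n) * (2 * ∫⁻ y in US F α m K j, ‖F y‖ₑ) := by
        refine Finset.sum_le_sum fun j _ => mul_le_mul' (ENNReal.ofReal_le_ofReal ?_) le_rfl
        rw [← Finset.mul_sum]
        have := geo (θ := 1/2) (by norm_num) (by norm_num) (Finset.Icc m K) j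
        norm_num at this ⊢
        nlinarith
    _ = _ := by
        rw [← Finset.mul_sum, ← Finset.mul_sum, US_lint hmK _ hF.meas.enorm, ← mul_assoc]
        congr 1
        rw [show (8:ℝ) * D1 n = 4 * D1 n * 2 by ring, ENNReal.ofReal_mul (p := 4 * D1 n) (by positivity),
          ENNReal.ofReal_ofNat]

end JV

-- part 9
namespace JV
variable {n : ℕ}

/-! ### Poisson-type averages -/

/-- Poisson-type averages -/
def po (k : ℤ) (f : E n → ℝ) (x : E n) : ℝ := ∫ y, rho (2 ^ k) (x - y) * |f y|

/-- normalised Poisson kernel -/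
def pk (k : ℤ) (x y : E n) : ℝ := ((n:ℝ) + 2)⁻¹ * rho (2 ^ k) (x - y)

lemma rho_diff {t : ℝ} (ht : 0 < t) (h h' : E n) :
    |rho t h - rho t h'| ≤ (n + 2) * (t⁻¹ * ‖h - h'‖ * (rho t h + rho t h')) := by
  wlog hle : ‖h‖ ≤ ‖h'‖ generalizing h h'
  · have := this h' h (le_of_not_ge hle)
    rw [abs_sub_comm, norm_sub_rev, add_comm (rho t h)]
    exact this
  have h1 : 0 < t + ‖h‖ := by positivity
  have h2 : 0 < t + ‖h'‖ := by positivity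
  have r1 := rho_pos ht h
  have r2 := rho_pos ht h'
  have e : rho t h' = rho t h * ((t + ‖h‖) / (t + ‖h'‖)) ^ (n + 2) := by
    unfold rho
    rw [div_pow]
    field_simp
  set r := (t + ‖h‖) / (t + ‖h'‖) with hr
  have hr0 : 0 ≤ r := by positivity
  have hr1 : r ≤ 1 := by rw [hr, div_le_one h2]; linarith
  have hb := one_add_mul_le_pow (a := r - 1) (by linarith) (n + 2)
  rw [add_sub_cancel] at hb
  push_cast at hb
  have h3 : 1 - r ≤ t⁻¹ * ‖h - h'‖ := by
    have : 1 - r = (‖h'‖ - ‖h‖) / (t + ‖h'‖) := by rw [hr]; field_simp; ring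
    rw [this, inv_mul_eq_div]
    have h5 : ‖h'‖ - ‖h‖ ≤ ‖h - h'‖ := by rw [norm_sub_rev]; exact norm_sub_norm_le h' h
    refine div_le_div₀ (norm_nonneg _) h5 ht ?_
    linarith [norm_nonneg h']
  have h4 : rho t h' ≤ rho t h := by
    rw [e]; exact mul_le_of_le_one_right r1.le (pow_le_one₀ hr0 hr1)
  rw [abs_of_nonneg (by linarith)]
  calc rho t h - rho t h' = rho t h * (1 - r ^ (n + 2)) := by rw [e]; ring
    _ ≤ rho t h * ((n + 2) * (1 - r)) := by gcongr; linarith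
    _ ≤ rho t h * ((n + 2) * (t⁻¹ * ‖h - h'‖)) := by gcongr
    _ = (n + 2) * (t⁻¹ * ‖h - h'‖ * (rho t h + 0)) := by ring
    _ ≤ _ := by gcongr

lemma pk_ker : Ker (pk (n := n)) := by
  have hn : (0:ℝ) < (n:ℝ) + 2 := by positivity
  have key : ∀ (k : ℤ) (h h' : E n), |((n:ℝ) + 2)⁻¹ * rho (2 ^ k) h - ((n:ℝ) + 2)⁻¹ * rho (2 ^ k) h'| ≤
      ((2:ℝ) ^ k)⁻¹ * ‖h - h'‖ * (rho (2 ^ k) h + rho (2 ^ k) h') := by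
    intro k h h'
    rw [← mul_sub, abs_mul, abs_of_pos (inv_pos.2 hn), inv_mul_le_iff₀ hn]
    exact rho_diff (two_pos k) h h'
  refine ⟨fun k => ?_, fun k x y => ?_, fun k x y y' => ?_, fun k x x' y => ?_⟩
  · exact ((measurable_rho (2 ^ k)).comp (measurable_fst.sub measurable_snd)).const_mul _
  · have := rho_pos (two_pos k) (x - y)
    unfold pk
    rw [abs_of_nonneg (by positivity)]
    refine mul_le_of_le_one_left this.le (inv_le_one_of_one_le₀ ?_)
    have : (0:ℝ) ≤ n := by positivity
    linarith
  · have := key k (x - y) (x - y')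
    have e : x - y - (x - y') = y' - y := by abel
    rw [e, norm_sub_rev] at this
    exact this
  · have := key k (x - y) (x' - y)
    rw [sub_sub_sub_cancel_right] at this
    exact this

lemma op_pk (k : ℤ) (f : E n → ℝ) (x : E n) :
    op (pk k) (fun y => |f y|) x = ((n:ℝ) + 2)⁻¹ * po k f x := by
  unfold op po pk
  rw [← integral_const_mul]
  congr 1; funext y; ring

lemma po_int (k : ℤ) {f : E n → ℝ} (hf : Nice f) (x : E n) :
    Integrable fun y => rho (2 ^ k) (x - y) * |f y| := by
  obtain ⟨M, hM⟩ := hf.abs.bdd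
  have := (pk_ker.dom k).int_mul (two_pos k) hf.abs.meas hM x
  have h2 := this.const_mul ((n:ℝ) + 2)
  refine h2.congr ?_
  filter_upwards with y
  unfold pk
  have hn : (0:ℝ) < (n:ℝ) + 2 := by positivity
  field_simp

lemma po_nonneg (k : ℤ) (f : E n → ℝ) (x : E n) : 0 ≤ po k f x :=
  integral_nonneg fun y => mul_nonneg (rho_pos (two_pos k) _).le (abs_nonneg _)

lemma measurable_po (k : ℤ) {f : E n → ℝ} (hf : Nice f) : Measurable (po k f) := by
  have h := measurable_op (pk_ker.dom k) hf.abs.meas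
  have e : po k f = fun x => ((n:ℝ) + 2) * op (pk k) (fun y => |f y|) x := by
    funext x
    have hn : (0:ℝ) < (n:ℝ) + 2 := by positivity
    rw [op_pk]
    field_simp
  rw [e]
  exact h.const_mul _

lemma rho_compare {t c : ℝ} (ht : 0 < t) (hc : 0 ≤ c) {h h' : E n} (hh : ‖h' - h‖ ≤ c * t) :
    rho t h ≤ (1 + c) ^ (n + 2) * rho t h' := by
  unfold rho
  have h1 : 0 < t + ‖h‖ := by positivity
  have h2 : 0 < t + ‖h'‖ := by positivity
  rw [mul_div_assoc', div_le_div_iff₀ (by positivity) (by positivity)]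
  have h3 : t + ‖h'‖ ≤ (1 + c) * (t + ‖h‖) := by
    have := norm_sub_norm_le h' h
    nlinarith [norm_nonneg h]
  calc t ^ 2 * (t + ‖h'‖) ^ (n + 2) ≤ t ^ 2 * ((1 + c) * (t + ‖h‖)) ^ (n + 2) := by gcongr
    _ = _ := by rw [mul_pow]; ring

lemma po_compare {k : ℤ} {f : E n → ℝ} (hf : Nice f) {c : ℝ} (hc : 0 ≤ c) {x x' : E n}
    (hh : ‖x' - x‖ ≤ c * 2 ^ k) : po k f x ≤ (1 + c) ^ (n + 2) * po k f x' := by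
  unfold po
  rw [← integral_const_mul]
  refine integral_mono (po_int k hf x) ((po_int k hf x').const_mul _) fun y => ?_
  simp only
  rw [← mul_assoc]
  gcongr
  refine rho_compare (two_pos k) hc ?_
  rwa [sub_sub_sub_cancel_right]

lemma abs_op_le_po {s : ℤ → E n → E n → ℝ} (hs : Ker s) {f : E n → ℝ} (hf : Nice f) (k : ℤ)
    (x : E n) : |op (s k) f x| ≤ po k f x := by
  unfold op po
  refine abs_integral_le_integral_abs.trans ?_
  obtain ⟨M, hM⟩ := hf.bdd
  refine integral_mono ((hs.dom k).int_mul (two_pos k) hf.meas hM x).abs (po_int k hf x) fun y => ?_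
  simp only
  rw [abs_mul]
  gcongr
  exact hs.size k x y

lemma Nice.indicator {f : E n → ℝ} (hf : Nice f) {U : Set (E n)} (hU : MeasurableSet U) :
    Nice (U.indicator f) := by
  obtain ⟨M, hM⟩ := hf.bdd
  refine ⟨hf.meas.indicator hU, hf.int.indicator hU, M, fun x => ?_⟩
  by_cases h : x ∈ U
  · rw [Set.indicator_of_mem h]; exact hM x
  · rw [Set.indicator_of_notMem h, abs_zero]; exact (abs_nonneg _).trans (hM x)

lemma Nice.sub {f g : E n → ℝ} (hf : Nice f) (hg : Nice g) : Nice fun x => f x - g x := by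
  obtain ⟨M, hM⟩ := hf.bdd
  obtain ⟨M', hM'⟩ := hg.bdd
  refine ⟨hf.meas.sub hg.meas, hf.int.sub hg.int, M + M', fun x => ?_⟩
  exact (abs_sub _ _).trans (add_le_add (hM x) (hM' x))

lemma op_sub {s : ℤ → E n → E n → ℝ} (hs : Ker s) {f g : E n → ℝ} (hf : Nice f) (hg : Nice g)
    (k : ℤ) (x : E n) : op (s k) (fun y => f y - g y) x = op (s k) f x - op (s k) g x := by
  unfold op
  obtain ⟨M, hM⟩ := hf.bdd
  obtain ⟨M', hM'⟩ := hg.bdd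
  rw [← integral_sub ((hs.dom k).int_mul (two_pos k) hf.meas hM x)
    ((hs.dom k).int_mul (two_pos k) hg.meas hM' x)]
  congr 1; funext y; ring

/-- the big ball -/
def BB (K : ℤ) (x0 : E n) : Set (E n) := {y | ‖x0 - y‖ ≤ (2 * n + 2) * 2 ^ K}

lemma BB_meas (K : ℤ) (x0 : E n) : MeasurableSet (BB K x0) :=
  measurableSet_le (measurable_const.sub measurable_id).norm measurable_const

lemma rho_tail {k K : ℤ} (hk : k ≤ K) {x0 x y : E n} (hx : x ∈ Q K x0) (hy : y ∉ BB K x0) :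
    rho (2 ^ k) (x - y) ≤ 4 ^ (n + 2) * (1/2 : ℝ) ^ (K - k).natAbs * rho (2 ^ K) (x0 - y) := by
  have h3 := two_pos k
  have h4 := two_pos K
  have h1 := norm_sub_le_of_mem_Q hx
  simp only [BB, Set.mem_ofPred_eq, not_le] at hy
  have h2 : ‖x0 - y‖ - n * 2 ^ K ≤ ‖x - y‖ := by
    have := norm_sub_le_norm_sub_add_norm_sub x0 x y
    rw [norm_sub_rev x0 x] at this
    linarith
  have hp : 0 ≤ (n:ℝ) * 2 ^ K := by positivity
  have h5 : 2 ^ K + ‖x0 - y‖ ≤ 4 * (2 ^ k + ‖x - y‖) := by nlinarith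
  have h6 : ((2:ℝ) ^ k) = (1/2 : ℝ) ^ (K - k).natAbs * 2 ^ K := by
    obtain ⟨d, hd⟩ := Int.le.dest hk
    have e : K - k = (d:ℤ) := by omega
    rw [e, Int.natAbs_natCast, ← hd, zpow_add₀ (by norm_num), zpow_natCast, one_div, inv_pow]
    field_simp
  set θ := (1/2 : ℝ) ^ (K - k).natAbs with hθ
  have hθ0 : 0 ≤ θ := by positivity
  have hθ1 : θ ≤ 1 := pow_le_one₀ (by norm_num) (by norm_num)
  unfold rho
  have p1 : 0 < 2 ^ k + ‖x - y‖ := by positivity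
  have p2 : 0 < 2 ^ K + ‖x0 - y‖ := by positivity
  rw [mul_div_assoc', div_le_div_iff₀ (by positivity) (by positivity)]
  calc ((2:ℝ) ^ k) ^ 2 * (2 ^ K + ‖x0 - y‖) ^ (n + 2)
      ≤ ((2:ℝ) ^ k) ^ 2 * (4 * (2 ^ k + ‖x - y‖)) ^ (n + 2) := by gcongr
    _ = (θ ^ 2) * (4 ^ (n + 2) * (2 ^ K) ^ 2 * (2 ^ k + ‖x - y‖) ^ (n + 2)) := by
        nth_rewrite 1 [h6]
        rw [mul_pow, mul_pow]; ring
    _ ≤ θ * (4 ^ (n + 2) * (2 ^ K) ^ 2 * (2 ^ k + ‖x - y‖) ^ (n + 2)) := by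
        gcongr
        nlinarith
    _ = _ := by ring

lemma op_tail {s : ℤ → E n → E n → ℝ} (hs : Ker s) {f : E n → ℝ} (hf : Nice f) {k K : ℤ}
    (hk : k ≤ K) {x0 x : E n} (hx : x ∈ Q K x0) :
    |op (s k) ((BB K x0)ᶜ.indicator f) x| ≤
      4 ^ (n + 2) * (1/2 : ℝ) ^ (K - k).natAbs * po K f x0 := by
  have hB := (BB_meas K x0).compl
  refine (abs_op_le_po hs (hf.indicator hB) k x).trans ?_
  unfold po
  rw [← integral_const_mul]
  refine integral_mono (po_int k (hf.indicator hB) x) ((po_int K hf x0).const_mul _) fun y => ?_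
  simp only
  by_cases hy : y ∈ BB K x0
  · rw [Set.indicator_of_notMem (by simpa using hy)]
    have := rho_pos (two_pos K) (x0 - y)
    rw [abs_zero, mul_zero]
    positivity
  · rw [Set.indicator_of_mem (by simpa using hy), ← mul_assoc]
    gcongr
    exact rho_tail hk hx hy

/-- constant -/
def Cb (n : ℕ) : ℝ := (2 * n + 3) ^ (n + 2)

lemma Cb_pos : 0 < Cb n := by unfold Cb; positivity

lemma int_BB {f : E n → ℝ} (hf : Nice f) (K : ℤ) (x0 : E n) :
    ∫ y, |(BB K x0).indicator f y| ≤ Cb n * po K f x0 * ((2:ℝ) ^ K) ^ n := by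
  have h4 := two_pos K
  unfold po
  rw [mul_comm (Cb n), mul_assoc, mul_comm, ← integral_const_mul]
  refine integral_mono (hf.indicator (BB_meas K x0)).int.abs ((po_int K hf x0).const_mul _) fun y => ?_
  simp only
  by_cases hy : y ∈ BB K x0
  · rw [Set.indicator_of_mem hy, ← mul_assoc]
    refine le_mul_of_one_le_left (abs_nonneg _) ?_
    have := rho_ge_of_le (n := n) h4 (c := 2 * n + 2) (by positivity) hy
    rw [inv_le_iff_one_le_mul₀ (by positivity)] at this
    refine this.trans (le_of_eq ?_)
    unfold Cb
    rw [show (2 * (n:ℝ) + 2 + 1) = 2 * n + 3 by ring]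
    ring
  · rw [Set.indicator_of_notMem hy, abs_zero]
    have := rho_pos h4 (x0 - y)
    have := Cb_pos (n := n)
    positivity

end JV

-- part 10
namespace JV
variable {n : ℕ}

/-! ### Local decomposition -/

lemma le_of_mul_ofReal {a b : ℝ} (ha : 0 < a) {X : ℝ≥0∞} (h : ENNReal.ofReal a * X ≤ ENNReal.ofReal b) :
    X ≤ ENNReal.ofReal (b / a) := by
  rw [ENNReal.ofReal_div_of_pos ha, ENNReal.le_div_iff_mul_le (by simp [ha]) (by simp)]
  rwa [mul_comm]

lemma lint_eq_ofReal {f : E n → ℝ} (hf : Integrable f) :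
    ∫⁻ x, ‖f x‖ₑ = ENNReal.ofReal (∫ x, |f x|) := by
  rw [← ofReal_integral_norm_eq_lintegral_enorm hf]
  simp only [Real.norm_eq_abs]

/-- constants -/
def A2 (n : ℕ) (δ : ℝ) : ℝ := Cb n + 1 + 2 * 3 ^ n * Cb n / δ
/-- constants -/
def T2 (n : ℕ) (δ : ℝ) : ℝ := 16 * D1 n * Cb n / δ + 1 + 4 * 4 ^ (n + 2)

lemma loc_dec {s : ℤ → E n → E n → ℝ} (hs : Ker s) {f : E n → ℝ} (hf : Nice f) {δ : ℝ}
    (hδ : 0 < δ) (x0 : E n) {m K : ℤ} (hmK : m ≤ K) (ha : 0 < po K f x0) :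
    ∃ (g : E n → ℝ) (Bd : Set (E n)), Nice g ∧ MeasurableSet Bd ∧
      (∀ x, |g x| ≤ 2 ^ n * (A2 n δ * po K f x0)) ∧
      ∫ x, |g x| ≤ Cb n * po K f x0 * ((2:ℝ) ^ K) ^ n ∧
      volume Bd ≤ ENNReal.ofReal (δ * ((2:ℝ) ^ K) ^ n) ∧
      ∀ x ∈ Q K x0, x ∉ Bd → ∑ k ∈ Finset.Icc m K, |op (s k) (fun y => f y - g y) x| ≤
        T2 n δ * po K f x0 := by
  have hCb := Cb_pos (n := n)
  have hD := D1_nonneg (n := n)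
  have h4 := two_pos K
  set a0 := po K f x0 with ha0
  set v := ((2:ℝ) ^ K) ^ n with hv
  have hv0 : 0 < v := by positivity
  set F := (BB K x0).indicator f with hFdef
  have hF : Nice F := hf.indicator (BB_meas K x0)
  have hA : 0 < A2 n δ := by unfold A2; positivity
  set α := A2 n δ * a0 with hα
  have hα0 : 0 < α := by positivity
  have hinteg : ∫ y, |F y| ≤ Cb n * a0 * v := int_BB hf K x0
  have hlint : ∫⁻ y, ‖F y‖ₑ ≤ ENNReal.ofReal (Cb n * a0 * v) := by
    rw [lint_eq_ofReal hF.int]; exact ENNReal.ofReal_le_ofReal hinteg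
  have hK : ∀ x, Ek K (fun y => |F y|) x ≤ α := by
    intro x
    unfold Ek
    rw [← hv, inv_mul_le_iff₀ hv0]
    refine (setIntegral_le_integral hF.int.abs (by filter_upwards with y using abs_nonneg _)).trans
      (hinteg.trans ?_)
    rw [hα, mul_comm v]
    gcongr
    unfold A2
    have : 0 ≤ 2 * 3 ^ n * Cb n / δ := by positivity
    linarith
  set g := good F α m K with hg
  have hgn : Nice g := good_nice hF hα0 hmK hK
  set Om := OmS F α m K with hOm
  have hOmm : MeasurableSet Om := OmS_meas F α m K
  set T := 16 * D1 n * Cb n / δ + 1 with hT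
  have hT0 : 0 < T := by positivity
  set G : E n → ℝ≥0∞ := fun x => ∑ k ∈ Finset.Icc m K, ‖op (s k) (fun y => F y - g y) x‖ₑ with hG
  have hGm : Measurable G := Finset.measurable_sum _ fun k _ =>
    (measurable_op (hs.dom k) (hF.sub hgn).meas).enorm
  set H := {x | ENNReal.ofReal (T * a0) ≤ G x} with hH
  have hHm : MeasurableSet H := measurableSet_le measurable_const hGm
  refine ⟨g, Om ∪ (H ∩ Omᶜ), hgn, hOmm.union (hHm.inter hOmm.compl), good_le hF hα0 hmK hK, ?_, ?_, ?_⟩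
  · refine le_trans ?_ hinteg
    have := good_lint (α := α) hF hmK
    rw [lint_eq_ofReal hgn.int, lint_eq_ofReal hF.int] at this
    exact (ENNReal.ofReal_le_ofReal_iff (integral_nonneg fun _ => abs_nonneg _)).1 this
  · have v1 : volume Om ≤ ENNReal.ofReal (δ / 2 * v) := by
      have h1 := OmS_vol (α := α) hF hmK
      have h2 : ENNReal.ofReal α * volume Om ≤ ENNReal.ofReal (3 ^ n * (Cb n * a0 * v)) := by
        refine h1.trans ?_
        rw [ENNReal.ofReal_mul (by positivity), ENNReal.ofReal_pow (by norm_num), ENNReal.ofReal_ofNat]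
        exact mul_le_mul' le_rfl hlint
      refine (le_of_mul_ofReal hα0 h2).trans (ENNReal.ofReal_le_ofReal ?_)
      rw [div_le_iff₀ hα0, hα]
      have : 3 ^ n * Cb n ≤ δ / 2 * A2 n δ := by
        unfold A2
        have : δ / 2 * (Cb n + 1 + 2 * 3 ^ n * Cb n / δ) = δ / 2 * (Cb n + 1) + 3 ^ n * Cb n := by
          field_simp
        rw [this]
        have : 0 ≤ δ / 2 * (Cb n + 1) := by positivity
        linarith
      calc _ = (3 ^ n * Cb n) * (a0 * v) := by ring
        _ ≤ (δ / 2 * A2 n δ) * (a0 * v) := by gcongr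
        _ = _ := by ring
    have v2 : volume (H ∩ Omᶜ) ≤ ENNReal.ofReal (δ / 2 * v) := by
      have h1 : ENNReal.ofReal (T * a0) * volume (H ∩ Omᶜ) ≤
          ENNReal.ofReal (8 * D1 n * (Cb n * a0 * v)) := by
        rw [← Measure.restrict_apply hHm]
        refine (mul_meas_ge_le_lintegral hGm _).trans ((cz_bad hs hF hmK).trans ?_)
        rw [ENNReal.ofReal_mul (p := 8 * D1 n) (by positivity)]
        exact mul_le_mul' le_rfl hlint
      refine (le_of_mul_ofReal (by positivity) h1).trans (ENNReal.ofReal_le_ofReal ?_)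
      rw [div_le_iff₀ (by positivity)]
      have : 8 * D1 n * Cb n ≤ δ / 2 * T := by
        have : δ / 2 * T = 8 * D1 n * Cb n + δ / 2 := by
          rw [hT]; field_simp; ring
        rw [this]; linarith
      calc _ = (8 * D1 n * Cb n) * (a0 * v) := by ring
        _ ≤ (δ / 2 * T) * (a0 * v) := by gcongr
        _ = _ := by ring
    calc _ ≤ volume Om + volume (H ∩ Omᶜ) := measure_union_le _ _
      _ ≤ ENNReal.ofReal (δ / 2 * v) + ENNReal.ofReal (δ / 2 * v) := add_le_add v1 v2
      _ = _ := by rw [← ENNReal.ofReal_add (by positivity) (by positivity)]; congr 1; ring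
  · intro x hx hxB
    have hx1 : x ∉ Om := fun h => hxB (Or.inl h)
    have hx2 : x ∉ H := fun h => hxB (Or.inr ⟨h, hx1⟩)
    have hx3 : ∑ k ∈ Finset.Icc m K, |op (s k) (fun y => F y - g y) x| ≤ T * a0 := by
      simp only [hH, Set.mem_ofPred_eq, not_le] at hx2
      rw [hG] at hx2
      simp only [← ofReal_norm] at hx2
      rw [← ENNReal.ofReal_sum_of_nonneg fun k _ => norm_nonneg _] at hx2
      exact ((ENNReal.ofReal_lt_ofReal_iff (by positivity)).1 hx2).le
    have hdec : ∀ k, op (s k) (fun y => f y - g y) x =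
        op (s k) ((BB K x0)ᶜ.indicator f) x + op (s k) (fun y => F y - g y) x := by
      intro k
      rw [op_sub hs hf hgn, op_sub hs hF hgn]
      have e : (BB K x0)ᶜ.indicator f = fun y => f y - F y := by
        rw [Set.indicator_compl]; rfl
      rw [e, op_sub hs hf hF]
      ring
    calc _ ≤ ∑ k ∈ Finset.Icc m K, (4 ^ (n + 2) * (1/2 : ℝ) ^ (K - k).natAbs * a0 +
          |op (s k) (fun y => F y - g y) x|) := by
          refine Finset.sum_le_sum fun k hk => ?_
          rw [hdec]
          exact (abs_add_le _ _).trans (add_le_add (op_tail hs hf (Finset.mem_Icc.1 hk).2 hx) le_rfl)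
      _ = 4 ^ (n + 2) * (∑ k ∈ Finset.Icc m K, (1/2 : ℝ) ^ (K - k).natAbs) * a0 +
          ∑ k ∈ Finset.Icc m K, |op (s k) (fun y => F y - g y) x| := by
          rw [Finset.sum_add_distrib, Finset.mul_sum, Finset.sum_mul]
      _ ≤ 4 ^ (n + 2) * 4 * a0 + T * a0 := by
          refine add_le_add ?_ hx3
          have := geo (θ := 1/2) (by norm_num) (by norm_num) (Finset.Icc m K) K
          gcongr
          refine this.trans (by norm_num)
      _ = _ := by unfold T2; rw [hT]; ring

/-- constants -/
def C5 (n : ℕ) (δ : ℝ) : ℝ := (n + 2) * (2 ^ n * A2 n δ * I0 n + T2 n δ)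

lemma A2_pos {δ : ℝ} (hδ : 0 < δ) : 1 ≤ A2 n δ := by
  have hCb := Cb_pos (n := n)
  have : 0 ≤ 2 * 3 ^ n * Cb n / δ := by positivity
  unfold A2; linarith

lemma T2_pos {δ : ℝ} (hδ : 0 < δ) : 1 ≤ T2 n δ := by
  have hCb := Cb_pos (n := n)
  have hD := D1_nonneg (n := n)
  have : 0 ≤ 16 * D1 n * Cb n / δ := by positivity
  have : (0:ℝ) ≤ 4 * 4 ^ (n + 2) := by positivity
  unfold T2; linarith

lemma C5_pos {δ : ℝ} (hδ : 0 < δ) : 0 < C5 n δ := by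
  have hA := A2_pos (n := n) hδ
  have hT := T2_pos (n := n) hδ
  have := I0_nonneg (n := n)
  unfold C5
  positivity

lemma po_abs (k : ℤ) (f : E n → ℝ) (x : E n) : po k (fun y => |f y|) x = po k f x := by
  unfold po; simp only [abs_abs]

lemma loc_po {f : E n → ℝ} (hf : Nice f) {δ : ℝ}
    (hδ : 0 < δ) (x0 : E n) {m K : ℤ} (hmK : m ≤ K) (ha : 0 < po K f x0) :
    ∃ (Bd : Set (E n)), MeasurableSet Bd ∧
      volume Bd ≤ ENNReal.ofReal (δ * ((2:ℝ) ^ K) ^ n) ∧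
      ∀ x ∈ Q K x0, x ∉ Bd → ∀ k ∈ Finset.Icc m K, po k f x ≤ C5 n δ * po K f x0 := by
  rw [← po_abs] at ha
  obtain ⟨g, Bd, hg, hBd, hgb, -, hvol, h⟩ := loc_dec pk_ker hf.abs hδ x0 hmK ha
  rw [po_abs] at *
  refine ⟨Bd, hBd, hvol, fun x hx hxB k hk => ?_⟩
  have h1 := h x hx hxB
  have h2 : |op (pk k) (fun y => |f y| - g y) x| ≤ T2 n δ * po K f x0 :=
    (Finset.single_le_sum (f := fun k => |op (pk k) (fun y => |f y| - g y) x|)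
      (fun _ _ => abs_nonneg _) hk).trans h1
  rw [op_sub pk_ker hf.abs hg, op_pk] at h2
  have h3 := abs_op_le (two_pos k) (pk_ker.dom k) hgb x
  rw [one_mul] at h3
  have hn : (0:ℝ) < (n:ℝ) + 2 := by positivity
  have h5 : ((n:ℝ) + 2)⁻¹ * po k f x ≤ 2 ^ n * (A2 n δ * po K f x0) * I0 n + T2 n δ * po K f x0 := by
    have := abs_le.1 h2
    have := abs_le.1 h3
    linarith
  rw [inv_mul_le_iff₀ hn] at h5
  refine h5.trans (le_of_eq ?_)
  unfold C5; ring

/-- constants -/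
def C6 (n : ℕ) (δ C4 : ℝ) : ℝ :=
  4 * (C3 n (Cb n) C4 * (2 ^ n * A2 n δ) ^ 2 * δ⁻¹) + 4 + 32 * T2 n δ ^ 2

lemma loc_W {s : ℤ → E n → E n → ℝ} (hs : Ker s) {C4 : ℝ} (hC4 : 0 ≤ C4) (h4 : K4 C4 s)
    {f : E n → ℝ} (hf : Nice f) {δ : ℝ}
    (hδ : 0 < δ) (x0 : E n) {m K : ℤ} (hmK : m ≤ K) (ha : 0 < po K f x0) {lam : ℝ} (hl : 0 < lam) :
    ∃ (Bd : Set (E n)), MeasurableSet Bd ∧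
      volume Bd ≤ ENNReal.ofReal (2 * δ * ((2:ℝ) ^ K) ^ n) ∧
      ∀ x ∈ Q K x0, x ∉ Bd → ENNReal.ofReal (lam ^ 2) * W lam (fun k => op (s k) f x) m K ≤
        ENNReal.ofReal (C6 n δ C4 * po K f x0 ^ 2) := by
  obtain ⟨g, Bd, hg, hBd, hgb, hgi, hvol, h⟩ := loc_dec hs hf hδ x0 hmK ha
  have hCb := Cb_pos (n := n)
  have hA := A2_pos (n := n) hδ
  have hT := T2_pos (n := n) hδ
  have h40 := two_pos K
  have hB1 := B1_pos (n := n)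
  have hI := I0_nonneg (n := n)
  have hC3 : 0 ≤ C3 n (Cb n) C4 := by unfold C3; positivity
  set a0 := po K f x0 with ha0
  set v := ((2:ℝ) ^ K) ^ n with hv
  have hv0 : 0 < v := by positivity
  have hl2 : 0 < lam / 2 := by positivity
  set a := 2 ^ n * (A2 n δ * a0) with ha'
  have ha0a : a0 ≤ a := by
    rw [ha', ← mul_assoc]
    refine le_mul_of_one_le_left ha.le ?_
    exact one_le_mul_of_one_le_of_one_le (one_le_pow₀ (by norm_num)) hA
  have hl3 := local_bdd hs hC4 h4 hg (a := a) (B := Cb n) (by positivity) hCb.le hgb x0 K m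
    (hgi.trans (by gcongr)) hl2
  set G : E n → ℝ≥0∞ := fun x => ENNReal.ofReal ((lam / 2) ^ 2) *
    W (lam / 2) (fun k => op (s k) g x) m K with hG
  have hGm : Measurable G :=
    (measurable_W (fun k => measurable_op (hs.dom k) hg.meas) _ _ _).const_mul _
  set T := C3 n (Cb n) C4 * (2 ^ n * A2 n δ) ^ 2 * δ⁻¹ + 1 with hTd
  have hT0 : 0 < T := by positivity
  set H := {x | ENNReal.ofReal (T * a0 ^ 2) ≤ G x} with hH
  have hHm : MeasurableSet H := measurableSet_le measurable_const hGm
  refine ⟨Bd ∪ (H ∩ Q K x0), hBd.union (hHm.inter (measurableSet_Q K x0)), ?_, ?_⟩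
  · have v2 : volume (H ∩ Q K x0) ≤ ENNReal.ofReal (δ * v) := by
      have h1 : ENNReal.ofReal (T * a0 ^ 2) * volume (H ∩ Q K x0) ≤
          ENNReal.ofReal (C3 n (Cb n) C4 * a ^ 2 * v) := by
        rw [← Measure.restrict_apply hHm]
        exact (mul_meas_ge_le_lintegral hGm _).trans hl3
      refine (le_of_mul_ofReal (by positivity) h1).trans (ENNReal.ofReal_le_ofReal ?_)
      rw [div_le_iff₀ (by positivity)]
      have : C3 n (Cb n) C4 * (2 ^ n * A2 n δ) ^ 2 ≤ δ * T := by
        have : δ * T = C3 n (Cb n) C4 * (2 ^ n * A2 n δ) ^ 2 + δ := by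
          rw [hTd]; field_simp
        rw [this]; linarith
      calc _ = (C3 n (Cb n) C4 * (2 ^ n * A2 n δ) ^ 2) * (a0 ^ 2 * v) := by rw [ha']; ring
        _ ≤ (δ * T) * (a0 ^ 2 * v) := by gcongr
        _ = _ := by ring
    calc _ ≤ volume Bd + volume (H ∩ Q K x0) := measure_union_le _ _
      _ ≤ ENNReal.ofReal (δ * v) + ENNReal.ofReal (δ * v) := add_le_add hvol v2
      _ = _ := by rw [← ENNReal.ofReal_add (by positivity) (by positivity)]; congr 1; ring
  · intro x hx hxB
    have hx1 : x ∉ Bd := fun h => hxB (Or.inl h)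
    have hx2 : x ∉ H := fun h => hxB (Or.inr ⟨h, hx⟩)
    have hx3 := h x hx hx1
    simp only [hH, Set.mem_ofPred_eq, not_le] at hx2
    set e : ℤ → ℝ := fun k => op (s k) (fun y => f y - g y) x with he
    have hdec : (fun k => op (s k) f x) = fun k => op (s k) g x + e k := by
      funext k
      rw [he]; beta_reduce
      rw [op_sub hs hf hg]; ring
    have hsq : ENNReal.ofReal ((lam / 2) ^ 2) * W (lam / 2) e m K ≤
        ENNReal.ofReal (8 * (T2 n δ * a0) ^ 2) := by
      refine (W_sq hl2 e m K).trans ?_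
      rw [← ENNReal.ofReal_sum_of_nonneg fun k _ => by positivity, ← Finset.mul_sum]
      apply ENNReal.ofReal_le_ofReal
      gcongr
      calc ∑ k ∈ Finset.Icc m K, e k ^ 2 = ∑ k ∈ Finset.Icc m K, |e k| ^ 2 := by simp only [sq_abs]
        _ ≤ (∑ k ∈ Finset.Icc m K, |e k|) ^ 2 :=
            Finset.sum_sq_le_sq_sum_of_nonneg fun k _ => abs_nonneg _
        _ ≤ _ := by gcongr
    rw [hdec]
    calc _ ≤ ENNReal.ofReal (lam ^ 2) * (W (lam / 2) (fun k => op (s k) g x) m K + W (lam / 2) e m K) :=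
          mul_le_mul' le_rfl (W_add _ _ _ _ _)
      _ = ENNReal.ofReal 4 * (G x + ENNReal.ofReal ((lam / 2) ^ 2) * W (lam / 2) e m K) := by
          rw [hG]; beta_reduce
          rw [← mul_add, ← mul_assoc, ← ENNReal.ofReal_mul (by norm_num)]
          congr 2; ring
      _ ≤ ENNReal.ofReal 4 * (ENNReal.ofReal (T * a0 ^ 2) + ENNReal.ofReal (8 * (T2 n δ * a0) ^ 2)) :=
          mul_le_mul' le_rfl (add_le_add hx2.le hsq)
      _ = _ := by
          rw [← ENNReal.ofReal_add (by positivity) (by positivity), ← ENNReal.ofReal_mul (by norm_num)]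
          congr 1
          rw [hTd]; unfold C6; ring

end JV

-- part 11
namespace JV
variable {n : ℕ}

/-! ### Induction on scales -/

/-- constant -/
def D7 (n : ℕ) : ℝ := n * ((1 + n) ^ (n + 2) + 1)

lemma op_diff {s : ℤ → E n → E n → ℝ} (hs : Ker s) {f : E n → ℝ} (hf : Nice f) {j k : ℤ}
    (hk : j ≤ k) {x x' : E n} (hx : x' ∈ Q j x) :
    |op (s k) f x - op (s k) f x'| ≤ D7 n * (1/2 : ℝ) ^ (j - k).natAbs * po k f x' := by
  have h3 := two_pos k
  have h4 := two_pos j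
  obtain ⟨M, hM⟩ := hf.bdd
  have i1 := (hs.dom k).int_mul h3 hf.meas hM x
  have i2 := (hs.dom k).int_mul h3 hf.meas hM x'
  have hxx : ‖x - x'‖ ≤ n * 2 ^ j := by rw [norm_sub_rev]; exact norm_sub_le_of_mem_Q hx
  have hjk : (2:ℝ) ^ j = (1/2 : ℝ) ^ (j - k).natAbs * 2 ^ k := by
    obtain ⟨d, hd⟩ := Int.le.dest hk
    have e : j - k = -(d:ℤ) := by omega
    rw [e, Int.natAbs_neg, Int.natAbs_natCast, ← hd, zpow_add₀ (by norm_num), zpow_natCast, one_div,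
      inv_pow]
    field_simp
  set θ := (1/2 : ℝ) ^ (j - k).natAbs with hθ
  have hθ0 : 0 ≤ θ := by positivity
  have hθ1 : θ ≤ 1 := pow_le_one₀ (by norm_num) (by norm_num)
  have h1 : |op (s k) f x - op (s k) f x'| ≤ ((2:ℝ) ^ k)⁻¹ * ‖x - x'‖ * (po k f x + po k f x') := by
    unfold op po
    rw [← integral_sub i1 i2, ← integral_add (po_int k hf x) (po_int k hf x'), ← integral_const_mul]
    refine abs_integral_le_integral_abs.trans ?_
    refine integral_mono (i1.sub i2).abs (((po_int k hf x).add (po_int k hf x')).const_mul _) fun y => ?_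
    simp only [Pi.sub_apply, Pi.add_apply]
    rw [← sub_mul, abs_mul, ← add_mul, ← mul_assoc]
    gcongr
    exact hs.regx k x x' y
  have h2 : ‖x - x'‖ ≤ n * θ * 2 ^ k := by rw [mul_assoc, ← hjk]; exact hxx
  have h5 : po k f x ≤ (1 + (n:ℝ)) ^ (n + 2) * po k f x' := by
    refine po_compare hf (by positivity) ?_
    rw [norm_sub_rev]
    refine h2.trans ?_
    gcongr
    exact mul_le_of_le_one_right (by positivity) hθ1
  have h6 := po_nonneg k f x'
  calc _ ≤ _ := h1
    _ ≤ ((2:ℝ) ^ k)⁻¹ * (n * θ * 2 ^ k) * ((1 + (n:ℝ)) ^ (n + 2) * po k f x' + po k f x') := by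
        have := po_nonneg k f x
        gcongr
    _ = _ := by unfold D7; field_simp

lemma pt {s : ℤ → E n → E n → ℝ} (hs : Ker s) {f : E n → ℝ} (hf : Nice f) {j K : ℤ}
    {x x' : E n} (hx : x' ∈ Q j x) {lam : ℝ} (hl : 0 < lam) {A B : ℝ} (hA : 0 ≤ A)
    (hB : 0 ≤ B)
    (hW : ENNReal.ofReal ((lam / 2) ^ 2) * W (lam / 2) (fun k => op (s k) f x') j K ≤ ENNReal.ofReal A)
    (hp : ∀ k ∈ Finset.Icc j K, po k f x' ≤ B) :
    ENNReal.ofReal (lam ^ 2) * W lam (fun k => op (s k) f x) j K ≤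
      ENNReal.ofReal (4 * (A + 32 * (D7 n * B) ^ 2)) := by
  have hl2 : 0 < lam / 2 := by positivity
  set e : ℤ → ℝ := fun k => op (s k) f x - op (s k) f x' with he
  have hD : 0 ≤ D7 n := by unfold D7; positivity
  have hdec : (fun k => op (s k) f x) = fun k => op (s k) f x' + e k := by
    funext k; rw [he]; ring
  have hsq : ENNReal.ofReal ((lam / 2) ^ 2) * W (lam / 2) e j K ≤
      ENNReal.ofReal (32 * (D7 n * B) ^ 2) := by
    refine (W_sq hl2 e j K).trans ?_
    rw [← ENNReal.ofReal_sum_of_nonneg fun k _ => by positivity, ← Finset.mul_sum]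
    apply ENNReal.ofReal_le_ofReal
    have h1 : ∑ k ∈ Finset.Icc j K, e k ^ 2 ≤
        ∑ k ∈ Finset.Icc j K, (D7 n * B) ^ 2 * (1/2 : ℝ) ^ (j - k).natAbs := by
      refine Finset.sum_le_sum fun k hk => ?_
      have h2 := op_diff hs hf (Finset.mem_Icc.1 hk).1 hx
      have h3 := hp k hk
      set θ := (1/2 : ℝ) ^ (j - k).natAbs with hθ
      have hθ0 : 0 ≤ θ := by positivity
      have hθ1 : θ ≤ 1 := pow_le_one₀ (by norm_num) (by norm_num)
      have h6 := po_nonneg k f x'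
      calc e k ^ 2 = |e k| ^ 2 := (sq_abs _).symm
        _ ≤ (D7 n * θ * B) ^ 2 := by
            refine pow_le_pow_left₀ (abs_nonneg _) (h2.trans ?_) 2
            gcongr
        _ = (D7 n * B) ^ 2 * (θ * θ) := by ring
        _ ≤ (D7 n * B) ^ 2 * θ := by
            gcongr
            exact mul_le_of_le_one_right hθ0 hθ1
    rw [← Finset.mul_sum] at h1
    have h2 := geo (θ := 1/2) (by norm_num) (by norm_num) (Finset.Icc j K) j
    norm_num at h2
    calc _ ≤ 8 * ((D7 n * B) ^ 2 * 4) := by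
          gcongr
          refine h1.trans ?_
          gcongr
      _ = _ := by ring
  rw [hdec]
  calc _ ≤ ENNReal.ofReal (lam ^ 2) * (W (lam / 2) (fun k => op (s k) f x') j K + W (lam / 2) e j K) :=
        mul_le_mul' le_rfl (W_add _ _ _ _ _)
    _ = ENNReal.ofReal 4 * (ENNReal.ofReal ((lam / 2) ^ 2) * W (lam / 2) (fun k => op (s k) f x') j K +
        ENNReal.ofReal ((lam / 2) ^ 2) * W (lam / 2) e j K) := by
        rw [← mul_add, ← mul_assoc, ← ENNReal.ofReal_mul (by norm_num)]
        congr 2; ring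
    _ ≤ ENNReal.ofReal 4 * (ENNReal.ofReal A + ENNReal.ofReal (32 * (D7 n * B) ^ 2)) :=
        mul_le_mul' le_rfl (add_le_add hW hsq)
    _ = _ := by
        rw [← ENNReal.ofReal_add (by positivity) (by positivity), ← ENNReal.ofReal_mul (by norm_num)]

/-- constants -/
def C7 (n : ℕ) (δ C4 : ℝ) : ℝ := 4 * (C6 n δ C4 + 32 * (D7 n * C5 n δ) ^ 2)

lemma C6_nonneg {δ C4 : ℝ} (hδ : 0 < δ) (hC4 : 0 ≤ C4) : 0 ≤ C6 n δ C4 := by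
  have hCb := Cb_pos (n := n)
  have hA := A2_pos (n := n) hδ
  have hT := T2_pos (n := n) hδ
  have hB1 := B1_pos (n := n)
  have hI := I0_nonneg (n := n)
  have hC3 : 0 ≤ C3 n (Cb n) C4 := by unfold C3; positivity
  unfold C6; positivity

lemma C7_nonneg {δ C4 : ℝ} (hδ : 0 < δ) (hC4 : 0 ≤ C4) : 0 ≤ C7 n δ C4 := by
  have := C6_nonneg (n := n) hδ hC4
  unfold C7; positivity

lemma step {s : ℤ → E n → E n → ℝ} (hs : Ker s) {C4 : ℝ} (hC4 : 0 ≤ C4) (h4 : K4 C4 s)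
    {f : E n → ℝ} (hf : Nice f) {δ : ℝ}
    (hδ : 0 < δ) (x0 : E n) {m K : ℤ} (hmK : m ≤ K) (ha : 0 < po K f x0) {lam : ℝ} (hl : 0 < lam) :
    ∃ (Bd : Set (E n)), MeasurableSet Bd ∧
      volume Bd ≤ ENNReal.ofReal (3 * δ * ((2:ℝ) ^ K) ^ n) ∧
      ∀ x ∈ Q K x0, ∀ j, m ≤ j → j ≤ K → ¬ Q j x ⊆ Bd →
        ENNReal.ofReal (lam ^ 2) * W lam (fun k => op (s k) f x) j K ≤
          ENNReal.ofReal (C7 n δ C4 * po K f x0 ^ 2) := by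
  obtain ⟨B1, m1, v1, h1⟩ := loc_W hs hC4 h4 hf hδ x0 hmK ha (half_pos hl)
  obtain ⟨B2, m2, v2, h2⟩ := loc_po hf hδ x0 hmK ha
  have h40 := two_pos K
  refine ⟨B1 ∪ B2, m1.union m2, ?_, ?_⟩
  · calc _ ≤ volume B1 + volume B2 := measure_union_le _ _
      _ ≤ _ := add_le_add v1 v2
      _ = _ := by rw [← ENNReal.ofReal_add (by positivity) (by positivity)]; congr 1; ring
  · intro x hx j hmj hjK hQ
    obtain ⟨x', hx', hxB⟩ := Set.not_subset.1 hQ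
    have hx'K : x' ∈ Q K x0 := by rw [← Q_eq hx]; exact Q_mono hjK x hx'
    have b1 : x' ∉ B1 := fun h => hxB (Or.inl h)
    have b2 : x' ∉ B2 := fun h => hxB (Or.inr h)
    have w1 := h1 x' hx'K b1
    have w2 := h2 x' hx'K b2
    have h6 := C6_nonneg (n := n) hδ hC4
    have h5 := C5_pos (n := n) hδ
    have := pt hs hf hx' hl (A := C6 n δ C4 * po K f x0 ^ 2) (B := C5 n δ * po K f x0) (K := K)
      (by positivity) (by positivity)
      ((mul_le_mul' le_rfl (W_mono hmj le_rfl)).trans w1)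
      (fun k hk => w2 k (Finset.mem_Icc.2 ⟨hmj.trans (Finset.mem_Icc.1 hk).1, (Finset.mem_Icc.1 hk).2⟩))
    refine this.trans (le_of_eq ?_)
    congr 1; unfold C7; ring

/-- square root of the jump functional -/
def Zs (s : ℤ → E n → E n → ℝ) (f : E n → ℝ) (lam : ℝ) (m k : ℤ) (x : E n) : ℝ≥0∞ :=
  (ENNReal.ofReal (lam ^ 2) * W lam (fun k => op (s k) f x) m k) ^ (1/2 : ℝ)

/-- constant -/
def C8 (n : ℕ) (δ C4 : ℝ) : ℝ := √(2 * C7 n δ C4) * (1 + n) ^ (n + 2)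

/-- constant -/
def C9 (n : ℕ) (p C4 : ℝ) : ℝ≥0∞ := 2 ^ (p + 1) * ENNReal.ofReal (C8 n ((2:ℝ) ^ (-p) / 3) C4) ^ p

/-- stopping children -/
def VV (Bd P : Set (E n)) (j : ℤ) : Set (E n) := {x | x ∈ P ∧ Q j x ⊆ Bd ∧ ¬ Q (j + 1) x ⊆ Bd}

lemma VV_sat {Bd : Set (E n)} {K j : ℤ} (hj : j ≤ K) (x0 : E n) : sat j (VV Bd (Q K x0) j) := by
  rintro x ⟨h1, h2, h3⟩ y hy
  refine ⟨sat_Q hj x0 x h1 hy, ?_, ?_⟩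
  · rw [Q_eq hy]; exact h2
  · rw [Q_eq (Q_mono (by omega) x hy)]; exact h3

lemma VV_disj (Bd P : Set (E n)) (s : Set ℤ) : s.PairwiseDisjoint (VV Bd P) := by
  have key : ∀ i j, i < j → Disjoint (VV Bd P i) (VV Bd P j) := by
    intro i j h
    rw [Set.disjoint_left]
    rintro x ⟨_, _, h3⟩ ⟨_, h2, _⟩
    exact h3 ((Q_mono (by omega) x).trans h2)
  intro i _ j _ hij
  rcases lt_or_gt_of_ne hij with h | h
  · exact key i j h
  · exact (key j i h).symm

lemma VV_cover {Bd : Set (E n)} {m K : ℤ} {x0 x : E n} (hx : x ∈ Q K x0) (hB : ¬ Q K x0 ⊆ Bd)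
    (hm : Q m x ⊆ Bd) : ∃ j ∈ Finset.Ico m K, x ∈ VV Bd (Q K x0) j := by
  by_contra hcon
  push Not at hcon
  have key : ∀ d : ℕ, m + d ≤ K → Q (m + d) x ⊆ Bd := by
    intro d
    induction d with
    | zero => intro _; simpa using hm
    | succ d ih =>
      intro h
      push_cast at h ⊢
      have h1 := ih (by omega)
      by_contra h2
      refine hcon (m + d) (Finset.mem_Ico.2 ⟨by omega, by omega⟩) ⟨hx, h1, ?_⟩
      rwa [← add_assoc] at h2
  rcases le_or_gt m K with h | h
  · obtain ⟨d, hd⟩ := Int.le.dest h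
    have := key d hd.le
    rw [hd, Q_eq hx] at this
    exact hB this
  · refine hB ?_
    rw [← Q_eq hx]
    exact (Q_mono h.le x).trans hm

end JV

-- part 12
namespace JV
variable {n : ℕ}

lemma sqrt_ofReal {c a : ℝ} (hc : 0 ≤ c) (ha : 0 ≤ a) :
    (ENNReal.ofReal (c * a ^ 2)) ^ (1/2 : ℝ) = ENNReal.ofReal (√c * a) := by
  rw [ENNReal.ofReal_rpow_of_nonneg (by positivity) (by norm_num), ← Real.sqrt_eq_rpow,
    Real.sqrt_mul hc, Real.sqrt_sq ha]

lemma scale_ind {s : ℤ → E n → E n → ℝ} (hs : Ker s) {C4 : ℝ} (hC4 : 0 ≤ C4) (h4 : K4 C4 s)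
    {f : E n → ℝ} (hf : Nice f) {p : ℝ} (hp : 1 < p) {m Kt : ℤ} (hpos : ∀ k x, 0 < po k f x)
    {lam : ℝ} (hl : 0 < lam) {F : E n → ℝ≥0∞}
    (hF : ∀ k ∈ Finset.Icc m Kt, ∀ x, ENNReal.ofReal (po k f x) ≤ F x) (d : ℕ) :
    m + d ≤ Kt → ∀ (x0 : E n) (t : ℝ≥0∞),
    ∫⁻ x in Q (m + d) x0, (t + Zs s f lam m (m + d) x) ^ p ≤
      ∫⁻ x in Q (m + d) x0, (2 ^ p * t ^ p + C9 n p C4 * F x ^ p) := by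
  induction d using Nat.strong_induction_on with
  | _ d ih =>
  intro hd x0 t
  have hp0 : 0 < p := by linarith
  set K := m + (d:ℤ) with hK
  have hmK : m ≤ K := by omega
  set δ := (2:ℝ) ^ (-p) / 3 with hδd
  have h2p : 0 < (2:ℝ) ^ (-p) := Real.rpow_pos_of_pos (by norm_num) _
  have hδ : 0 < δ := by positivity
  have h7 := C7_nonneg (n := n) hδ hC4
  obtain ⟨Bd, hBdm, hvol, hst⟩ := step hs hC4 h4 hf hδ x0 hmK (hpos K x0) hl
  have h40 := two_pos K
  set P := Q K x0 with hP
  have hPm : MeasurableSet P := measurableSet_Q K x0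
  set v := volume P with hv
  have hv' : v = ENNReal.ofReal (((2:ℝ) ^ K) ^ n) := volume_Q K x0
  have hvt : v ≠ ∞ := volume_Q_ne_top K x0
  have hv0 : v ≠ 0 := by rw [hv']; simp only [ne_eq, ENNReal.ofReal_eq_zero, not_le]; positivity
  have hvolB : 2 ^ p * volume Bd ≤ v := by
    calc _ ≤ 2 ^ p * ENNReal.ofReal ((2:ℝ) ^ (-p) * ((2:ℝ) ^ K) ^ n) := by
          refine mul_le_mul' le_rfl (hvol.trans (le_of_eq ?_))
          congr 1; rw [hδd]; ring
      _ = v := by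
          rw [ENNReal.ofReal_mul h2p.le, ← hv', ← ENNReal.ofReal_rpow_of_pos (by norm_num), ← mul_assoc,
            ENNReal.ofReal_ofNat, ← ENNReal.rpow_add _ _ (by norm_num) (by norm_num)]
          simp
  have h2le : (2:ℝ≥0∞) ≤ 2 ^ p := by
    calc (2:ℝ≥0∞) = 2 ^ (1:ℝ) := by simp
      _ ≤ _ := ENNReal.rpow_le_rpow_of_exponent_le (by norm_num) hp.le
  have hvol2 : 2 * volume Bd ≤ v := (mul_le_mul' h2le le_rfl).trans hvolB
  have hPB : ¬ P ⊆ Bd := by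
    intro h
    have h1 := (mul_le_mul' (le_refl (2:ℝ≥0∞)) (measure_mono (μ := volume) h)).trans hvol2
    rw [two_mul, ← hv] at h1
    have : v < v + v := ENNReal.lt_add_right hvt hv0
    exact absurd h1 (not_le.2 this)
  set a0 := po K f x0 with ha0
  have ha0n : 0 ≤ a0 := po_nonneg _ _ _
  set a := ENNReal.ofReal (√(2 * C7 n δ C4) * a0) with ha
  set c' := ENNReal.ofReal (C8 n δ C4) with hc'
  have haF : ∀ x ∈ P, a ≤ c' * F x := by
    intro x hx
    refine le_trans ?_ (mul_le_mul' le_rfl (hF K (Finset.mem_Icc.2 ⟨hmK, hd⟩) x))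
    have h8 : 0 ≤ C8 n δ C4 := by unfold C8; positivity
    rw [hc', ← ENNReal.ofReal_mul h8]
    apply ENNReal.ofReal_le_ofReal
    unfold C8
    rw [mul_assoc]
    gcongr
    exact po_compare hf (by positivity) (norm_sub_le_of_mem_Q hx)
  -- the pieces
  set R := {x | x ∈ P ∧ ¬ Q m x ⊆ Bd} with hR
  set I := Finset.Ico m K with hI
  set V := ⋃ j ∈ I, VV Bd P j with hV
  have hVm : ∀ j ∈ I, MeasurableSet (VV Bd P j) := fun j hj =>
    (VV_sat (Finset.mem_Ico.1 hj).2.le x0).measurableSet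
  have hVmm : MeasurableSet V := Finset.measurableSet_biUnion _ hVm
  have hVP : V ⊆ P := Set.iUnion₂_subset fun j _ x hx => hx.1
  have hVB : V ⊆ Bd := Set.iUnion₂_subset fun j _ x hx => hx.2.1 (mem_Q_self j x)
  have hcov : P ⊆ R ∪ V := by
    intro x hx
    by_cases h : Q m x ⊆ Bd
    · right
      obtain ⟨j, hj, hxj⟩ := VV_cover hx hPB h
      exact Set.mem_biUnion hj hxj
    · left; exact ⟨hx, h⟩
  have hZR : ∀ x ∈ R, Zs s f lam m K x ≤ a := by
    intro x hx
    unfold Zs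
    calc _ ≤ (ENNReal.ofReal (2 * C7 n δ C4 * a0 ^ 2)) ^ (1/2 : ℝ) := by
          refine ENNReal.rpow_le_rpow ((hst x hx.1 m le_rfl hmK hx.2).trans ?_) (by norm_num)
          apply ENNReal.ofReal_le_ofReal
          gcongr
          linarith
      _ = a := sqrt_ofReal (by positivity) ha0n
  have hZV : ∀ j ∈ I, ∀ x ∈ VV Bd P j, Zs s f lam m K x ≤ a + Zs s f lam m j x := by
    intro j hj x hx
    rw [hI, Finset.mem_Ico] at hj
    unfold Zs
    rw [ha, ← sqrt_ofReal (by positivity) ha0n]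
    refine le_trans ?_ (ENNReal.rpow_add_le_add_rpow _ _ (by norm_num) (by norm_num))
    refine ENNReal.rpow_le_rpow ?_ (by norm_num)
    calc _ ≤ ENNReal.ofReal (lam ^ 2) * (W lam (fun k => op (s k) f x) m j +
          2 * W lam (fun k => op (s k) f x) (j + 1) K) := mul_le_mul' le_rfl (W_split _ _ _ _ _)
      _ = 2 * (ENNReal.ofReal (lam ^ 2) * W lam (fun k => op (s k) f x) (j + 1) K) +
          ENNReal.ofReal (lam ^ 2) * W lam (fun k => op (s k) f x) m j := by ring
      _ ≤ _ := by
          refine add_le_add ?_ le_rfl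
          refine (mul_le_mul' le_rfl (hst x hx.1 (j + 1) (by omega) (by omega) hx.2.2)).trans_eq ?_
          rw [mul_assoc 2 (C7 n δ C4), ENNReal.ofReal_mul (p := 2) (by norm_num), ENNReal.ofReal_ofNat]
  set b := (t + a) ^ p with hb
  have c9 : C9 n p C4 = 2 ^ (p + 1) * c' ^ p := rfl
  have c9t : C9 n p C4 ≠ ∞ := by
    rw [c9]
    exact ENNReal.mul_ne_top (by simp [ENNReal.rpow_eq_top_iff])
      (ENNReal.rpow_ne_top_of_nonneg hp0.le ENNReal.ofReal_ne_top)
  have e1 : ∫⁻ x in P, (t + Zs s f lam m K x) ^ p ≤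
      b * v + (2 ^ p * b * volume V + C9 n p C4 * ∫⁻ x in V, F x ^ p) := by
    refine (lintegral_mono_set hcov).trans ((lintegral_union_le _ _ _).trans (add_le_add ?_ ?_))
    · calc _ ≤ ∫⁻ x in R, b := by
            refine setLIntegral_mono measurable_const fun x hx => ?_
            exact ENNReal.rpow_le_rpow (add_le_add le_rfl (hZR x hx)) hp0.le
        _ ≤ ∫⁻ x in P, b := lintegral_mono_set fun x hx => hx.1
        _ = _ := by rw [setLIntegral_const]
    · have e3 : ∫⁻ x in V, (t + Zs s f lam m K x) ^ p ≤ ∫⁻ x in V, (2 ^ p * b + C9 n p C4 * F x ^ p) := by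
        rw [hV, lintegral_biUnion_finset (VV_disj Bd P _) hVm, lintegral_biUnion_finset (VV_disj Bd P _) hVm]
        refine Finset.sum_le_sum fun j hj => ?_
        have hj' := Finset.mem_Ico.1 hj
        calc _ ≤ ∫⁻ x in VV Bd P j, (t + a + Zs s f lam m j x) ^ p := by
              refine setLIntegral_mono' (hVm j hj) fun x hx => ?_
              refine ENNReal.rpow_le_rpow ?_ hp0.le
              rw [add_assoc]
              exact add_le_add le_rfl (hZV j hj x hx)
          _ ≤ _ := by
              refine lint_le_of_cubes j (VV_sat hj'.2.le x0) fun x _ => ?_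
              obtain ⟨d', hd'⟩ := Int.le.dest hj'.1
              have := ih d' (by omega) (by omega) x (t + a)
              rw [hd'] at this
              exact this
      refine e3.trans (le_of_eq ?_)
      rw [lintegral_add_left measurable_const, setLIntegral_const, lintegral_const_mul' _ _ c9t]
  have e2 : ∫⁻ x in P, (2 ^ p * t ^ p + C9 n p C4 * F x ^ p) =
      2 ^ p * t ^ p * v + (C9 n p C4 * (∫⁻ x in V, F x ^ p) + C9 n p C4 * ∫⁻ x in P \ V, F x ^ p) := by
    rw [lintegral_add_left measurable_const, setLIntegral_const, lintegral_const_mul' _ _ c9t, ← mul_add]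
    congr 2
    rw [← lintegral_inter_add_sdiff _ P hVmm, Set.inter_eq_right.2 hVP]
  have hPV : v ≤ 2 * volume (P \ V) := by
    have h1 : v = volume V + volume (P \ V) := by
      rw [hv, ← measure_inter_add_sdiff P hVmm, Set.inter_eq_right.2 hVP]
    have h2 : v + v ≤ v + 2 * volume (P \ V) := by
      rw [← two_mul]
      nth_rewrite 1 [h1]
      rw [mul_add]
      exact add_le_add ((mul_le_mul' le_rfl (measure_mono hVB)).trans hvol2) le_rfl
    exact (ENNReal.add_le_add_iff_left hvt).1 h2
  have e4 : 2 ^ p * a ^ p * v ≤ C9 n p C4 * ∫⁻ x in P \ V, F x ^ p := by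
    calc _ ≤ 2 ^ p * a ^ p * (2 * volume (P \ V)) := mul_le_mul' le_rfl hPV
      _ = 2 ^ (p + 1) * ∫⁻ x in P \ V, a ^ p := by
          rw [setLIntegral_const, ENNReal.rpow_add _ _ (by norm_num) (by norm_num), ENNReal.rpow_one]
          ring
      _ ≤ 2 ^ (p + 1) * ∫⁻ x in P \ V, c' ^ p * F x ^ p := by
          refine mul_le_mul' le_rfl (setLIntegral_mono' (hPm.diff hVmm) fun x hx => ?_)
          rw [← ENNReal.mul_rpow_of_nonneg _ _ hp0.le]
          exact ENNReal.rpow_le_rpow (haF x hx.1) hp0.le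
      _ = _ := by
          rw [lintegral_const_mul' _ _ (ENNReal.rpow_ne_top_of_nonneg hp0.le ENNReal.ofReal_ne_top), c9,
            mul_assoc]
  have hbb : 2 * b ≤ 2 ^ p * (t ^ p + a ^ p) := by
    calc 2 * b ≤ 2 * (2 ^ (p - 1) * (t ^ p + a ^ p)) :=
          mul_le_mul' le_rfl (ENNReal.rpow_add_le_mul_rpow_add_rpow _ _ hp.le)
      _ = _ := by
          rw [← mul_assoc]
          congr 1
          nth_rewrite 1 [← ENNReal.rpow_one 2]
          rw [← ENNReal.rpow_add _ _ (by norm_num) (by norm_num)]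
          congr 1; ring
  rw [e2]
  refine e1.trans ?_
  calc _ ≤ b * v + (b * v + C9 n p C4 * ∫⁻ x in V, F x ^ p) := by
        refine add_le_add le_rfl (add_le_add ?_ le_rfl)
        calc _ = b * (2 ^ p * volume V) := by ring
          _ ≤ b * v := mul_le_mul' le_rfl ((mul_le_mul' le_rfl (measure_mono hVB)).trans hvolB)
    _ = 2 * b * v + C9 n p C4 * ∫⁻ x in V, F x ^ p := by ring
    _ ≤ 2 ^ p * (t ^ p + a ^ p) * v + C9 n p C4 * ∫⁻ x in V, F x ^ p :=
        add_le_add (mul_le_mul' hbb le_rfl) le_rfl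
    _ = 2 ^ p * t ^ p * v + ((C9 n p C4 * ∫⁻ x in V, F x ^ p) + 2 ^ p * a ^ p * v) := by ring
    _ ≤ _ := add_le_add le_rfl (add_le_add le_rfl e4)

/-- The `L^p` bound by the maximal function -/
lemma Zs_int {s : ℤ → E n → E n → ℝ} (hs : Ker s) {C4 : ℝ} (hC4 : 0 ≤ C4) (h4 : K4 C4 s)
    {f : E n → ℝ} (hf : Nice f) {p : ℝ} (hp : 1 < p) {m K : ℤ} (hmK : m ≤ K)
    (hpos : ∀ k x, 0 < po k f x)
    {lam : ℝ} (hl : 0 < lam) {F : E n → ℝ≥0∞}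
    (hF : ∀ k ∈ Finset.Icc m K, ∀ x, ENNReal.ofReal (po k f x) ≤ F x) :
    ∫⁻ x, Zs s f lam m K x ^ p ≤ ∫⁻ x, C9 n p C4 * F x ^ p := by
  obtain ⟨d, rfl⟩ := Int.le.dest hmK
  rw [← setLIntegral_univ, ← setLIntegral_univ (fun x => C9 n p C4 * F x ^ p)]
  refine lint_le_of_cubes (m + d) (sat_univ _) fun x _ => ?_
  have := scale_ind hs hC4 h4 hf hp hpos hl hF d le_rfl x 0
  simpa [show 0 < p by linarith] using this

lemma C9_ne_top {p C4 : ℝ} (hp : 1 < p) : C9 n p C4 ≠ ∞ := by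
  unfold C9
  exact ENNReal.mul_ne_top (by simp [ENNReal.rpow_eq_top_iff])
      (ENNReal.rpow_ne_top_of_nonneg (by linarith) ENNReal.ofReal_ne_top)

end JV

-- part 13
namespace JV
variable {n : ℕ}

lemma Ek_large (hn : 1 ≤ n) {h : E n → ℝ} (hh : Nice h) {α : ℝ} (hα : 0 < α) (K : ℤ) :
    ∃ K', K ≤ K' ∧ ∀ x, Ek K' (fun y => |h y|) x ≤ α := by
  obtain ⟨N, hN⟩ := pow_unbounded_of_one_lt ((∫ y, |h y|) / α) (one_lt_two (α := ℝ))
  refine ⟨max K N, le_max_left _ _, fun x => ?_⟩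
  set K' := max K (N:ℤ)
  have h1 : (2:ℝ) ^ N ≤ ((2:ℝ) ^ K') ^ n := by
    have h2 : (2:ℝ) ^ N ≤ (2:ℝ) ^ K' := by
      rw [← zpow_natCast]; exact zpow_le_zpow_right₀ (by norm_num) (le_max_right _ _)
    have h3 : (1:ℝ) ≤ 2 ^ N := one_le_pow₀ (by norm_num)
    exact h2.trans (le_self_pow₀ (h3.trans h2) (by omega))
  unfold Ek
  have h4 : ∫ y in Q K' x, |h y| ≤ ∫ y, |h y| :=
    setIntegral_le_integral hh.int.abs (Filter.Eventually.of_forall fun y => abs_nonneg _)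
  have h5 : (∫ y, |h y|) < α * 2 ^ N := by rwa [div_lt_iff₀' hα] at hN
  have := two_pos K'
  rw [inv_mul_le_iff₀ (by positivity)]
  calc _ ≤ _ := h4
    _ ≤ α * 2 ^ N := h5.le
    _ ≤ α * ((2:ℝ) ^ K') ^ n := by gcongr
    _ = _ := by ring

def cm (n : ℕ) : ℝ := (n + 2) * (2 ^ n * I0 n + 1)
def Cm (n : ℕ) : ℝ := 3 ^ n + 8 * D1 n

lemma cm_pos : 0 < cm n := by have := I0_nonneg (n := n); unfold cm; positivity
lemma Cm_pos : 0 < Cm n := by have := D1_nonneg (n := n); unfold Cm; positivity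

lemma mx_weak (hn : 1 ≤ n) {h : E n → ℝ} (hh : Nice h) {α : ℝ} (hα : 0 < α) {m K : ℤ} (hmK : m ≤ K) :
    ENNReal.ofReal α * volume {x | ∃ k ∈ Finset.Icc m K, cm n * α < po k h x} ≤
      ENNReal.ofReal (Cm n) * ∫⁻ x, ‖h x‖ₑ := by
  obtain ⟨K', hKK, hK'⟩ := Ek_large hn hh hα K
  have hF := hh.abs
  set F : E n → ℝ := fun x => |h x| with hFd
  have hK2 : ∀ x, Ek K' (fun y => |F y|) x ≤ α := by simpa [hFd] using hK'
  have hmK' : m ≤ K' := hmK.trans hKK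
  have hg := good_nice hF hα hmK' hK2
  set O := OmS F α m K' with hO
  have hOm : MeasurableSet O := OmS_meas _ _ _ _
  set S : E n → ℝ≥0∞ := fun x => ∑ k ∈ Finset.Icc m K', ‖op (pk k) (fun y => F y - good F α m K' y) x‖ₑ
    with hS
  have hSm : Measurable S := Finset.measurable_fun_sum _ fun k _ =>
    (measurable_op (pk_ker.dom k) (hF.sub hg).meas).enorm
  have hsub : {x | ∃ k ∈ Finset.Icc m K, cm n * α < po k h x} ⊆ O ∪ ({x | ENNReal.ofReal α ≤ S x} ∩ Oᶜ) := by
    rintro x ⟨k, hk, hx⟩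
    by_cases hxO : x ∈ O
    · exact Or.inl hxO
    right
    refine ⟨?_, hxO⟩
    have hk' : k ∈ Finset.Icc m K' := by
      rw [Finset.mem_Icc] at hk ⊢; omega
    refine le_trans ?_ (Finset.single_le_sum
      (f := fun k => ‖op (pk k) (fun y => F y - good F α m K' y) x‖ₑ) (fun _ _ => zero_le) hk')
    rw [← ofReal_norm]
    apply ENNReal.ofReal_le_ofReal
    rw [op_sub pk_ker hF hg, hFd, op_pk]
    have h1 := abs_op_le (two_pos k) (pk_ker.dom k) (good_le hF hα hmK' hK2) x
    rw [← hFd]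
    have h2 : (2 ^ n * I0 n + 1) * α < ((n:ℝ) + 2)⁻¹ * po k h x := by
      rw [lt_inv_mul_iff₀ (by positivity)]
      unfold cm at hx
      linarith
    have h3 := abs_le.1 h1
    rw [Real.norm_eq_abs]
    refine le_trans ?_ (le_abs_self _)
    nlinarith [h3.2]
  have c1 : ENNReal.ofReal α * volume ({x | ENNReal.ofReal α ≤ S x} ∩ Oᶜ) ≤
      ENNReal.ofReal (8 * D1 n) * ∫⁻ x, ‖F x‖ₑ := by
    refine le_trans ?_ (cz_bad pk_ker hF (α := α) hmK')
    rw [← Measure.restrict_apply' hOm.compl]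
    exact mul_meas_ge_le_lintegral hSm _
  have hFe : ∫⁻ x, ‖F x‖ₑ = ∫⁻ x, ‖h x‖ₑ := by
    refine lintegral_congr fun x => ?_
    simp only [hFd]
    rw [← Real.norm_eq_abs, enorm_norm]
  rw [hFe] at c1
  have c2 := OmS_vol hF (α := α) hmK'
  rw [hFe] at c2
  calc _ ≤ ENNReal.ofReal α * (volume O + volume ({x | ENNReal.ofReal α ≤ S x} ∩ Oᶜ)) :=
        mul_le_mul' le_rfl ((measure_mono hsub).trans (measure_union_le _ _))
    _ ≤ 3 ^ n * (∫⁻ x, ‖h x‖ₑ) + ENNReal.ofReal (8 * D1 n) * ∫⁻ x, ‖h x‖ₑ := by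
        rw [mul_add]; exact add_le_add c2 c1
    _ = _ := by
        have := D1_nonneg (n := n)
        rw [← add_mul, Cm, ENNReal.ofReal_add (by positivity) (by positivity), ENNReal.ofReal_pow (by norm_num)]
        simp

lemma po_trunc {f : E n → ℝ} (hf : Nice f) {α : ℝ} (hα : 0 ≤ α) (k : ℤ) (x : E n) :
    po k f x ≤ po k ({y | α < |f y|}.indicator f) x + α * I0 n := by
  have hm : MeasurableSet {y | α < |f y|} := measurableSet_lt measurable_const hf.meas.abs
  have hi := hf.indicator hm
  have i2 : Integrable fun y : E n => α * rho (2 ^ k) (x - y) :=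
    ((integrable_rho (two_pos k)).comp_sub_left x).const_mul α
  unfold po
  rw [← integral_rho_left (two_pos k) x, ← integral_const_mul, ← integral_add (po_int k hi x) i2]
  refine integral_mono (po_int k hf x) ((po_int k hi x).add i2) fun y => ?_
  have h3 := (rho_pos (two_pos k) (x - y))
  simp only
  by_cases h : α < |f y|
  · rw [Set.indicator_of_mem (show y ∈ {y | α < |f y|} from h)]
    have : 0 ≤ α * rho (2 ^ k) (x - y) := by positivity
    linarith
  · rw [Set.indicator_of_notMem (show y ∉ {y | α < |f y|} from h)]
    push Not at h
    simp only [abs_zero, mul_zero, zero_add]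
    rw [mul_comm]
    gcongr

lemma lint_rpow {a r : ℝ} (hr : -1 < r) (ha : 0 ≤ a) :
    ∫⁻ t in Set.Ioo 0 a, ENNReal.ofReal (t ^ r) = ENNReal.ofReal (a ^ (r + 1) / (r + 1)) := by
  rw [Measure.restrict_congr_set Ioo_ae_eq_Ioc, ← ofReal_integral_eq_lintegral_ofReal,
    ← intervalIntegral.integral_of_le ha, integral_rpow (Or.inl hr), Real.zero_rpow (by linarith), sub_zero]
  · exact (intervalIntegral.intervalIntegrable_rpow' hr (a := 0) (b := a)).1
  · filter_upwards [ae_restrict_mem measurableSet_Ioc] with t ht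
    exact Real.rpow_nonneg ht.1.le _

def cM (n : ℕ) : ℝ := cm n + I0 n
lemma cM_pos : 0 < cM n := add_pos_of_pos_of_nonneg cm_pos I0_nonneg
def CM (n : ℕ) (p : ℝ) : ℝ≥0∞ :=
  ENNReal.ofReal p * ENNReal.ofReal (Cm n * cM n * (cM n ^ (p - 1) / (p - 1)))

lemma mx_int (hn : 1 ≤ n) {f : E n → ℝ} (hf : Nice f) {p : ℝ} (hp : 1 < p) {m K : ℤ} (hmK : m ≤ K)
    {G : E n → ℝ} (hG : Measurable G) (hG0 : ∀ x, 0 ≤ G x)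
    (hGp : ∀ x t, t < G x → ∃ k ∈ Finset.Icc m K, t < po k f x) :
    ∫⁻ x, ENNReal.ofReal (G x ^ p) ≤ CM n p * ∫⁻ x, ‖f x‖ₑ ^ p := by
  have hc := cM_pos (n := n)
  have hC := Cm_pos (n := n)
  rw [lintegral_rpow_eq_lintegral_meas_lt_mul volume (Filter.Eventually.of_forall hG0) hG.aemeasurable
    (by linarith), CM, mul_assoc]
  refine mul_le_mul' le_rfl ?_
  have key : ∀ t ∈ Set.Ioi (0:ℝ), volume {x | t < G x} * ENNReal.ofReal (t ^ (p - 1)) ≤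
      ∫⁻ x, ENNReal.ofReal (Cm n * cM n) * ({z : ℝ × E n | z.1 < cM n * |f z.2|}.indicator
        (fun z => ‖f z.2‖ₑ * ENNReal.ofReal (z.1 ^ (p - 2))) (t, x)) := by
    intro t ht
    have ht : 0 < t := ht
    set α := t / cM n with hαd
    have hα : 0 < α := by positivity
    have hm : MeasurableSet {y | α < |f y|} := measurableSet_lt measurable_const hf.meas.abs
    have hi := hf.indicator hm
    have h1 : {x | t < G x} ⊆ {x | ∃ k ∈ Finset.Icc m K, cm n * α < po k ({y | α < |f y|}.indicator f) x} := by
      intro x hx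
      obtain ⟨k, hk, hkx⟩ := hGp x t hx
      refine ⟨k, hk, ?_⟩
      have := po_trunc hf hα.le k x
      have h2 : t = cm n * α + α * I0 n := by rw [hαd]; field_simp; rw [cM]
      linarith
    have h2 := (mul_le_mul' (le_refl (ENNReal.ofReal α)) (measure_mono h1)).trans (mx_weak hn hi hα hmK)
    have h3 : volume {x | t < G x} * ENNReal.ofReal (t ^ (p - 1)) =
        ENNReal.ofReal (cM n * t ^ (p - 2)) * (ENNReal.ofReal α * volume {x | t < G x}) := by
      rw [← mul_assoc, ← ENNReal.ofReal_mul (by positivity), mul_comm]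
      congr 2
      rw [hαd, show p - 1 = p - 2 + 1 by ring, Real.rpow_add ht, Real.rpow_one]
      field_simp
    rw [h3]
    refine (mul_le_mul' le_rfl h2).trans (le_of_eq ?_)
    rw [lintegral_const_mul' _ _ ofReal_ne_top, ← mul_assoc, ← ENNReal.ofReal_mul (by positivity),
      show cM n * t ^ (p - 2) * Cm n = Cm n * cM n * t ^ (p - 2) by ring,
      ENNReal.ofReal_mul (by positivity), mul_assoc]
    congr 1
    rw [← lintegral_const_mul' _ _ ofReal_ne_top]
    refine lintegral_congr fun x => ?_
    by_cases h : t < cM n * |f x|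
    · rw [Set.indicator_of_mem (show (t, x) ∈ {z : ℝ × E n | z.1 < cM n * |f z.2|} from h),
        Set.indicator_of_mem (show x ∈ {y | α < |f y|} by
          rw [Set.mem_ofPred_eq, hαd, div_lt_iff₀' hc]; exact h), mul_comm]
    · rw [Set.indicator_of_notMem (show (t, x) ∉ {z : ℝ × E n | z.1 < cM n * |f z.2|} from h),
        Set.indicator_of_notMem (show x ∉ {y | α < |f y|} by
          rw [Set.mem_ofPred_eq, hαd, div_lt_iff₀' hc]; exact h)]
      simp
  refine (setLIntegral_mono' measurableSet_Ioi key).trans ?_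
  have mm : Measurable fun z : ℝ × E n => {z : ℝ × E n | z.1 < cM n * |f z.2|}.indicator
        (fun z => ‖f z.2‖ₑ * ENNReal.ofReal (z.1 ^ (p - 2))) z := by
    have := hf.meas
    refine Measurable.indicator (by fun_prop) (measurableSet_lt (by fun_prop) ?_)
    exact ((hf.meas.comp measurable_snd).abs).const_mul _
  rw [lintegral_lintegral_swap (mm.const_mul _).aemeasurable,
    ← lintegral_const_mul _ (by have := hf.meas; fun_prop)]
  refine lintegral_mono fun x => ?_
  beta_reduce
  rw [lintegral_const_mul' _ _ ofReal_ne_top, ENNReal.ofReal_mul (p := Cm n * cM n) (by positivity), mul_assoc]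
  refine mul_le_mul' le_rfl (le_of_eq ?_)
  calc _ = ∫⁻ t in Set.Ioi 0, (Set.Iio (cM n * |f x|)).indicator
        (fun t => ‖f x‖ₑ * ENNReal.ofReal (t ^ (p - 2))) t := by
        refine lintegral_congr fun t => ?_
        rfl
    _ = ∫⁻ t in Set.Ioo 0 (cM n * |f x|), ‖f x‖ₑ * ENNReal.ofReal (t ^ (p - 2)) := by
        rw [lintegral_indicator measurableSet_Iio, Measure.restrict_restrict measurableSet_Iio,
          Set.inter_comm]; rfl
    _ = ‖f x‖ₑ * ENNReal.ofReal ((cM n * |f x|) ^ (p - 1) / (p - 1)) := by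
        rw [lintegral_const_mul' _ _ enorm_ne_top, lint_rpow (by linarith) (by positivity),
          show p - 2 + 1 = p - 1 by ring]
    _ = ENNReal.ofReal (cM n ^ (p - 1) / (p - 1) * |f x| ^ p) := by
        rw [← ofReal_norm, ← ENNReal.ofReal_mul (norm_nonneg _)]
        congr 1
        rw [Real.norm_eq_abs, Real.mul_rpow hc.le (abs_nonneg _)]
        have : |f x| ^ p = |f x| * |f x| ^ (p - 1) := by
          nth_rewrite 1 [show p = 1 + (p - 1) by ring]
          rw [Real.rpow_add' (abs_nonneg _) (by linarith), Real.rpow_one]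
        rw [this]; ring
    _ = _ := by
        have : 0 < p - 1 := by linarith
        rw [ENNReal.ofReal_mul (by positivity), ← ENNReal.ofReal_rpow_of_nonneg (abs_nonneg _) (by linarith),
          ← Real.norm_eq_abs, ofReal_norm]

lemma CM_ne_top {p : ℝ} : CM n p ≠ ∞ := ENNReal.mul_ne_top ofReal_ne_top ofReal_ne_top

/-- Final estimate for a single operator -/
lemma Zs_final (hn : 1 ≤ n) {s : ℤ → E n → E n → ℝ} (hs : Ker s) {C4 : ℝ} (hC4 : 0 ≤ C4) (h4 : K4 C4 s)
    {f : E n → ℝ} (hf : Nice f) {p : ℝ} (hp : 1 < p) {m K : ℤ} (hmK : m ≤ K)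
    (hpos : ∀ k x, 0 < po k f x) {lam : ℝ} (hl : 0 < lam) :
    ∫⁻ x, Zs s f lam m K x ^ p ≤ C9 n p C4 * CM n p * ∫⁻ x, ‖f x‖ₑ ^ p := by
  have hne : (Finset.Icc m K).Nonempty := ⟨m, by simp [hmK]⟩
  set G : E n → ℝ := fun x => (Finset.Icc m K).sup' hne fun k => po k f x with hG
  have hGm : Measurable G := by
    have := Finset.measurable_sup' hne (f := fun k => po k f) fun k _ => measurable_po k hf
    convert this using 1
    funext x; simp [hG]
  have hG1 : ∀ k ∈ Finset.Icc m K, ∀ x, po k f x ≤ G x := fun k hk x =>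
    Finset.le_sup' (fun k => po k f x) hk
  have hG0 : ∀ x, 0 ≤ G x := fun x => (po_nonneg m f x).trans (hG1 m (by simp [hmK]) x)
  have h1 := Zs_int hs hC4 h4 hf hp hmK hpos hl (F := fun x => ENNReal.ofReal (G x))
    fun k hk x => ENNReal.ofReal_le_ofReal (hG1 k hk x)
  refine h1.trans ?_
  rw [lintegral_const_mul' _ _ (C9_ne_top hp), mul_assoc]
  refine mul_le_mul' le_rfl ?_
  refine le_trans (le_of_eq ?_) (mx_int hn hf hp hmK hGm hG0 fun x t ht => ?_)
  · refine lintegral_congr fun x => ?_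
    rw [ENNReal.ofReal_rpow_of_nonneg (hG0 x) (by linarith)]
  · exact (Finset.lt_sup'_iff hne).1 ht

end JV

-- part 14
namespace JV
variable {n : ℕ}

/-- dilated Schwartz function -/
def sc (ψ : SchwartzMap (E n) ℝ) (k : ℤ) (h : E n) : ℝ := (((2:ℝ) ^ k) ^ n)⁻¹ * ψ (((2:ℝ) ^ k)⁻¹ • h)

lemma sc_cont (ψ : SchwartzMap (E n) ℝ) (k : ℤ) : Continuous (sc ψ k) := by
  unfold sc
  exact continuous_const.mul (ψ.continuous.comp (continuous_const_smul _))

lemma sch_decay (ψ : SchwartzMap (E n) ℝ) : ∃ A : ℝ, 0 < A ∧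
    (∀ u, |ψ u| ≤ A / (1 + ‖u‖) ^ (n + 4)) ∧ ∀ u, ‖fderiv ℝ ψ u‖ ≤ A / (1 + ‖u‖) ^ (n + 4) := by
  set M := 2 ^ (n + 4) * (Finset.Iic (n + 4, 1)).sup (fun m => SchwartzMap.seminorm ℝ m.1 m.2) ψ with hM
  have h0 : ∀ j ≤ 1, ∀ u, (1 + ‖u‖) ^ (n + 4) * ‖iteratedFDeriv ℝ j ψ u‖ ≤ M := fun j hj u =>
    SchwartzMap.one_add_le_sup_seminorm_apply (𝕜 := ℝ) (m := (n + 4, 1)) le_rfl hj ψ u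
  have hM0 : 0 ≤ M := le_trans (by positivity) (h0 0 (by norm_num) 0)
  refine ⟨M + 1, by positivity, fun u => ?_, fun u => ?_⟩
  · rw [le_div_iff₀ (by positivity), mul_comm]
    have := h0 0 (by norm_num) u
    rw [norm_iteratedFDeriv_zero, Real.norm_eq_abs] at this
    linarith
  · rw [le_div_iff₀ (by positivity), mul_comm]
    have := h0 1 le_rfl u
    rw [norm_iteratedFDeriv_one] at this
    linarith

lemma dec_rho (u : E n) : 1 / (1 + ‖u‖) ^ (n + 4) * (1 + ‖u‖) ≤ rho 1 u := by
  unfold rho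
  have h1 : 1 ≤ 1 + ‖u‖ := by have := norm_nonneg u; linarith
  rw [show n + 4 = (n + 2) + 1 + 1 by ring, pow_succ, pow_succ]
  have h2 : 0 < (1 + ‖u‖) ^ (n + 2) := by positivity
  rw [div_mul_eq_mul_div, div_le_div_iff₀ (by positivity) (by positivity)]
  have h3 : (1 + ‖u‖) ≤ (1 + ‖u‖) * (1 + ‖u‖) := by nlinarith
  nlinarith

lemma sch_one (ψ : SchwartzMap (E n) ℝ) : ∃ A : ℝ, 0 < A ∧
    (∀ u, |ψ u| * (1 + ‖u‖) ≤ A * rho 1 u) ∧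
    ∀ u u', |ψ u - ψ u'| * (1 + ‖u‖) ≤ A * (‖u - u'‖ * (rho 1 u + rho 1 u')) := by
  obtain ⟨A, hA, h1, h2⟩ := sch_decay ψ
  have k1 : ∀ u, |ψ u| * (1 + ‖u‖) ≤ A * rho 1 u := fun u => by
    calc _ ≤ A / (1 + ‖u‖) ^ (n + 4) * (1 + ‖u‖) := by gcongr; exact h1 u
      _ = A * (1 / (1 + ‖u‖) ^ (n + 4) * (1 + ‖u‖)) := by ring
      _ ≤ _ := by gcongr; exact dec_rho u
  refine ⟨2 ^ (n + 4) * A, by positivity, fun u => ?_, fun u u' => ?_⟩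
  · have := rho_pos one_pos u
    calc _ ≤ 1 * (A * rho 1 u) := by rw [one_mul]; exact k1 u
      _ ≤ 2 ^ (n + 4) * (A * rho 1 u) := by gcongr; exact one_le_pow₀ (by norm_num)
      _ = _ := by ring
  have r1 := rho_pos one_pos u
  have r2 := rho_pos one_pos u'
  rcases le_total 1 ‖u - u'‖ with h | h
  · have e1 : 1 + ‖u‖ ≤ 2 * ‖u - u'‖ * (1 + ‖u'‖) := by
      have h3 : ‖u‖ ≤ ‖u - u'‖ + ‖u'‖ := by simpa using norm_add_le (u - u') u'
      have := norm_nonneg u'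
      nlinarith
    calc |ψ u - ψ u'| * (1 + ‖u‖) ≤ (|ψ u| + |ψ u'|) * (1 + ‖u‖) := by gcongr; exact abs_sub _ _
      _ = |ψ u| * (1 + ‖u‖) + |ψ u'| * (1 + ‖u‖) := by ring
      _ ≤ A * rho 1 u * ‖u - u'‖ + |ψ u'| * (2 * ‖u - u'‖ * (1 + ‖u'‖)) := by
          refine add_le_add ?_ (mul_le_mul_of_nonneg_left e1 (abs_nonneg _))
          have : A * rho 1 u * 1 ≤ A * rho 1 u * ‖u - u'‖ := by gcongr
          linarith [k1 u]
      _ = A * rho 1 u * ‖u - u'‖ + (|ψ u'| * (1 + ‖u'‖)) * (2 * ‖u - u'‖) := by ring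
      _ ≤ A * rho 1 u * ‖u - u'‖ + (A * rho 1 u') * (2 * ‖u - u'‖) := 
          add_le_add le_rfl (mul_le_mul_of_nonneg_right (k1 u') (by positivity))
      _ ≤ 2 * (A * (‖u - u'‖ * (rho 1 u + rho 1 u'))) := by
          have : 0 ≤ A * rho 1 u * ‖u - u'‖ := by positivity
          nlinarith
      _ ≤ 2 ^ (n + 4) * (A * (‖u - u'‖ * (rho 1 u + rho 1 u'))) := by
          gcongr
          exact le_self_pow₀ (by norm_num) (by omega)
      _ = _ := by ring
  · have hB : ∀ ξ ∈ Metric.closedBall u 1, ‖fderiv ℝ ψ ξ‖ ≤ 2 ^ (n + 4) * A / (1 + ‖u‖) ^ (n + 4) := by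
      intro ξ hξ
      refine (h2 ξ).trans ?_
      rw [div_le_div_iff₀ (by positivity) (by positivity)]
      have : 1 + ‖u‖ ≤ 2 * (1 + ‖ξ‖) := by
        have h3 : ‖u‖ ≤ ‖u - ξ‖ + ‖ξ‖ := by simpa using norm_add_le (u - ξ) ξ
        rw [mem_closedBall_iff_norm, norm_sub_rev] at hξ
        have := norm_nonneg ξ
        linarith
      calc A * (1 + ‖u‖) ^ (n + 4) ≤ A * (2 * (1 + ‖ξ‖)) ^ (n + 4) := by gcongr
        _ = _ := by rw [mul_pow]; ring
    have := (convex_closedBall u 1).norm_image_sub_le_of_norm_fderiv_le (f := ψ) (𝕜 := ℝ)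
      (fun ξ _ => ψ.differentiableAt) hB (x := u') (y := u)
      (by rw [mem_closedBall_iff_norm, norm_sub_rev]; exact h) (by simp)
    rw [Real.norm_eq_abs] at this
    calc _ ≤ 2 ^ (n + 4) * A / (1 + ‖u‖) ^ (n + 4) * ‖u - u'‖ * (1 + ‖u‖) := by gcongr
      _ = 2 ^ (n + 4) * A * ‖u - u'‖ * (1 / (1 + ‖u‖) ^ (n + 4) * (1 + ‖u‖)) := by ring
      _ ≤ 2 ^ (n + 4) * A * ‖u - u'‖ * rho 1 u := by gcongr; exact dec_rho u
      _ ≤ 2 ^ (n + 4) * A * ‖u - u'‖ * (rho 1 u + rho 1 u') := by gcongr; linarith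
      _ = _ := by ring

lemma sc_bound (ψ : SchwartzMap (E n) ℝ) : ∃ A : ℝ, 0 < A ∧
    (∀ k h, |sc ψ k h| * (1 + ((2:ℝ) ^ k)⁻¹ * ‖h‖) ≤ A * rho (2 ^ k) h) ∧
    ∀ k h h', |sc ψ k h - sc ψ k h'| * (1 + ((2:ℝ) ^ k)⁻¹ * ‖h‖) ≤
      A * (((2:ℝ) ^ k)⁻¹ * ‖h - h'‖ * (rho (2 ^ k) h + rho (2 ^ k) h')) := by
  obtain ⟨A, hA, h1, h2⟩ := sch_one ψ
  refine ⟨A, hA, fun k h => ?_, fun k h h' => ?_⟩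
  · have ht := two_pos k
    have := h1 (((2:ℝ) ^ k)⁻¹ • h)
    rw [norm_smul, Real.norm_of_nonneg (by positivity)] at this
    rw [rho_scale ht, sc, abs_mul, abs_of_nonneg (by positivity), mul_assoc]
    calc _ ≤ (((2:ℝ) ^ k) ^ n)⁻¹ * (A * rho 1 (((2:ℝ) ^ k)⁻¹ • h)) := by gcongr
      _ = _ := by ring
  · have ht := two_pos k
    have := h2 (((2:ℝ) ^ k)⁻¹ • h) (((2:ℝ) ^ k)⁻¹ • h')
    rw [← smul_sub, norm_smul, norm_smul, Real.norm_of_nonneg (by positivity)] at this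
    rw [rho_scale ht, rho_scale ht, sc, sc, ← mul_sub, abs_mul, abs_of_nonneg (by positivity), mul_assoc]
    calc _ ≤ (((2:ℝ) ^ k) ^ n)⁻¹ * _ := mul_le_mul_of_nonneg_left this (by positivity)
      _ = _ := by ring

structure ScB (ψ : SchwartzMap (E n) ℝ) (A : ℝ) : Prop where
  pos : 0 < A
  size : ∀ k h, |sc ψ k h| * (1 + ((2:ℝ) ^ k)⁻¹ * ‖h‖) ≤ A * rho (2 ^ k) h
  reg : ∀ k h h', |sc ψ k h - sc ψ k h'| * (1 + ((2:ℝ) ^ k)⁻¹ * ‖h‖) ≤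
      A * (((2:ℝ) ^ k)⁻¹ * ‖h - h'‖ * (rho (2 ^ k) h + rho (2 ^ k) h'))

lemma ScB_ex (ψ : SchwartzMap (E n) ℝ) : ∃ A, ScB ψ A := by
  obtain ⟨A, hA, h1, h2⟩ := sc_bound ψ
  exact ⟨A, hA, h1, h2⟩

lemma ScB.size' {ψ : SchwartzMap (E n) ℝ} {A : ℝ} (h : ScB ψ A) (k : ℤ) (x : E n) :
    |sc ψ k x| ≤ A * rho (2 ^ k) x := by
  refine le_trans ?_ (h.size k x)
  have := two_pos k
  have h2 : 0 ≤ ((2:ℝ) ^ k)⁻¹ * ‖x‖ := by positivity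
  have := abs_nonneg (sc ψ k x)
  nlinarith

lemma ScB.reg' {ψ : SchwartzMap (E n) ℝ} {A : ℝ} (h : ScB ψ A) (k : ℤ) (x y : E n) :
    |sc ψ k x - sc ψ k y| ≤ A * (((2:ℝ) ^ k)⁻¹ * ‖x - y‖ * (rho (2 ^ k) x + rho (2 ^ k) y)) := by
  refine le_trans ?_ (h.reg k x y)
  have := two_pos k
  have h2 : 0 ≤ ((2:ℝ) ^ k)⁻¹ * ‖x‖ := by positivity
  have := abs_nonneg (sc ψ k x - sc ψ k y)
  nlinarith

def kP (ψ : SchwartzMap (E n) ℝ) (A : ℝ) (k : ℤ) (x y : E n) : ℝ := A⁻¹ * sc ψ k (x - y)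

lemma kP_ker {ψ : SchwartzMap (E n) ℝ} {A : ℝ} (h : ScB ψ A) : Ker (kP ψ A) := by
  have hA := h.pos
  refine ⟨fun k => ?_, fun k x y => ?_, fun k x y y' => ?_, fun k x x' y => ?_⟩
  · exact ((sc_cont ψ k).measurable.comp (measurable_fst.sub measurable_snd)).const_mul _
  · unfold kP
    rw [abs_mul, abs_of_pos (inv_pos.2 hA), inv_mul_le_iff₀ hA]
    exact h.size' k _
  · unfold kP
    rw [← mul_sub, abs_mul, abs_of_pos (inv_pos.2 hA), inv_mul_le_iff₀ hA]
    have := h.reg' k (x - y) (x - y')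
    rwa [show x - y - (x - y') = -(y - y') by abel, norm_neg] at this
  · unfold kP
    rw [← mul_sub, abs_mul, abs_of_pos (inv_pos.2 hA), inv_mul_le_iff₀ hA]
    have := h.reg' k (x - y) (x' - y)
    rwa [show x - y - (x' - y) = x - x' by abel] at this

def kS (ψ : SchwartzMap (E n) ℝ) (A L : ℝ) (b : E n → ℝ) (k : ℤ) (x y : E n) : ℝ :=
  (2 * A * L)⁻¹ * ((b x - b y) * ((2:ℝ) ^ k)⁻¹ * sc ψ k (x - y))

lemma kS_ker {ψ : SchwartzMap (E n) ℝ} {A : ℝ} (h : ScB ψ A) {b : E n → ℝ} {L : ℝ} (hL : 0 < L)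
    (hbm : Measurable b) (hb : ∀ x y, |b x - b y| ≤ L * ‖x - y‖) : Ker (kS ψ A L b) := by
  have hA := h.pos
  have hAL : 0 < 2 * A * L := by positivity
  -- weighted bound
  have hw : ∀ (k : ℤ) (x y : E n), |b x - b y| * ((2:ℝ) ^ k)⁻¹ ≤ L * (1 + ((2:ℝ) ^ k)⁻¹ * ‖x - y‖) := by
    intro k x y
    have := two_pos k
    calc _ ≤ L * ‖x - y‖ * ((2:ℝ) ^ k)⁻¹ := by gcongr; exact hb x y
      _ ≤ _ := by nlinarith
  refine ⟨fun k => ?_, fun k x y => ?_, fun k x y y' => ?_, fun k x x' y => ?_⟩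
  · have m1 : Measurable fun z : E n × E n => sc ψ k (z.1 - z.2) :=
      (sc_cont ψ k).measurable.comp (measurable_fst.sub measurable_snd)
    have m2 : Measurable fun z : E n × E n => b z.1 := hbm.comp measurable_fst
    have m3 : Measurable fun z : E n × E n => b z.2 := hbm.comp measurable_snd
    exact (((m2.sub m3).mul_const _).mul m1).const_mul _
  · unfold kS
    have ht := two_pos k
    rw [abs_mul, abs_of_pos (inv_pos.2 hAL), inv_mul_le_iff₀ hAL, abs_mul, abs_mul,
      abs_of_pos (inv_pos.2 ht)]
    have := rho_pos ht (x - y)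
    calc _ ≤ L * (1 + ((2:ℝ) ^ k)⁻¹ * ‖x - y‖) * |sc ψ k (x - y)| := 
          mul_le_mul_of_nonneg_right (hw k x y) (abs_nonneg _)
      _ = L * (|sc ψ k (x - y)| * (1 + ((2:ℝ) ^ k)⁻¹ * ‖x - y‖)) := by ring
      _ ≤ L * (A * rho (2 ^ k) (x - y)) := 
          mul_le_mul_of_nonneg_left (h.size k _) hL.le
      _ ≤ _ := by
          have : 0 ≤ A * L * rho (2 ^ k) (x - y) := by positivity
          nlinarith
  · unfold kS
    have ht := two_pos k
    rw [← mul_sub, abs_mul, abs_of_pos (inv_pos.2 hAL), inv_mul_le_iff₀ hAL]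
    have r1 := rho_pos ht (x - y)
    have r2 := rho_pos ht (x - y')
    have e := h.reg k (x - y) (x - y')
    rw [show x - y - (x - y') = -(y - y') by abel, norm_neg] at e
    calc _ = |(b x - b y) * ((2:ℝ) ^ k)⁻¹ * (sc ψ k (x - y) - sc ψ k (x - y')) +
            (b y' - b y) * ((2:ℝ) ^ k)⁻¹ * sc ψ k (x - y')| := by congr 1; ring
      _ ≤ |b x - b y| * ((2:ℝ) ^ k)⁻¹ * |sc ψ k (x - y) - sc ψ k (x - y')| +
            |b y' - b y| * ((2:ℝ) ^ k)⁻¹ * |sc ψ k (x - y')| := by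
          refine (abs_add_le _ _).trans (le_of_eq ?_)
          simp only [abs_mul, abs_of_pos (inv_pos.2 ht)]
      _ ≤ L * (1 + ((2:ℝ) ^ k)⁻¹ * ‖x - y‖) * |sc ψ k (x - y) - sc ψ k (x - y')| +
            L * ‖y - y'‖ * ((2:ℝ) ^ k)⁻¹ * (A * rho (2 ^ k) (x - y')) := by
          refine add_le_add (mul_le_mul_of_nonneg_right (hw k x y) (abs_nonneg _)) ?_
          have b1 : |b y' - b y| ≤ L * ‖y - y'‖ := by rw [norm_sub_rev]; exact hb y' y
          have b2 := h.size' k (x - y')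
          gcongr
      _ = L * (|sc ψ k (x - y) - sc ψ k (x - y')| * (1 + ((2:ℝ) ^ k)⁻¹ * ‖x - y‖)) +
            L * ‖y - y'‖ * ((2:ℝ) ^ k)⁻¹ * (A * rho (2 ^ k) (x - y')) := by ring
      _ ≤ L * (A * (((2:ℝ) ^ k)⁻¹ * ‖y - y'‖ * (rho (2 ^ k) (x - y) + rho (2 ^ k) (x - y')))) +
            L * ‖y - y'‖ * ((2:ℝ) ^ k)⁻¹ * (A * (rho (2 ^ k) (x - y) + rho (2 ^ k) (x - y'))) := by
          refine add_le_add (mul_le_mul_of_nonneg_left e hL.le) ?_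
          gcongr
          linarith
      _ = _ := by ring
  · unfold kS
    have ht := two_pos k
    rw [← mul_sub, abs_mul, abs_of_pos (inv_pos.2 hAL), inv_mul_le_iff₀ hAL]
    have r1 := rho_pos ht (x - y)
    have r2 := rho_pos ht (x' - y)
    have e := h.reg k (x - y) (x' - y)
    rw [show x - y - (x' - y) = x - x' by abel] at e
    calc _ = |(b x - b y) * ((2:ℝ) ^ k)⁻¹ * (sc ψ k (x - y) - sc ψ k (x' - y)) +
            (b x - b x') * ((2:ℝ) ^ k)⁻¹ * sc ψ k (x' - y)| := by congr 1; ring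
      _ ≤ |b x - b y| * ((2:ℝ) ^ k)⁻¹ * |sc ψ k (x - y) - sc ψ k (x' - y)| +
            |b x - b x'| * ((2:ℝ) ^ k)⁻¹ * |sc ψ k (x' - y)| := by
          refine (abs_add_le _ _).trans (le_of_eq ?_)
          simp only [abs_mul, abs_of_pos (inv_pos.2 ht)]
      _ ≤ L * (1 + ((2:ℝ) ^ k)⁻¹ * ‖x - y‖) * |sc ψ k (x - y) - sc ψ k (x' - y)| +
            L * ‖x - x'‖ * ((2:ℝ) ^ k)⁻¹ * (A * rho (2 ^ k) (x' - y)) := by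
          refine add_le_add (mul_le_mul_of_nonneg_right (hw k x y) (abs_nonneg _)) ?_
          have b1 := hb x x'
          have b2 := h.size' k (x' - y)
          gcongr
      _ = L * (|sc ψ k (x - y) - sc ψ k (x' - y)| * (1 + ((2:ℝ) ^ k)⁻¹ * ‖x - y‖)) +
            L * ‖x - x'‖ * ((2:ℝ) ^ k)⁻¹ * (A * rho (2 ^ k) (x' - y)) := by ring
      _ ≤ L * (A * (((2:ℝ) ^ k)⁻¹ * ‖x - x'‖ * (rho (2 ^ k) (x - y) + rho (2 ^ k) (x' - y)))) +
            L * ‖x - x'‖ * ((2:ℝ) ^ k)⁻¹ * (A * (rho (2 ^ k) (x - y) + rho (2 ^ k) (x' - y))) := by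
          refine add_le_add (mul_le_mul_of_nonneg_left e hL.le) ?_
          gcongr
          linarith
      _ = _ := by ring

lemma uk_kP (ψ : SchwartzMap (E n) ℝ) (A : ℝ) (k : ℤ) (x : E n) :
    uk (kP ψ A) k x = A⁻¹ * ∫ u, ψ u := by
  unfold uk kP
  rw [integral_const_mul, integral_sub_left_eq_self (sc ψ k)]
  congr 1
  unfold sc
  have ht := two_pos k
  rw [integral_const_mul, Measure.integral_comp_smul]
  simp only [finrank_euclideanSpace, Fintype.card_fin, smul_eq_mul]
  rw [← mul_assoc, inv_pow, inv_inv, abs_of_pos (by positivity), inv_mul_cancel₀ (by positivity), one_mul]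

def CP (ψ : SchwartzMap (E n) ℝ) (A : ℝ) : ℝ := 4 * (A⁻¹ * ∫ u, ψ u) ^ 2

lemma kP_K4 (ψ : SchwartzMap (E n) ℝ) (A : ℝ) : K4 (CP ψ A) (kP ψ A) := by
  intro x0 K m μ hμ
  have ht := two_pos K
  calc _ ≤ ∫⁻ x in Q K x0, ENNReal.ofReal (CP ψ A) := by
        refine lintegral_mono fun x => ?_
        simp_rw [uk_kP]
        exact W_const μ hμ _ m K
    _ = _ := by
        rw [setLIntegral_const, volume_Q, ← ENNReal.ofReal_mul (by unfold CP; positivity)]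

end JV

-- part 15
namespace JV
variable {n : ℕ}

def C10 (n : ℕ) (C4 : ℝ) : ℝ := 4 * C3 n (Cb n * I0 n) C4 + 128 * (4 ^ (n + 2) * I0 n) ^ 2

lemma C10_nonneg {C4 : ℝ} (hC4 : 0 ≤ C4) : 0 ≤ C10 n C4 := by
  have hB1 := B1_pos (n := n)
  have hI := I0_nonneg (n := n)
  have hCb := Cb_pos (n := n)
  unfold C10 C3; positivity

lemma bdd_W {s : ℤ → E n → E n → ℝ} (hs : Ker s) {C4 : ℝ} (hC4 : 0 ≤ C4) (h4 : K4 C4 s)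
    {β : E n → ℝ} (hβ : Measurable β) {a : ℝ} (ha : 0 < a) (hb : ∀ x, |β x| ≤ a) (x0 : E n) (K m : ℤ)
    {μ : ℝ} (hμ : 0 < μ) :
    ∫⁻ x in Q K x0, ENNReal.ofReal (μ ^ 2) * W μ (fun k => op (s k) β x) m K ≤
      ENNReal.ofReal (C10 n C4 * a ^ 2 * ((2:ℝ) ^ K) ^ n) := by
  have h40 := two_pos K
  have hI := I0_nonneg (n := n)
  have hB1 := B1_pos (n := n)
  have hCb := Cb_pos (n := n)
  have hC3 : 0 ≤ C3 n (Cb n * I0 n) C4 := by unfold C3; positivity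
  set B := BB K x0 with hB
  have hBm : MeasurableSet B := BB_meas K x0
  set g := B.indicator β with hg
  set r := Bᶜ.indicator β with hr
  have hgm : Measurable g := hβ.indicator hBm
  have hrm : Measurable r := hβ.indicator hBm.compl
  have hga : ∀ x, |g x| ≤ a := fun x => by
    rw [hg]; by_cases h : x ∈ B
    · rw [Set.indicator_of_mem h]; exact hb x
    · rw [Set.indicator_of_notMem h, abs_zero]; exact ha.le
  have hra : ∀ x, |r x| ≤ a := fun x => by
    rw [hr]; by_cases h : x ∈ Bᶜ
    · rw [Set.indicator_of_mem h]; exact hb x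
    · rw [Set.indicator_of_notMem h, abs_zero]; exact ha.le
  set v := ((2:ℝ) ^ K) ^ n with hv
  have hv0 : 0 < v := by positivity
  have hgp : ∀ y, |g y| ≤ a * (Cb n * v) * rho (2 ^ K) (x0 - y) := by
    intro y
    have hrp := rho_pos h40 (x0 - y)
    by_cases hy : y ∈ B
    · have := rho_ge_of_le (n := n) h40 (c := 2 * n + 2) (by positivity) hy
      rw [inv_le_iff_one_le_mul₀ (by positivity)] at this
      have h1 : 1 ≤ Cb n * v * rho (2 ^ K) (x0 - y) := by
        refine this.trans (le_of_eq ?_)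
        unfold Cb
        rw [show (2 * (n:ℝ) + 2 + 1) = 2 * n + 3 by ring]
        ring
      calc |g y| ≤ a * 1 := by rw [mul_one]; exact hga y
        _ ≤ a * (Cb n * v * rho (2 ^ K) (x0 - y)) := by gcongr
        _ = _ := by ring
    · rw [hg, Set.indicator_of_notMem hy, abs_zero]; positivity
  have ir : Integrable fun y : E n => a * (Cb n * v) * rho (2 ^ K) (x0 - y) :=
    ((integrable_rho h40).comp_sub_left x0).const_mul _
  have hgN : Nice g := ⟨hgm, ir.mono' hgm.aestronglyMeasurable (Filter.Eventually.of_forall hgp), a, hga⟩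
  have hgi : ∫ x, |g x| ≤ Cb n * I0 n * a * v := by
    calc _ ≤ ∫ y : E n, a * (Cb n * v) * rho (2 ^ K) (x0 - y) := integral_mono hgN.int.abs ir hgp
      _ = _ := by rw [integral_const_mul, integral_rho_left h40]; ring
  have hl2 : 0 < μ / 2 := by positivity
  have e1 := local_bdd hs hC4 h4 hgN ha (by positivity) hga x0 K m hgi hl2
  have hsplit : ∀ k x, op (s k) β x = op (s k) g x + op (s k) r x := by
    intro k x
    unfold op
    rw [← integral_add ((hs.dom k).int_mul (two_pos k) hgm hga x) ((hs.dom k).int_mul (two_pos k) hrm hra x)]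
    congr 1; funext y
    rw [← mul_add, hg, hr, Set.indicator_self_add_compl_apply]
  set T := 4 ^ (n + 2) * I0 n * a with hT
  have htail : ∀ k ≤ K, ∀ x ∈ Q K x0, |op (s k) r x| ≤ T * (1/2 : ℝ) ^ (K - k).natAbs := by
    intro k hk x hx
    have ik : Integrable fun y : E n => a * (4 ^ (n + 2) * (1/2 : ℝ) ^ (K - k).natAbs) * rho (2 ^ K) (x0 - y) :=
      ((integrable_rho h40).comp_sub_left x0).const_mul _
    have := norm_integral_le_of_norm_le ik (f := fun y => s k x y * r y)
      (Filter.Eventually.of_forall fun y => by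
        rw [norm_mul, Real.norm_eq_abs, Real.norm_eq_abs]
        by_cases hy : y ∈ B
        · rw [hr, Set.indicator_of_notMem (by simpa using hy), abs_zero, mul_zero]
          have := rho_pos h40 (x0 - y)
          positivity
        · calc _ ≤ rho (2 ^ k) (x - y) * a :=
                mul_le_mul (hs.size k x y) (hra y) (abs_nonneg _) (rho_pos (two_pos k) _).le
            _ ≤ 4 ^ (n + 2) * (1/2 : ℝ) ^ (K - k).natAbs * rho (2 ^ K) (x0 - y) * a :=
                mul_le_mul_of_nonneg_right (rho_tail hk hx hy) ha.le
            _ = _ := by ring)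
    rw [integral_const_mul, integral_rho_left h40] at this
    refine this.trans (le_of_eq ?_)
    rw [hT]; ring
  have e2 : ∀ x ∈ Q K x0, ENNReal.ofReal ((μ / 2) ^ 2) * W (μ / 2) (fun k => op (s k) r x) m K ≤
      ENNReal.ofReal (32 * T ^ 2) := by
    intro x hx
    refine (W_sq hl2 _ m K).trans ?_
    rw [← ENNReal.ofReal_sum_of_nonneg fun k _ => by positivity]
    apply ENNReal.ofReal_le_ofReal
    calc _ ≤ ∑ k ∈ Finset.Icc m K, 8 * T ^ 2 * (1/2 : ℝ) ^ (K - k).natAbs := by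
          refine Finset.sum_le_sum fun k hk => ?_
          have h1 := htail k (Finset.mem_Icc.1 hk).2 x hx
          have h2 : (op (s k) r x) ^ 2 ≤ (T * (1/2 : ℝ) ^ (K - k).natAbs) ^ 2 := by
            rw [← sq_abs (op (s k) r x)]; gcongr
          have h3 : ((1/2 : ℝ) ^ (K - k).natAbs) ^ 2 ≤ (1/2 : ℝ) ^ (K - k).natAbs := by
            rw [sq]
            exact mul_le_of_le_one_right (by positivity) (pow_le_one₀ (by norm_num) (by norm_num))
          rw [mul_pow] at h2
          have h5 := mul_le_mul_of_nonneg_left h3 (sq_nonneg T)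
          linarith
      _ ≤ 8 * T ^ 2 * (2 * (1 - 1/2)⁻¹) := by
          rw [← Finset.mul_sum]
          have := geo (θ := 1/2) (by norm_num) (by norm_num) (Finset.Icc m K) K
          gcongr
      _ = _ := by ring
  have e4 : ENNReal.ofReal (μ ^ 2) = 4 * ENNReal.ofReal ((μ / 2) ^ 2) := by
    rw [show μ ^ 2 = 4 * (μ / 2) ^ 2 by ring, ENNReal.ofReal_mul (p := 4) (by norm_num), ENNReal.ofReal_ofNat]
  calc _ ≤ ∫⁻ x in Q K x0, (4 * (ENNReal.ofReal ((μ / 2) ^ 2) * W (μ / 2) (fun k => op (s k) g x) m K) +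
        4 * ENNReal.ofReal (32 * T ^ 2)) := by
        refine setLIntegral_mono' (measurableSet_Q K x0) fun x hx => ?_
        simp_rw [hsplit]
        refine (mul_le_mul' le_rfl (W_add _ _ _ _ _)).trans ?_
        rw [e4, mul_assoc, ← mul_add, mul_add (ENNReal.ofReal ((μ / 2) ^ 2))]
        exact mul_le_mul' le_rfl (add_le_add le_rfl (e2 x hx))
    _ = 4 * (∫⁻ x in Q K x0, ENNReal.ofReal ((μ / 2) ^ 2) * W (μ / 2) (fun k => op (s k) g x) m K) +
        4 * ENNReal.ofReal (32 * T ^ 2) * ENNReal.ofReal v := by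
        rw [lintegral_add_right _ measurable_const, lintegral_const_mul' _ _ (by norm_num), setLIntegral_const,
          volume_Q]
    _ ≤ 4 * ENNReal.ofReal (C3 n (Cb n * I0 n) C4 * a ^ 2 * v) +
        4 * ENNReal.ofReal (32 * T ^ 2) * ENNReal.ofReal v :=
        add_le_add (mul_le_mul' le_rfl e1) le_rfl
    _ = _ := by
        rw [← ENNReal.ofReal_ofNat 4, ← ENNReal.ofReal_mul (by norm_num), ← ENNReal.ofReal_mul (by norm_num),
          ← ENNReal.ofReal_mul (by positivity), ← ENNReal.ofReal_add (by positivity) (by positivity)]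
        congr 1
        rw [hT, C10]; ring

open Filter Topology in
/-- Integration by parts -/
lemma ibp {φ : SchwartzMap (E n) ℝ} {A : ℝ} (hA : ScB φ A) {b : E n → ℝ} {L : ℝ≥0}
    (hb : LipschitzWith L b) (e : E n) (he : ‖e‖ = 1) (k : ℤ) (x : E n) :
    ∫ y, lineDeriv ℝ b y e * sc φ k (x - y) =
      ∫ y, ((2:ℝ) ^ k)⁻¹ * sc (LineDeriv.lineDerivOp e φ) k (x - y) * (b y - b x) := by
  set τ := (2:ℝ) ^ k with hτ
  have ht0 : 0 < τ := two_pos k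
  set f : E n → ℝ := fun y => b y - b x with hf
  set g : E n → ℝ := fun y => sc φ k (x - y) with hg
  have hfl : LipschitzWith L f := by
    refine LipschitzWith.of_dist_le_mul fun y z => ?_
    simp only [hf, dist_sub_right]
    exact hb.dist_le_mul y z
  have hgc : Continuous g := (sc_cont φ k).comp (continuous_const.sub continuous_id)
  have hApos := hA.pos
  have hfL : ∀ y, |f y| ≤ L * ‖x - y‖ := fun y => by
    have := hb.dist_le_mul y x
    rwa [Real.dist_eq, dist_eq_norm, norm_sub_rev] at this
  have ir : ∀ c : ℝ, Integrable fun y : E n => c * rho τ (x - y) := fun c =>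
    ((integrable_rho ht0).comp_sub_left x).const_mul _
  have hgi : Integrable g := by
    refine (ir A).mono' hgc.aestronglyMeasurable (Eventually.of_forall fun y => hA.size' k _)
  have I1 : ∀ t : ℝ, Integrable fun y => f (y + t • e) * g y := by
    intro t
    refine (ir (L * (τ + |t|) * A)).mono' ?_ (Eventually.of_forall fun y => ?_)
    · exact ((hfl.continuous.comp (continuous_add_const _)).mul hgc).aestronglyMeasurable
    · have h1 := hfL (y + t • e)
      have h2 : ‖x - (y + t • e)‖ ≤ ‖x - y‖ + |t| := by
        rw [show x - (y + t • e) = (x - y) - t • e by abel]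
        refine (norm_sub_le _ _).trans ?_
        rw [norm_smul, he, mul_one, Real.norm_eq_abs]
      have h3 := hA.size k (x - y)
      rw [← hτ] at h3
      have h5 : ‖x - y‖ + |t| ≤ (τ + |t|) * (1 + τ⁻¹ * ‖x - y‖) := by
        have : (τ + |t|) * (1 + τ⁻¹ * ‖x - y‖) = ‖x - y‖ + |t| + τ + |t| * (τ⁻¹ * ‖x - y‖) := by
          field_simp; ring
        rw [this]
        have : 0 ≤ |t| * (τ⁻¹ * ‖x - y‖) := by positivity
        linarith
      rw [norm_mul, Real.norm_eq_abs, Real.norm_eq_abs]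
      calc |f (y + t • e)| * |g y| ≤ L * ((τ + |t|) * (1 + τ⁻¹ * ‖x - y‖)) * |g y| := by
            refine mul_le_mul_of_nonneg_right (h1.trans ?_) (abs_nonneg _)
            exact mul_le_mul_of_nonneg_left (h2.trans h5) L.coe_nonneg
        _ = L * (τ + |t|) * (|g y| * (1 + τ⁻¹ * ‖x - y‖)) := by ring
        _ ≤ L * (τ + |t|) * (A * rho τ (x - y)) := mul_le_mul_of_nonneg_left h3 (by positivity)
        _ = _ := by ring
  have I0' : Integrable fun y => f y * g y := by simpa using I1 0
  have I2 : ∀ t : ℝ, Integrable fun y => f y * g (y + t • (-e)) := by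
    intro t
    have := (I1 t).comp_add_right (t • (-e))
    simpa using this
  have TA : Tendsto (fun (t : ℝ) ↦ ∫ y, (t⁻¹ • (f (y + t • e) - f y)) * g y) (𝓝[>] 0)
              (𝓝 (∫ y, lineDeriv ℝ f y e * g y)) :=
    hfl.integral_inv_smul_sub_mul_tendsto_integral_lineDeriv_mul hgi e
  have TB : Tendsto (fun (t : ℝ) ↦ ∫ y, (t⁻¹ • (g (y + t • (-e)) - g y)) * f y) (𝓝[>] 0)
              (𝓝 (∫ y, τ⁻¹ * sc (LineDeriv.lineDerivOp e φ) k (x - y) * f y)) := by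
    apply tendsto_integral_filter_of_dominated_convergence
      (fun y => (L * A * (1 + 2 ^ (n + 2))) * rho τ (x - y))
    · refine Eventually.of_forall fun t => Continuous.aestronglyMeasurable ?_
      have q1 : Continuous fun y => g (y + t • (-e)) := hgc.comp (continuous_id.add continuous_const)
      have q2 := hfl.continuous
      simp only [smul_eq_mul]
      exact (continuous_const.mul (q1.sub hgc)).mul q2
    · have : Set.Ioo (0:ℝ) τ ∈ 𝓝[>] (0:ℝ) := Ioo_mem_nhdsGT ht0
      filter_upwards [this] with t ht
      filter_upwards with y
      have e1 := hA.reg k (x - y) (x - (y + t • (-e)))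
      have e2 : x - y - (x - (y + t • (-e))) = t • (-e) := by abel
      have e3 : ‖t • (-e)‖ = t := by rw [norm_smul, norm_neg, he, mul_one, Real.norm_of_nonneg ht.1.le]
      rw [e2, e3, ← hτ] at e1
      have e4 : rho τ (x - (y + t • (-e))) ≤ 2 ^ (n + 2) * rho τ (x - y) := by
        have := rho_compare (n := n) ht0 (c := 1) (by norm_num) (h := x - (y + t • (-e))) (h' := x - y)
          (by rw [e2, e3, one_mul]; exact ht.2.le)
        rwa [show (1:ℝ) + 1 = 2 by norm_num] at this
      have e5 := hfL y
      have e6 : ‖x - y‖ ≤ τ * (1 + τ⁻¹ * ‖x - y‖) := by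
        rw [mul_add, mul_inv_cancel_left₀ ht0.ne']; linarith
      have hrp := rho_pos ht0 (x - y)
      rw [norm_mul, norm_smul, Real.norm_eq_abs, Real.norm_eq_abs, Real.norm_eq_abs, abs_of_pos (inv_pos.2 ht.1),
        abs_sub_comm]
      calc t⁻¹ * |g y - g (y + t • (-e))| * |f y| ≤
            t⁻¹ * |g y - g (y + t • (-e))| * (L * (τ * (1 + τ⁻¹ * ‖x - y‖))) := by
            have := ht.1
            exact mul_le_mul_of_nonneg_left (e5.trans (mul_le_mul_of_nonneg_left e6 L.coe_nonneg)) (by positivity)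
        _ = t⁻¹ * L * τ * (|g y - g (y + t • (-e))| * (1 + τ⁻¹ * ‖x - y‖)) := by ring
        _ ≤ t⁻¹ * L * τ * (A * (τ⁻¹ * t * (rho τ (x - y) + rho τ (x - (y + t • (-e)))))) := by
            have := ht.1
            exact mul_le_mul_of_nonneg_left e1 (by positivity)
        _ = L * A * (rho τ (x - y) + rho τ (x - (y + t • (-e)))) := by
            have := ht.1
            field_simp
        _ ≤ L * A * (rho τ (x - y) + 2 ^ (n + 2) * rho τ (x - y)) := by gcongr
        _ = _ := by ring
    · exact ir _
    · filter_upwards with y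
      refine Tendsto.mul ?_ tendsto_const_nhds
      have hd : HasDerivAt (fun t : ℝ => g (y + t • (-e)))
          (τ⁻¹ * sc (LineDeriv.lineDerivOp e φ) k (x - y)) 0 := by
        have h1 : HasDerivAt (fun t : ℝ => τ⁻¹ • (x - (y + t • (-e)))) (τ⁻¹ • e) 0 := by
          have := ((((hasDerivAt_id (0:ℝ)).smul_const (-e)).const_add y).const_sub x).const_smul τ⁻¹
          have e' : τ⁻¹ • -((1:ℝ) • -e) = τ⁻¹ • e := by simp
          rw [e'] at this
          exact this
        have h2 := (φ.differentiableAt (x := τ⁻¹ • (x - (y + (0:ℝ) • (-e))))).hasFDerivAt.comp_hasDerivAt (0:ℝ) h1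
        have h3 := h2.const_mul (τ ^ n)⁻¹
        have e' : (τ ^ n)⁻¹ * (fderiv ℝ (⇑φ) (τ⁻¹ • (x - (y + (0:ℝ) • -e)))) (τ⁻¹ • e) =
            τ⁻¹ * sc (LineDeriv.lineDerivOp e φ) k (x - y) := by
          simp only [sc, SchwartzMap.lineDerivOp_apply_eq_fderiv, map_smul, smul_eq_mul, zero_smul, add_zero]
          rw [← hτ]; ring
        rw [e'] at h3
        exact h3
      have := hd.tendsto_slope_zero_right
      simpa using this
  have S1 : ∀ (t : ℝ), ∫ y, (t⁻¹ • (f (y + t • e) - f y)) * g y =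
                            ∫ y, (t⁻¹ • (g (y + t • (-e)) - g y)) * f y := by
    intro t
    suffices S2 : ∫ y, (f (y + t • e) - f y) * g y = ∫ y, f y * (g (y + t • (-e)) - g y) by
      simp only [smul_eq_mul, mul_assoc, integral_const_mul, S2, mul_comm (f _)]
    have S3 : ∫ y, f (y + t • e) * g y = ∫ y, f y * g (y + t • (-e)) := by
      rw [← integral_add_right_eq_self _ (t • (-e))]; simp
    simp_rw [_root_.sub_mul, _root_.mul_sub]
    rw [integral_sub (I1 t) I0', integral_sub (I2 t) I0', S3]
  simp only [S1] at TA
  have := tendsto_nhds_unique TA TB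
  rw [← this]
  congr 1; funext y
  congr 1
  simp only [lineDeriv, hf, deriv_sub_const]

def CS (φ : SchwartzMap (E n) ℝ) (A0 A : ℝ) : ℝ := (A0 / (2 * A)) ^ 2 * C10 n (CP φ A0)

lemma kS_K4 {φ : SchwartzMap (E n) ℝ} {A0 A : ℝ} (hA0 : ScB φ A0) (hA : 0 < A) {b : E n → ℝ} {L : ℝ≥0}
    (hL : 0 < L) (hb : LipschitzWith L b) (e : E n) (he : ‖e‖ = 1) :
    K4 (CS φ A0 A) (kS (LineDeriv.lineDerivOp e φ) A L b) := by
  intro x0 K m μ hμ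
  have h0 := hA0.pos
  have hL' : (0:ℝ) < L := hL
  set β : E n → ℝ := fun y => - lineDeriv ℝ b y e with hβ
  have hβm : Measurable β := (measurable_lineDeriv hb.continuous).neg
  have hβb : ∀ y, |β y| ≤ L := fun y => by
    have := norm_lineDeriv_le_of_lipschitz ℝ hb (x₀ := y) (v := e)
    rw [he, mul_one] at this
    rw [hβ, abs_neg]; exact this
  set c := (2 * A * L)⁻¹ * A0 with hc
  have hc0 : 0 < c := by positivity
  have hu : ∀ k x, uk (kS (LineDeriv.lineDerivOp e φ) A L b) k x = c * op (kP φ A0 k) β x := by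
    intro k x
    have := ibp hA0 hb e he k x
    unfold uk kS op kP
    rw [integral_const_mul, hc, mul_assoc ((2 * A * (L:ℝ))⁻¹) A0]
    refine congrArg _ ?_
    rw [← integral_const_mul]
    calc _ = -∫ y, ((2:ℝ) ^ k)⁻¹ * sc (LineDeriv.lineDerivOp e φ) k (x - y) * (b y - b x) := by
          rw [← integral_neg]; congr 1; funext y; ring
      _ = _ := by
          rw [← this, ← integral_neg]; congr 1; funext y
          rw [hβ]; field_simp
  have hCP : 0 ≤ CP φ A0 := by unfold CP; positivity
  have main := bdd_W (kP_ker hA0) hCP (kP_K4 φ A0) hβm hL' hβb x0 K m (μ := μ / c) (by positivity)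
  calc _ = ∫⁻ x in Q K x0, ENNReal.ofReal (c ^ 2) *
        (ENNReal.ofReal ((μ / c) ^ 2) * W (μ / c) (fun k => op (kP φ A0 k) β x) m K) := by
        refine lintegral_congr fun x => ?_
        rw [← resc hc0]
        simp_rw [hu]
        rw [← W_smul_le (lam := μ / c) hc0, div_mul_cancel₀ _ hc0.ne']
    _ ≤ ENNReal.ofReal (c ^ 2) * ENNReal.ofReal (C10 n (CP φ A0) * L ^ 2 * ((2:ℝ) ^ K) ^ n) := by
        rw [lintegral_const_mul' _ _ ofReal_ne_top]
        exact mul_le_mul' le_rfl main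
    _ = _ := by
        rw [← ENNReal.ofReal_mul (by positivity), CS, hc]
        congr 1
        field_simp

lemma CS_nonneg {φ : SchwartzMap (E n) ℝ} {A0 A : ℝ} : 0 ≤ CS φ A0 A := by
  unfold CS
  have := C10_nonneg (n := n) (C4 := CP φ A0) (by unfold CP; positivity)
  positivity

end JV

-- part 16
namespace JV
variable {n : ℕ}

lemma sconv_sc (φ : SchwartzMap (E n) ℝ) (k : ℤ) (g : E n → ℝ) (x : E n) :
    schwartzConv n φ k g x = ∫ y, sc φ k (x - y) * g y := by
  unfold schwartzConv sc
  congr 1; funext y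
  rw [zpow_neg, zpow_neg, zpow_mul, zpow_natCast]

lemma sconv_op {φ : SchwartzMap (E n) ℝ} {A : ℝ} (hA : 0 < A) (k : ℤ) (g : E n → ℝ) (x : E n) :
    schwartzConv n φ k g x = A * op (kP φ A k) g x := by
  rw [sconv_sc]
  unfold op kP
  rw [← integral_const_mul]
  congr 1; funext y
  field_simp

lemma fderiv_bdd (φ : SchwartzMap (E n) ℝ) : ∃ C : ℝ, 0 ≤ C ∧ ∀ x, ‖fderiv ℝ φ x‖ ≤ C := by
  obtain ⟨C, hC, h⟩ := φ.decay 0 1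
  refine ⟨C, hC.le, fun x => ?_⟩
  have := h x
  rw [pow_zero, one_mul, norm_iteratedFDeriv_one] at this
  exact this

lemma sc_mul_int (φ : SchwartzMap (E n) ℝ) (k : ℤ) {g : E n → ℝ} (hg : Integrable g) (x : E n) :
    Integrable (fun y => sc φ k (x - y) * g y) := by
  have hp := two_pos k
  obtain ⟨M, hM⟩ : ∃ M, ∀ z, ‖φ z‖ ≤ M := by
    obtain ⟨M, _, h⟩ := φ.decay 0 0
    exact ⟨M, fun z => by simpa using h z⟩
  have hm : AEStronglyMeasurable (fun y => sc φ k (x - y) * g y) volume :=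
    (((sc_cont φ k).comp (continuous_const.sub continuous_id)).aestronglyMeasurable).mul hg.1
  refine (hg.abs.const_mul ((((2:ℝ) ^ k) ^ n)⁻¹ * M)).mono' hm (Filter.Eventually.of_forall fun y => ?_)
  rw [norm_mul, sc, norm_mul, Real.norm_of_nonneg (by positivity : 0 ≤ (((2:ℝ) ^ k) ^ n)⁻¹), Real.norm_eq_abs (g y)]
  exact mul_le_mul_of_nonneg_right (mul_le_mul_of_nonneg_left (hM _) (by positivity)) (abs_nonneg _)

lemma sconv_hasFDerivAt (φ : SchwartzMap (E n) ℝ) (k : ℤ) {g : E n → ℝ} (hg : Integrable g) (x : E n) :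
    ∃ D : E n →L[ℝ] ℝ, HasFDerivAt (schwartzConv n φ k g) D x ∧
      ∀ e, D e = ∫ y, ((2:ℝ) ^ k)⁻¹ * sc (LineDeriv.lineDerivOp e φ) k (x - y) * g y := by
  obtain ⟨C, hC, hb⟩ := fderiv_bdd φ
  set τ : ℝ := 2 ^ k with hτ
  have ht0 : 0 < τ := two_pos k
  set F' : E n → E n → (E n →L[ℝ] ℝ) := fun z y => (g y * (τ ^ n)⁻¹ * τ⁻¹) • fderiv ℝ φ (τ⁻¹ • (z - y)) with hF'
  have hsm : ∀ z, AEStronglyMeasurable (fun y => sc φ k (z - y) * g y) volume := fun z =>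
    (((sc_cont φ k).comp (continuous_const.sub continuous_id)).aestronglyMeasurable).mul hg.1
  have hfd : Continuous (fderiv ℝ φ) := (φ.smooth 1).continuous_fderiv (by simp)
  have hF'm : ∀ z, AEStronglyMeasurable (F' z) volume := fun z => by
    refine AEStronglyMeasurable.smul ((hg.1.mul_const _).mul_const _) (Continuous.aestronglyMeasurable ?_)
    have : Continuous fun y : E n => τ⁻¹ • (z - y) := by fun_prop
    exact hfd.comp this
  have hbd : ∀ z y, ‖F' z y‖ ≤ ((τ ^ n)⁻¹ * τ⁻¹ * C) * |g y| := fun z y => by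
    rw [hF', norm_smul, norm_mul, norm_mul, Real.norm_eq_abs, Real.norm_of_nonneg (by positivity),
      Real.norm_of_nonneg (by positivity)]
    calc _ ≤ |g y| * (τ ^ n)⁻¹ * τ⁻¹ * C := mul_le_mul_of_nonneg_left (hb _) (by positivity)
      _ = _ := by ring
  have hbi : Integrable (fun y => ((τ ^ n)⁻¹ * τ⁻¹ * C) * |g y|) := hg.abs.const_mul _
  have hinteg : ∀ z, Integrable (F' z) := fun z => hbi.mono' (hF'm z) (Filter.Eventually.of_forall (hbd z))
  have hFi := sc_mul_int φ k hg x
  refine ⟨∫ y, F' x y, ?_, fun e => ?_⟩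
  · have : schwartzConv n φ k g = fun z => ∫ y, sc φ k (z - y) * g y := funext (sconv_sc φ k g)
    rw [this]
    refine hasFDerivAt_integral_of_dominated_of_fderiv_le (s := Set.univ) (F' := F') Filter.univ_mem
      (Filter.Eventually.of_forall hsm) hFi (hF'm x) (Filter.Eventually.of_forall fun y z _ => hbd z y) hbi
      (Filter.Eventually.of_forall fun y z _ => ?_)
    have h1 : HasFDerivAt (fun z : E n => τ⁻¹ • (z - y)) (τ⁻¹ • ContinuousLinearMap.id ℝ (E n)) z :=
      ((hasFDerivAt_id z).sub_const y).const_smul τ⁻¹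
    have h2 := ((φ.differentiableAt (x := τ⁻¹ • (z - y))).hasFDerivAt.comp z h1).const_mul (τ ^ n)⁻¹
    have h3 := h2.mul_const (g y)
    have e' : F' z y = g y • (τ ^ n)⁻¹ • (fderiv ℝ (⇑φ) (τ⁻¹ • (z - y))).comp
        (τ⁻¹ • ContinuousLinearMap.id ℝ (E n)) := by
      ext v
      simp [hF']; ring
    rw [e']
    exact h3
  · rw [ContinuousLinearMap.integral_apply (hinteg x)]
    congr 1; funext y
    simp only [hF', sc, SchwartzMap.lineDerivOp_apply_eq_fderiv, ContinuousLinearMap.smul_apply, smul_eq_mul]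
    rw [← hτ]; ring

lemma grad_coord (h : E n → ℝ) (x : E n) (i : Fin n) :
    gradient h x i = fderiv ℝ h x (EuclideanSpace.single i 1) := by
  have : inner ℝ (gradient h x) (EuclideanSpace.single i 1) = fderiv ℝ h x (EuclideanSpace.single i 1) := by
    unfold gradient
    rw [InnerProductSpace.toDual_symm_apply]
  rw [← this, EuclideanSpace.inner_single_right]
  simp

lemma grad_comm (φ : SchwartzMap (E n) ℝ) (k : ℤ) {b f : E n → ℝ} (hf : Integrable f)
    (hbf : Integrable (fun y => b y * f y)) {x : E n} (hx : DifferentiableAt ℝ b x) (i : Fin n)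
    {A0 A L : ℝ} (hA0 : 0 < A0) (hA : 0 < A) (hL : 0 < L) :
    gradient (fun z => b z * schwartzConv n φ k f z -
                schwartzConv n φ k (fun y => b y * f y) z) x i =
      (fderiv ℝ b x (EuclideanSpace.single i 1)) * (A0 * op (kP φ A0 k) f x) +
      (2 * A * L) * op (kS (LineDeriv.lineDerivOp (EuclideanSpace.single i 1 : E n) φ) A L b k) f x := by
  set e : E n := EuclideanSpace.single i 1 with he
  rw [grad_coord, ← he]
  obtain ⟨D1, h1, h1e⟩ := sconv_hasFDerivAt φ k hf x
  obtain ⟨D2, h2, h2e⟩ := sconv_hasFDerivAt φ k hbf x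
  have h3 := (hx.hasFDerivAt.mul h1).sub h2
  have h4 : fderiv ℝ (fun z => b z * schwartzConv n φ k f z -
                schwartzConv n φ k (fun y => b y * f y) z) x = _ := h3.fderiv
  rw [h4]
  simp only [ContinuousLinearMap.sub_apply, ContinuousLinearMap.add_apply, ContinuousLinearMap.smul_apply, smul_eq_mul]
  rw [h1e, h2e, ← sconv_op hA0]
  have : (2 * A * L) * op (kS (LineDeriv.lineDerivOp e φ) A L b k) f x =
      b x * (∫ y, ((2:ℝ) ^ k)⁻¹ * sc (LineDeriv.lineDerivOp e φ) k (x - y) * f y) -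
      ∫ y, ((2:ℝ) ^ k)⁻¹ * sc (LineDeriv.lineDerivOp e φ) k (x - y) * (b y * f y) := by
    unfold op kS
    rw [← integral_const_mul, ← integral_const_mul, ← integral_sub]
    · congr 1; funext y
      field_simp
    · simp only [mul_assoc]
      exact ((sc_mul_int _ k hf x).const_mul _).const_mul _
    · simp only [mul_assoc]
      exact (sc_mul_int _ k hbf x).const_mul _
  rw [this]; ring

end JV

-- part 17
namespace JV
variable {n : ℕ}

lemma chain_list (D : ℤ → ℤ → Prop) : ∀ (N : ℕ) (t : Fin (N + 1) → ℤ), StrictMono t →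
    (∀ k : Fin N, D (t k.succ) (t k.castSucc)) →
    ∃ l : List ℤ, (t (Fin.last N) :: l).Pairwise (· > ·) ∧ (∀ a ∈ l, a ∈ Set.range t) ∧
      (N : ℝ≥0∞) ≤ jr D (D (t (Fin.last N))) l := by
  intro N
  induction N with
  | zero => intro t _ _; exact ⟨[], by simp, by simp, by simp⟩
  | succ N ih =>
    intro t ht hD
    obtain ⟨l, h1, h2, h3⟩ := ih (fun k => t k.castSucc) (fun a b h => ht (Fin.castSucc_lt_castSucc_iff.2 h))
      (fun k => by have := hD k.castSucc; rwa [Fin.succ_castSucc] at this)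
    have hlt : t (Fin.last N).castSucc < t (Fin.last (N + 1)) := ht (Fin.castSucc_lt_last _)
    refine ⟨t (Fin.last N).castSucc :: l, ?_, ?_, ?_⟩
    · rw [List.pairwise_cons]
      refine ⟨fun a ha => ?_, h1⟩
      rw [List.mem_cons] at ha
      rcases ha with rfl | ha
      · exact hlt
      · exact lt_trans ((List.pairwise_cons.1 h1).1 a ha) hlt
    · intro a ha
      rw [List.mem_cons] at ha
      rcases ha with rfl | ha
      · exact ⟨_, rfl⟩
      · obtain ⟨k, hk⟩ := h2 a ha
        exact ⟨_, hk⟩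
    · rw [jr, ind_true (by have := hD (Fin.last N); rwa [Fin.succ_last] at this)]
      push_cast
      rw [add_comm]
      exact add_le_add le_rfl h3

lemma jump_le_WD {α V : Type*} [NormedAddCommGroup V] (F : ℤ → α → V) (lam : ℝ) (x : α) :
    jumpCountE F lam x ≤ ⨆ M : ℕ, WD (fun a b => lam < ‖F a x - F b x‖) (fun _ => False) (-(M:ℤ)) M := by
  refine iSup₂_le fun N hN => ?_
  obtain ⟨t, ht, hj⟩ := hN
  obtain ⟨l, h1, h2, h3⟩ := chain_list (fun a b => lam < ‖F a x - F b x‖) N t ht hj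
  obtain ⟨M, hM⟩ : ∃ M : ℕ, ∀ i, |t i| ≤ M := by
    refine ⟨∑ i, (t i).natAbs, fun i => ?_⟩
    rw [Int.abs_eq_natAbs]
    exact_mod_cast Finset.single_le_sum (f := fun i => (t i).natAbs) (fun _ _ => Nat.zero_le _) (Finset.mem_univ i)
  refine le_trans ?_ (le_iSup (fun M : ℕ => WD (fun a b => lam < ‖F a x - F b x‖) (fun _ => False) (-(M:ℤ)) M) M)
  refine le_trans ?_ (le_WD (l := t (Fin.last N) :: l) ⟨h1, fun a ha => ?_⟩)
  · rw [jr]; exact h3.trans le_add_self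
  · rw [List.mem_cons] at ha
    rw [← abs_le]
    rcases ha with rfl | ha
    · exact hM _
    · obtain ⟨k, rfl⟩ := h2 a ha
      exact hM _

lemma W_le_smul {lam c β : ℝ} (hc : 0 < c) (hβ : |β| ≤ c) (F : ℤ → ℝ) (m K : ℤ) :
    W lam (fun k => β * F k) m K ≤ W (lam / c) F m K := by
  have := WD_dom (Finset.univ : Finset Unit) (D := JD lam (fun k => β * F k)) (p := JP lam (fun k => β * F k))
    (D' := fun _ => JD (lam / c) F) (p' := fun _ => JP (lam / c) F)
    (fun a b h => ⟨(), Finset.mem_univ _, by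
      unfold JD at h ⊢
      rw [div_lt_iff₀ hc]
      rw [← mul_sub, abs_mul] at h
      refine h.trans_le ?_
      rw [mul_comm]; exact mul_le_mul_of_nonneg_left hβ (abs_nonneg _)⟩)
    (fun a h => ⟨(), Finset.mem_univ _, by
      unfold JP at h ⊢
      rw [div_right_comm, div_lt_iff₀ hc]
      rw [abs_mul] at h
      refine h.trans_le ?_
      rw [mul_comm]; exact mul_le_mul_of_nonneg_left hβ (abs_nonneg _)⟩) m K
  simpa [W] using this

lemma WD_vec (hn : 1 ≤ n) {lam : ℝ} (v : ℤ → E n) (m K : ℤ) :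
    WD (fun a b => lam < ‖v a - v b‖) (fun _ => False) m K ≤ ∑ i, W (lam / n) (fun k => v k i) m K := by
  refine WD_dom Finset.univ ?_ (fun a h => h.elim) m K
  intro a b h
  by_contra! hh
  have h1 := h.trans_le (norm_le_sum (v a - v b))
  have hn' : (0:ℝ) < n := by exact_mod_cast hn
  have h2 : ∑ i, |(v a - v b) i| ≤ ∑ _i : Fin n, lam / n := by
    refine Finset.sum_le_sum fun i _ => ?_
    have := hh i (Finset.mem_univ i)
    unfold JD at this
    push Not at this
    exact this
  rw [Finset.sum_const, Finset.card_univ, Fintype.card_fin, nsmul_eq_mul, mul_div_cancel₀ _ hn'.ne'] at h2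
  linarith

/-- One-component bound -/
lemma W_comp {lam a c A0 L β : ℝ} (hA0 : 0 < A0) (hL : 0 < L) (ha : 0 < a) (hβ : |β| ≤ L) (P S : ℤ → ℝ) (m K : ℤ)
    (hc : c = lam / 2) :
    W lam (fun k => β * (A0 * P k) + a * S k) m K ≤ W (c / (L * A0)) P m K + W (c / a) S m K := by
  refine (W_add lam _ _ m K).trans (add_le_add ?_ ?_)
  · have h := W_le_smul (lam := lam / 2) (c := L * A0) (β := β * A0) (by positivity)
      (by rw [abs_mul, abs_of_pos hA0]; exact mul_le_mul_of_nonneg_right hβ hA0.le) P m K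
    simp only [mul_assoc] at h
    rw [hc]; exact h
  · rw [hc]
    exact W_le_smul ha (abs_of_pos ha).le S m K

lemma sum_rpow_le {ι : Type*} (s : Finset ι) (X : ι → ℝ≥0∞) {q : ℝ} (hq : 0 < q) :
    (∑ i ∈ s, X i) ^ q ≤ (s.card : ℝ≥0∞) ^ q * ∑ i ∈ s, X i ^ q := by
  rcases s.eq_empty_or_nonempty with rfl | hs
  · simp [hq]
  obtain ⟨j, hj, hmax⟩ := Finset.exists_max_image s X hs
  calc (∑ i ∈ s, X i) ^ q ≤ ((s.card : ℝ≥0∞) * X j) ^ q := by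
        refine ENNReal.rpow_le_rpow ?_ hq.le
        have := Finset.sum_le_card_nsmul s X (X j) hmax
        rwa [nsmul_eq_mul] at this
    _ = (s.card : ℝ≥0∞) ^ q * X j ^ q := ENNReal.mul_rpow_of_nonneg _ _ hq.le
    _ ≤ _ := mul_le_mul' le_rfl (Finset.single_le_sum (f := fun i => X i ^ q) (fun _ _ => zero_le) hj)

lemma add_rpow_le' (X Y : ℝ≥0∞) {q : ℝ} (hq : 0 < q) : (X + Y) ^ q ≤ 2 ^ q * (X ^ q + Y ^ q) := by
  have := sum_rpow_le (Finset.univ : Finset Bool) (fun b => if b then X else Y) hq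
  simpa using this

end JV

-- part 18
namespace JV
variable {n : ℕ}

/-- one-window estimate in rescaled form -/
lemma resc_int (hn : 1 ≤ n) {s : ℤ → E n → E n → ℝ} (hs : Ker s) {C4 : ℝ} (hC4 : 0 ≤ C4) (h4 : K4 C4 s)
    {f : E n → ℝ} (hf : Nice f) {p : ℝ} (hp : 1 < p) (M : ℕ) (hpos : ∀ k x, 0 < po k f x)
    {lam L c : ℝ} (hl : 0 < lam) (hL : 0 < L) (hc : 0 < c) :
    ∫⁻ x, (ENNReal.ofReal (lam ^ 2) * W (lam / (c * L)) (fun k => op (s k) f x) (-(M:ℤ)) M) ^ (p / 2) ≤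
      ENNReal.ofReal L ^ p * (ENNReal.ofReal c ^ p * (C9 n p C4 * CM n p)) * ∫⁻ x, ‖f x‖ₑ ^ p := by
  have key := Zs_final hn hs hC4 h4 hf hp (m := -(M:ℤ)) (K := M) (by omega) hpos
    (lam := lam / (c * L)) (by positivity)
  have hcL : 0 < c * L := by positivity
  have e : ∀ x, (ENNReal.ofReal (lam ^ 2) * W (lam / (c * L)) (fun k => op (s k) f x) (-(M:ℤ)) M) ^ (p / 2) =
      (ENNReal.ofReal L ^ p * ENNReal.ofReal c ^ p) * Zs s f (lam / (c * L)) (-(M:ℤ)) M x ^ p := by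
    intro x
    rw [resc hcL, ENNReal.mul_rpow_of_nonneg _ _ (by linarith), Zs, ← ENNReal.rpow_mul,
      ENNReal.ofReal_pow hcL.le, ← ENNReal.rpow_natCast, ← ENNReal.rpow_mul, mul_comm c L, ENNReal.ofReal_mul hL.le,
      ← ENNReal.mul_rpow_of_nonneg _ _ (by linarith)]
    congr 2
    · push_cast; ring
    · ring
  simp_rw [e]
  have hne : ENNReal.ofReal L ^ p * ENNReal.ofReal c ^ p ≠ ∞ :=
    ENNReal.mul_ne_top (ENNReal.rpow_ne_top_of_nonneg (by linarith) ofReal_ne_top)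
      (ENNReal.rpow_ne_top_of_nonneg (by linarith) ofReal_ne_top)
  rw [lintegral_const_mul' _ _ hne]
  refine (mul_le_mul' le_rfl key).trans (le_of_eq ?_)
  ring

/-- Final constant -/
def CF (n : ℕ) (p : ℝ) (φ : SchwartzMap (E n) ℝ) (A0 : ℝ) (A : Fin n → ℝ) : ℝ≥0∞ :=
  (n : ℝ≥0∞) ^ (p / 2) * ∑ i : Fin n, 2 ^ (p / 2) *
    (ENNReal.ofReal (2 * n * A0) ^ p * (C9 n p (CP φ A0) * CM n p) +
      ENNReal.ofReal (4 * n * A i) ^ p * (C9 n p (CS φ A0 (A i)) * CM n p))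

lemma CF_ne_top {p : ℝ} (hp : 1 < p) (φ : SchwartzMap (E n) ℝ) (A0 : ℝ) (A : Fin n → ℝ) : CF n p φ A0 A ≠ ∞ := by
  unfold CF
  refine ENNReal.mul_ne_top (ENNReal.rpow_ne_top_of_nonneg (by linarith) (ENNReal.natCast_ne_top n)) ?_
  refine ENNReal.sum_ne_top.2 fun i _ => ?_
  have h : ∀ c C4, ENNReal.ofReal c ^ p * (C9 n p C4 * CM n p) ≠ ∞ := fun c C4 =>
    ENNReal.mul_ne_top (ENNReal.rpow_ne_top_of_nonneg (by linarith) ofReal_ne_top)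
      (ENNReal.mul_ne_top (C9_ne_top hp) CM_ne_top)
  exact ENNReal.mul_ne_top (ENNReal.rpow_ne_top_of_nonneg (by linarith) (by simp))
    (ENNReal.add_ne_top.2 ⟨h _ _, h _ _⟩)

lemma main_est (hn : 1 ≤ n) {p : ℝ} (hp : 1 < p) {φ : SchwartzMap (E n) ℝ} {A0 : ℝ} {A : Fin n → ℝ}
    (hA0 : ScB φ A0)
    (hA : ∀ i, ScB (LineDeriv.lineDerivOp (EuclideanSpace.single i 1 : E n) φ) (A i))
    {b : E n → ℝ} {L : ℝ≥0} (hL : 0 < L) (hb : LipschitzWith L b) {f : E n → ℝ} (hfc : Continuous f)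
    (hfs : HasCompactSupport f) (hf0 : f ≠ 0) {lam : ℝ} (hl : 0 < lam) :
    ∫⁻ x, (ENNReal.ofReal lam *
          (jumpCountE (fun (k : ℤ) x =>
              gradient (fun z => b z * schwartzConv n φ k f z -
                schwartzConv n φ k (fun y => b y * f y) z) x) lam x)
            ^ ((1:ℝ)/2)) ^ p ≤
      ENNReal.ofReal L ^ p * CF n p φ A0 A * ∫⁻ x, ‖f x‖ₑ ^ p := by
  have hL' : (0:ℝ) < L := hL
  have hn' : (0:ℝ) < n := by exact_mod_cast hn
  have hq : 0 < p / 2 := by linarith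
  have h0 := hA0.pos
  have hfi : Integrable f := hfc.integrable_of_hasCompactSupport hfs
  have hNice : Nice f := ⟨hfc.measurable, hfi, by
    obtain ⟨M, hM⟩ := hfs.exists_bound_of_continuous hfc
    exact ⟨M, hM⟩⟩
  have hbf : Integrable (fun y => b y * f y) :=
    (hb.continuous.mul hfc).integrable_of_hasCompactSupport hfs.mul_left
  have hpos : ∀ k x, 0 < po k f x := by
    intro k x
    have hr := fun y => rho_pos (two_pos k) (x - y)
    unfold po
    rw [integral_pos_iff_support_of_nonneg (fun y => mul_nonneg (hr y).le (abs_nonneg _)) (po_int k hNice x)]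
    have : (Function.support fun y => rho (2 ^ k) (x - y) * |f y|) = Function.support f := by
      ext y
      simp [(hr y).ne']
    rw [this]
    exact hfc.isOpen_support.measure_pos _ (Function.support_nonempty_iff.2 hf0)
  set e : Fin n → E n := fun i => EuclideanSpace.single i 1 with he
  have hen : ∀ i, ‖e i‖ = 1 := fun i => by simp [he]
  have hb' : ∀ x y, |b x - b y| ≤ L * ‖x - y‖ := fun x y => by
    have := hb.norm_sub_le x y
    rwa [Real.norm_eq_abs] at this
  have kerS : ∀ i, Ker (kS (LineDeriv.lineDerivOp (e i) φ) (A i) L b) := fun i =>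
    kS_ker (hA i) hL' hb.continuous.measurable hb'
  set T1 : Fin n → ℕ → E n → ℝ≥0∞ := fun _ M x =>
    ENNReal.ofReal (lam ^ 2) * W (lam / (2 * n * A0 * L)) (fun k => op (kP φ A0 k) f x) (-(M:ℤ)) M with hT1
  set T2 : Fin n → ℕ → E n → ℝ≥0∞ := fun i M x =>
    ENNReal.ofReal (lam ^ 2) * W (lam / (4 * n * A i * L))
      (fun k => op (kS (LineDeriv.lineDerivOp (e i) φ) (A i) L b k) f x) (-(M:ℤ)) M with hT2
  have mT1 : ∀ i M, Measurable (T1 i M) := fun i M =>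
    (measurable_W (F := fun k x => op (kP φ A0 k) f x)
      (fun k => measurable_op ((kP_ker hA0).dom k) hNice.meas) _ _ _).const_mul _
  have mT2 : ∀ i M, Measurable (T2 i M) := fun i M =>
    (measurable_W (F := fun k x => op (kS (LineDeriv.lineDerivOp (e i) φ) (A i) L b k) f x)
      (fun k => measurable_op ((kerS i).dom k) hNice.meas) _ _ _).const_mul _
  set G : ℕ → E n → ℝ≥0∞ := fun M x => (∑ i, (T1 i M x + T2 i M x)) ^ (p / 2) with hG
  have mG : ∀ M, Measurable (G M) := fun M =>
    (Finset.measurable_sum _ fun i _ => (mT1 i M).add (mT2 i M)).pow_const _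
  have monG : Monotone G := by
    intro M M' h x
    refine ENNReal.rpow_le_rpow (Finset.sum_le_sum fun i _ => add_le_add ?_ ?_) hq.le
    · exact mul_le_mul' le_rfl (W_mono (by omega) (by omega))
    · exact mul_le_mul' le_rfl (W_mono (by omega) (by omega))
  have hpt : ∀ᵐ x, (ENNReal.ofReal lam *
          (jumpCountE (fun (k : ℤ) x =>
              gradient (fun z => b z * schwartzConv n φ k f z -
                schwartzConv n φ k (fun y => b y * f y) z) x) lam x)
            ^ ((1:ℝ)/2)) ^ p ≤ ⨆ M, G M x := by
    filter_upwards [hb.ae_differentiableAt] with x hx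
    set v : ℤ → E n := fun k => gradient (fun z => b z * schwartzConv n φ k f z -
                schwartzConv n φ k (fun y => b y * f y) z) x with hv
    have hβ : ∀ i, |fderiv ℝ b x (e i)| ≤ L := fun i => by
      have := (fderiv ℝ b x).le_opNorm (e i)
      rw [hen, mul_one, Real.norm_eq_abs] at this
      exact this.trans (norm_fderiv_le_of_lipschitz ℝ hb)
    have hwin : ∀ M : ℕ, ENNReal.ofReal (lam ^ 2) *
        WD (fun a b => lam < ‖v a - v b‖) (fun _ => False) (-(M:ℤ)) M ≤ ∑ i, (T1 i M x + T2 i M x) := by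
      intro M
      refine (mul_le_mul' le_rfl (WD_vec hn v _ _)).trans ?_
      rw [Finset.mul_sum]
      refine Finset.sum_le_sum fun i _ => ?_
      have e1 : (fun k => v k i) = fun k => fderiv ℝ b x (e i) * (A0 * op (kP φ A0 k) f x) +
          (2 * A i * L) * op (kS (LineDeriv.lineDerivOp (e i) φ) (A i) L b k) f x := by
        funext k
        exact grad_comm φ k hfi hbf hx i h0 (hA i).pos hL'
      have hAi := (hA i).pos
      rw [e1]
      refine (mul_le_mul' le_rfl (W_comp (c := lam / n / 2) h0 hL' (by positivity : 0 < 2 * A i * (L:ℝ)) (hβ i)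
        (fun k => op (kP φ A0 k) f x) (fun k => op (kS (LineDeriv.lineDerivOp (e i) φ) (A i) L b k) f x)
        (-(M:ℤ)) M rfl)).trans (le_of_eq ?_)
      rw [mul_add, hT1, hT2]
      beta_reduce
      rw [show lam / n / 2 / (L * A0) = lam / (2 * n * A0 * L) by field_simp,
        show lam / n / 2 / (2 * A i * L) = lam / (4 * n * A i * L) by field_simp; norm_num]
    have hj := jump_le_WD (fun (k : ℤ) x =>
              gradient (fun z => b z * schwartzConv n φ k f z -
                schwartzConv n φ k (fun y => b y * f y) z) x) lam x
    have hsup : ENNReal.ofReal (lam ^ 2) * jumpCountE (fun (k : ℤ) x =>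
              gradient (fun z => b z * schwartzConv n φ k f z -
                schwartzConv n φ k (fun y => b y * f y) z) x) lam x ≤ ⨆ M, ∑ i, (T1 i M x + T2 i M x) := by
      refine (mul_le_mul' le_rfl hj).trans ?_
      rw [ENNReal.mul_iSup]
      exact iSup_mono hwin
    have e2 : (⨆ M, G M x) = (⨆ M, ∑ i, (T1 i M x + T2 i M x)) ^ (p / 2) :=
      ((ENNReal.orderIsoRpow (p / 2) hq).map_iSup _).symm
    rw [e2]
    refine le_trans (le_of_eq ?_) (ENNReal.rpow_le_rpow hsup hq.le)
    rw [ENNReal.mul_rpow_of_nonneg _ _ (by linarith), ENNReal.mul_rpow_of_nonneg _ _ hq.le, ← ENNReal.rpow_mul,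
      ENNReal.ofReal_pow hl.le, ← ENNReal.rpow_natCast, ← ENNReal.rpow_mul]
    congr 2
    · push_cast; ring
    · ring
  refine (lintegral_mono_ae hpt).trans ?_
  rw [lintegral_iSup mG monG]
  refine iSup_le fun M => ?_
  have hAM : ∀ x, G M x ≤ (n : ℝ≥0∞) ^ (p / 2) * ∑ i, 2 ^ (p / 2) * (T1 i M x ^ (p / 2) + T2 i M x ^ (p / 2)) := by
    intro x
    have := sum_rpow_le Finset.univ (fun i => T1 i M x + T2 i M x) hq
    rw [Finset.card_univ, Fintype.card_fin] at this
    exact this.trans (mul_le_mul' le_rfl (Finset.sum_le_sum fun i _ => add_rpow_le' _ _ hq))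
  refine (lintegral_mono hAM).trans ?_
  have hmi : ∀ i, Measurable fun x => (2:ℝ≥0∞) ^ (p / 2) * (T1 i M x ^ (p / 2) + T2 i M x ^ (p / 2)) := fun i =>
    (((mT1 i M).pow_const _).add ((mT2 i M).pow_const _)).const_mul _
  rw [lintegral_const_mul' _ _ (ENNReal.rpow_ne_top_of_nonneg hq.le (ENNReal.natCast_ne_top n)),
    lintegral_finsetSum _ (fun i _ => hmi i)]
  have hi : ∀ i, ∫⁻ x, 2 ^ (p / 2) * (T1 i M x ^ (p / 2) + T2 i M x ^ (p / 2)) ≤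
      ENNReal.ofReal L ^ p * (2 ^ (p / 2) *
    (ENNReal.ofReal (2 * n * A0) ^ p * (C9 n p (CP φ A0) * CM n p) +
      ENNReal.ofReal (4 * n * A i) ^ p * (C9 n p (CS φ A0 (A i)) * CM n p))) * ∫⁻ x, ‖f x‖ₑ ^ p := by
    intro i
    have hAi := (hA i).pos
    rw [lintegral_const_mul' _ _ (ENNReal.rpow_ne_top_of_nonneg hq.le (by simp)),
      lintegral_add_left ((mT1 i M).pow_const _)]
    have a1 := resc_int hn (kP_ker hA0) (by unfold CP; positivity) (kP_K4 φ A0) hNice hp M hpos hl hL'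
      (c := 2 * n * A0) (by positivity)
    have a2 := resc_int hn (kerS i) CS_nonneg (kS_K4 hA0 hAi hL hb (e i) (hen i)) hNice hp M hpos hl hL'
      (c := 4 * n * A i) (by positivity)
    refine (mul_le_mul' le_rfl (add_le_add a1 a2)).trans (le_of_eq ?_)
    ring
  refine (mul_le_mul' le_rfl (Finset.sum_le_sum fun i _ => hi i)).trans (le_of_eq ?_)
  rw [← Finset.sum_mul, ← Finset.mul_sum, CF]
  ring

lemma zero_case {p lam : ℝ} (hp : 1 < p) (hl : 0 < lam) (F : ℤ → E n → E n) (hF : ∀ k x, F k x = 0) :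
    (∫⁻ x, (ENNReal.ofReal lam * (jumpCountE F lam x) ^ ((1:ℝ)/2)) ^ p) ^ (1/p) = 0 := by
  have h0 : ∀ x, jumpCountE F lam x = 0 := by
    intro x
    refine le_antisymm (iSup₂_le fun N hN => ?_) zero_le
    obtain ⟨t, _, h⟩ := hN
    rcases N with _ | N
    · simp
    · have := h 0
      rw [hF, hF, sub_self, norm_zero] at this
      exact absurd this (not_lt.2 hl.le)
  have hp0 : 0 < p := by linarith
  have : ∀ x, (ENNReal.ofReal lam * (jumpCountE F lam x) ^ ((1:ℝ)/2)) ^ p = 0 := by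
    intro x
    rw [h0, ENNReal.zero_rpow_of_pos (by norm_num), mul_zero, ENNReal.zero_rpow_of_pos hp0]
  simp_rw [this]
  rw [lintegral_zero, ENNReal.zero_rpow_of_pos (by positivity)]

end JV

theorem stmt6 (n : ℕ) (hn : 1 ≤ n) (p : ℝ) (hp : 1 < p)
    (φ : SchwartzMap (EuclideanSpace ℝ (Fin n)) ℝ) :
    ∃ C : ℝ, 0 < C ∧
      ∀ (b : EuclideanSpace ℝ (Fin n) → ℝ) (L : ℝ≥0), LipschitzWith L b →
      ∀ f : EuclideanSpace ℝ (Fin n) → ℝ, ContDiff ℝ 1 f → HasCompactSupport f →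
      ∀ lam : ℝ, 0 < lam →
      (∫⁻ x, (ENNReal.ofReal lam *
          (jumpCountE (fun (k : ℤ) x =>
              gradient (fun z => b z * schwartzConv n φ k f z -
                schwartzConv n φ k (fun y => b y * f y) z) x) lam x)
            ^ ((1:ℝ)/2)) ^ p) ^ (1/p)
        ≤ ENNReal.ofReal C * (L : ℝ≥0∞) * eLpNorm f (ENNReal.ofReal p) volume := by
  have hp0 : 0 < p := by linarith
  obtain ⟨A0, hA0⟩ := JV.ScB_ex φ
  choose A hA using fun i : Fin n =>
    JV.ScB_ex (LineDeriv.lineDerivOp (EuclideanSpace.single i 1 : JV.E n) φ)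
  have hCF := JV.CF_ne_top hp φ A0 A
  have hCF' : (JV.CF n p φ A0 A) ^ (1 / p) ≠ ∞ := ENNReal.rpow_ne_top_of_nonneg (by positivity) hCF
  refine ⟨((JV.CF n p φ A0 A) ^ (1 / p)).toReal + 1, by positivity, ?_⟩
  intro b L hb f hf hfs lam hl
  by_cases hL : L = 0
  · rw [JV.zero_case hp hl]
    · exact zero_le
    intro k x
    have hbc : ∀ y z, b y = b z := fun y z => by
      have := hb.dist_le_mul y z
      rw [hL] at this
      simpa using this
    have : (fun z => b z * schwartzConv n φ k f z - schwartzConv n φ k (fun y => b y * f y) z) = fun _ => 0 := by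
      funext z
      have e1 : (fun y => b y * f y) = fun y => b z * f y := funext fun y => by rw [hbc y z]
      rw [e1, JV.sconv_sc, JV.sconv_sc, ← integral_const_mul, sub_eq_zero]
      congr 1; funext y; ring
    rw [this]
    simp [gradient]
  by_cases hf0 : f = 0
  · rw [JV.zero_case hp hl]
    · exact zero_le
    intro k x
    have : (fun z => b z * schwartzConv n φ k f z - schwartzConv n φ k (fun y => b y * f y) z) = fun _ => 0 := by
      funext z
      simp [hf0, schwartzConv]
    rw [this]
    simp [gradient]
  have hLp : 0 < L := pos_iff_ne_zero.2 hL
  have key := JV.main_est hn hp hA0 hA hLp hb hf.continuous hfs hf0 hl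
  refine (ENNReal.rpow_le_rpow key (by positivity)).trans ?_
  rw [ENNReal.mul_rpow_of_nonneg _ _ (by positivity), ENNReal.mul_rpow_of_nonneg _ _ (by positivity),
    ← ENNReal.rpow_mul, mul_one_div_cancel hp0.ne', ENNReal.rpow_one,
    eLpNorm_eq_lintegral_rpow_enorm_toReal (by simpa using hp0) ofReal_ne_top, ENNReal.toReal_ofReal hp0.le,
    ENNReal.ofReal_coe_nnreal]
  refine mul_le_mul' ?_ le_rfl
  rw [mul_comm]
  refine mul_le_mul' ?_ le_rfl
  rw [← ENNReal.ofReal_toReal hCF']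
  exact ENNReal.ofReal_le_ofReal (by rw [ENNReal.toReal_ofReal ENNReal.toReal_nonneg]; linarith)
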